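/- arXiv:math/0301275 — 5 statements merged into one kernel-verified Lean document; each statement's English description precedes it below -/
import Mathlib

section
/- There are absolute constants η > 0 and C < ∞ such that for every positive integer k there are signs {ε_{i,j}}_{i,j=1}^k ∈ {−1,1}^{k²} with the following property: letting B be the k×k matrix with entries ε_{i,j}, A = [√k I_k, B] and Ā = [−B*, √k I_k] (k×2k matrices), one has for all a ∈ S^{k−1}: C^{-1} ≤ ‖aA‖_{L_1^{2k}} ≤ ‖aA‖_{L_2^{2k}} ≤ C and C^{-1} ≤ ‖aĀ‖_{L_1^{2k}} ≤ ‖aĀ‖_{L_2^{2k}} ≤ C. Moreover, this property holds with probability larger than 1 − e^{−η k} when the ε_{i,j} are i.i.d. uniform ±1. -/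
open Finset

/-- The sign `±1` associated to a boolean. -/
noncomputable def sgn (b : Bool) : ℝ := if b then 1 else -1

open scoped Classical in
/-- The probability, under the uniform measure on sign arrays
`{ε_{i,j}}_{i,j=1}^k ∈ {−1,1}^{k²}`, of an event `pred`. -/
noncomputable def signProb (k : ℕ) (pred : (Fin k → Fin k → Bool) → Prop) : ℝ :=
  ((Finset.univ : Finset (Fin k → Fin k → Bool)).filter pred).card / 2 ^ (k * k)

/-- The row vector `aA ∈ ℝ^{2k}` where `A = [√k I_k, B]` and `B` is the sign matrix with
entries `B i j = ε i j`. The `2k` coordinates are indexed by `Fin k ⊕ Fin k`. -/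
noncomputable def rowA (k : ℕ) (ε : Fin k → Fin k → Bool) (a : Fin k → ℝ) :
    Fin k ⊕ Fin k → ℝ :=
  Sum.elim (fun j => Real.sqrt k * a j) (fun j => ∑ i, a i * sgn (ε i j))

/-- The row vector `aĀ ∈ ℝ^{2k}` where `Ā = [−B*, √k I_k]`. -/
noncomputable def rowAbar (k : ℕ) (ε : Fin k → Fin k → Bool) (a : Fin k → ℝ) :
    Fin k ⊕ Fin k → ℝ :=
  Sum.elim (fun j => -∑ i, a i * sgn (ε j i)) (fun j => Real.sqrt k * a j)

/-- The `L_1^{2k}` norm of a vector in `ℝ^{2k}`. -/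
noncomputable def L1norm (k : ℕ) (x : Fin k ⊕ Fin k → ℝ) : ℝ :=
  (2 * (k : ℝ))⁻¹ * ∑ j, |x j|

/-- The `L_2^{2k}` norm of a vector in `ℝ^{2k}`. -/
noncomputable def L2norm (k : ℕ) (x : Fin k ⊕ Fin k → ℝ) : ℝ :=
  Real.sqrt ((2 * (k : ℝ))⁻¹ * ∑ j, x j ^ 2)

/-- The Kashin splitting property of the sign matrix `B = (ε i j)` with constant `C`:
for all `a` in the Euclidean unit sphere of `ℝ^k`,
`C⁻¹ ≤ ‖aA‖_{L_1^{2k}} ≤ ‖aA‖_{L_2^{2k}} ≤ C` and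
`C⁻¹ ≤ ‖aĀ‖_{L_1^{2k}} ≤ ‖aĀ‖_{L_2^{2k}} ≤ C`. -/
def KashinGood (k : ℕ) (C : ℝ) (ε : Fin k → Fin k → Bool) : Prop :=
  ∀ a : Fin k → ℝ, (∑ i, a i ^ 2) = 1 →
    (C⁻¹ ≤ L1norm k (rowA k ε a) ∧ L1norm k (rowA k ε a) ≤ L2norm k (rowA k ε a) ∧
      L2norm k (rowA k ε a) ≤ C) ∧
    (C⁻¹ ≤ L1norm k (rowAbar k ε a) ∧ L1norm k (rowAbar k ε a) ≤ L2norm k (rowAbar k ε a) ∧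
      L2norm k (rowAbar k ε a) ≤ C)


lemma sgn_sq (b : Bool) : sgn b ^ 2 = 1 := by cases b <;> simp [sgn]

lemma sgn_abs (b : Bool) : |sgn b| = 1 := by cases b <;> simp [sgn]

lemma kg_pi_sum {R : Type*} [CommSemiring R] {n : ℕ} {β : Type*} [Fintype β]
    (g : Fin n → β → R) :
    ∑ v : Fin n → β, ∏ i, g i (v i) = ∏ i, ∑ c, g i c := by
  classical
  rw [Finset.prod_univ_sum, Fintype.piFinset_univ]

/-- Hoeffding -/
lemma kg_hoeffding (k : ℕ) (c : Fin k → Fin k → ℝ) :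
    ∑ ε : Fin k → Fin k → Bool, Real.exp (∑ i, ∑ j, c i j * sgn (ε i j)) ≤
      2 ^ (k * k) * Real.exp ((∑ i, ∑ j, c i j ^ 2) / 2) := by
  have h1 : ∀ ε : Fin k → Fin k → Bool, Real.exp (∑ i, ∑ j, c i j * sgn (ε i j)) =
      ∏ i, (fun i (r : Fin k → Bool) => ∏ j, Real.exp (c i j * sgn (r j))) i (ε i) := by
    intro ε
    simp only [Real.exp_sum]
  rw [Finset.sum_congr rfl (fun ε _ => h1 ε), kg_pi_sum (fun i (r : Fin k → Bool) => ∏ j, Real.exp (c i j * sgn (r j)))]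
  have h2 : ∀ i : Fin k, ∑ r : Fin k → Bool, ∏ j, Real.exp (c i j * sgn (r j)) ≤
      2 ^ k * Real.exp ((∑ j, c i j ^ 2) / 2) := by
    intro i
    rw [kg_pi_sum (fun j b => Real.exp (c i j * sgn b))]
    have : (2:ℝ) ^ k * Real.exp ((∑ j, c i j ^ 2) / 2) =
        ∏ j : Fin k, (2 * Real.exp (c i j ^ 2 / 2)) := by
      rw [Finset.prod_mul_distrib, ← Real.exp_sum, Finset.sum_div]; simp
    rw [this]
    apply Finset.prod_le_prod
    · intro j _; positivity
    · intro j _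
      have := Real.cosh_le_exp_half_sq (c i j)
      rw [Real.cosh_eq] at this
      simp [sgn]
      linarith
  calc _ ≤ ∏ i : Fin k, (2 ^ k * Real.exp ((∑ j, c i j ^ 2) / 2)) := by
        apply Finset.prod_le_prod
        · intro i _; positivity
        · intro i _; exact h2 i
    _ = _ := by
        rw [Finset.prod_mul_distrib, ← Real.exp_sum, Finset.sum_div]; simp [pow_mul]

lemma kg_exp_le (t : ℝ) : Real.exp (-|t|) ≤ 2 / 3 + Real.cos t / 3 := by
  have h0 := abs_nonneg t
  have h1 : Real.exp (-|t|) ≤ 1 / (1 + |t|) := by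
    rw [Real.exp_neg, ← one_div]
    apply one_div_le_one_div_of_le (by positivity)
    linarith [Real.add_one_le_exp |t|]
  by_cases ht : |t| ≤ 2
  · have h2 := Real.one_sub_sq_div_two_le_cos (x := t)
    have h3 : t ^ 2 = |t| ^ 2 := (sq_abs t).symm
    have h4 : 1 / (1 + |t|) ≤ 1 - |t| / 3 := by
      rw [div_le_iff₀ (by positivity)]; nlinarith
    nlinarith
  · push Not at ht
    have h4 : 1 / (1 + |t|) ≤ 1 / 3 := one_div_le_one_div_of_le (by norm_num) (by linarith)
    linarith [Real.neg_one_le_cos t]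

lemma kg_cos_sum (k : ℕ) (b : Fin k → ℝ) :
    ∑ v : Fin k → Bool, Real.cos (∑ i, b i * sgn (v i)) = 2 ^ k * ∏ i, Real.cos (b i) := by
  have h : ∑ v : Fin k → Bool, Complex.exp ((∑ i, b i * sgn (v i) : ℝ) * Complex.I) =
      ((2 ^ k * ∏ i, Real.cos (b i) : ℝ) : ℂ) := by
    have h1 : ∀ v : Fin k → Bool, Complex.exp ((∑ i, b i * sgn (v i) : ℝ) * Complex.I) =
      ∏ i, Complex.exp ((b i * sgn (v i) : ℝ) * Complex.I) := by
      intro v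
      rw [← Complex.exp_sum]; push_cast; rw [Finset.sum_mul]
    simp_rw [h1]
    rw [kg_pi_sum (fun i c => Complex.exp ((b i * sgn c : ℝ) * Complex.I))]
    push_cast
    have : (2:ℂ) ^ k * ∏ i, Complex.cos (b i) = ∏ i : Fin k, (2 * Complex.cos (b i)) := by
      rw [Finset.prod_mul_distrib]; simp
    rw [this]
    apply Finset.prod_congr rfl
    intro i _
    rw [Complex.two_cos]
    simp [sgn]
  have := congrArg Complex.re h
  rw [Complex.re_sum, Complex.ofReal_re] at this
  simpa only [Complex.exp_ofReal_mul_I_re] using this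

lemma kg_one_add_sum {ι : Type*} (s : Finset ι) (f : ι → ℝ) (hf : ∀ i, 0 ≤ f i) :
    1 + ∑ i ∈ s, f i ≤ ∏ i ∈ s, (1 + f i) := by
  classical
  induction s using Finset.induction_on with
  | empty => simp
  | insert a s ha ih =>
    rw [Finset.sum_insert ha, Finset.prod_insert ha]
    have := Finset.sum_nonneg (fun i (_ : i ∈ s) => hf i)
    nlinarith [hf a, mul_nonneg (hf a) this, mul_le_mul_of_nonneg_left ih (hf a)]

lemma kg_cos_prod (k : ℕ) (b : Fin k → ℝ) (hb : ∀ i, |b i| ≤ 1) (hs : 1 / 2 ≤ ∑ i, b i ^ 2) :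
    ∏ i, Real.cos (b i) ≤ 0.82 := by
  have hpi := Real.pi_gt_three
  have h1 : ∀ i, Real.cos (b i) ^ 2 * (1 + b i ^ 2) ≤ 1 := by
    intro i
    have ⟨h1, h2⟩ := abs_le.1 (hb i)
    have h := Real.cos_le_one_div_sqrt_sq_add_one (x := b i) (by linarith) (by linarith)
    have h0 : 0 ≤ Real.cos (b i) := Real.cos_nonneg_of_mem_Icc ⟨by linarith, by linarith⟩
    have h3 := pow_le_pow_left₀ h0 h 2
    rw [div_pow, Real.sq_sqrt (by positivity), one_pow, le_div_iff₀ (by positivity)] at h3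
    linarith
  have h2 : (∏ i, Real.cos (b i)) ^ 2 * ∏ i, (1 + b i ^ 2) ≤ 1 := by
    rw [← Finset.prod_pow, ← Finset.prod_mul_distrib]
    apply Finset.prod_le_one
    · intro i _; positivity
    · intro i _; exact h1 i
  have h3 := kg_one_add_sum Finset.univ (fun i => b i ^ 2) (fun i => sq_nonneg _)
  by_contra hcon
  push Not at hcon
  nlinarith [sq_nonneg (∏ i, Real.cos (b i))]

/-- Laplace transform of the L1 norm. -/
lemma kg_laplace (k : ℕ) (b : Fin k → ℝ) (hb : ∀ i, |b i| ≤ 1) (hs : 1 / 2 ≤ ∑ i, b i ^ 2) :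
    ∑ ε : Fin k → Fin k → Bool, Real.exp (-∑ j, |∑ i, b i * sgn (ε j i)|) ≤
      2 ^ (k * k) * Real.exp (-(0.06 * k)) := by
  have h1 : ∀ ε : Fin k → Fin k → Bool, Real.exp (-∑ j, |∑ i, b i * sgn (ε j i)|) =
      ∏ j, (fun (_ : Fin k) (r : Fin k → Bool) => Real.exp (-|∑ i, b i * sgn (r i)|)) j (ε j) := by
    intro ε
    simp only [← Real.exp_sum, Finset.sum_neg_distrib]
  rw [Finset.sum_congr rfl (fun ε _ => h1 ε),
    kg_pi_sum (fun (_ : Fin k) (r : Fin k → Bool) => Real.exp (-|∑ i, b i * sgn (r i)|))]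
  have h2 : ∑ r : Fin k → Bool, Real.exp (-|∑ i, b i * sgn (r i)|) ≤ 2 ^ k * Real.exp (-0.06) := by
    calc _ ≤ ∑ r : Fin k → Bool, (2 / 3 + Real.cos (∑ i, b i * sgn (r i)) / 3) :=
          Finset.sum_le_sum (fun r _ => kg_exp_le _)
      _ = 2 ^ k * (2 / 3 + (∏ i, Real.cos (b i)) / 3) := by
          rw [Finset.sum_add_distrib, ← Finset.sum_div _ (fun r : Fin k → Bool => Real.cos _), kg_cos_sum]
          simp; ring
      _ ≤ _ := by
          have := kg_cos_prod k b hb hs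
          have h3 := Real.add_one_le_exp (-0.06)
          gcongr
          linarith
  calc _ ≤ ∏ i : Fin k, ((2:ℝ) ^ k * Real.exp (-0.06)) := by
        apply Finset.prod_le_prod
        · intro i _; positivity
        · intro i _; exact h2
    _ = _ := by
        simp only [Finset.prod_const, Finset.card_univ, Fintype.card_fin, mul_pow, ← pow_mul,
          ← Real.exp_nat_mul]
        congr 2; ring

/-- Lattice points. -/
noncomputable def kgNet (k m : ℕ) : Finset (Fin k → ℤ) :=
  (Fintype.piFinset (fun _ : Fin k => Finset.Icc (-(m:ℤ)) m)).filter
    (fun z => ∑ i, (z i).natAbs ≤ m)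

lemma kg_mem_net {k m : ℕ} {z : Fin k → ℤ} (h : ∑ i, (z i).natAbs ≤ m) : z ∈ kgNet k m := by
  simp only [kgNet, Finset.mem_filter, Fintype.mem_piFinset, Finset.mem_Icc]
  refine ⟨fun i => ?_, h⟩
  have := Finset.single_le_sum (f := fun i => (z i).natAbs) (fun _ _ => Nat.zero_le _)
    (Finset.mem_univ i)
  omega

lemma kg_geom (m : ℕ) (x : ℝ) (hx1 : x < 1) :
    ∑ j ∈ Finset.Icc (-(m:ℤ)) m, x ^ j.natAbs = (1 + x - 2 * x ^ (m + 1)) / (1 - x) := by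
  have h1 : 1 - x ≠ 0 := by linarith
  induction m with
  | zero => simp; field_simp; ring
  | succ m ih =>
    have : Finset.Icc (-((m + 1 : ℕ):ℤ)) ((m + 1 : ℕ):ℤ) =
        insert (-((m:ℤ) + 1)) (insert ((m:ℤ) + 1) (Finset.Icc (-(m:ℤ)) m)) := by
      ext j; simp only [Finset.mem_Icc, Finset.mem_insert]; push_cast; omega
    rw [this, Finset.sum_insert, Finset.sum_insert, ih]
    · have e1 : ((m:ℤ) + 1).natAbs = m + 1 := by omega
      rw [Int.natAbs_neg, e1]
      field_simp; ring
    · simp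
    · simp only [Finset.mem_Icc, Finset.mem_insert]; omega

lemma kg_net_card (k m : ℕ) (x : ℝ) (hx : 0 < x) (hx1 : x < 1) :
    ((kgNet k m).card : ℝ) * x ^ m ≤ ((1 + x) / (1 - x)) ^ k := by
  have h1 : ((kgNet k m).card : ℝ) * x ^ m ≤ ∑ z ∈ kgNet k m, ∏ i, x ^ (z i).natAbs := by
    rw [← nsmul_eq_mul]
    apply Finset.card_nsmul_le_sum
    intro z hz
    rw [Finset.prod_pow_eq_pow_sum]
    exact pow_le_pow_of_le_one hx.le hx1.le (Finset.mem_filter.1 hz).2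
  have h2 : ∑ z ∈ kgNet k m, ∏ i, x ^ (z i).natAbs ≤
      ∑ z ∈ (Fintype.piFinset (fun _ : Fin k => Finset.Icc (-(m:ℤ)) m)),
        ∏ i, x ^ (z i).natAbs := by
    apply Finset.sum_le_sum_of_subset_of_nonneg (Finset.filter_subset _ _)
    intro z _ _; positivity
  refine h1.trans (h2.trans ?_)
  rw [← Finset.prod_univ_sum (fun _ : Fin k => Finset.Icc (-(m:ℤ)) m)
    (fun _ (j : ℤ) => x ^ j.natAbs)]
  rw [kg_geom m x hx1]
  have h3 : 0 < 1 - x := by linarith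
  have h4 : x ^ (m + 1) ≤ x := by
    simpa using pow_le_pow_of_le_one hx.le hx1.le (show 1 ≤ m + 1 by omega)
  simp only [Finset.prod_const, Finset.card_univ, Fintype.card_fin]
  have h5 := pow_pos hx (m+1)
  apply pow_le_pow_left₀
  · apply div_nonneg _ h3.le; linarith
  · gcongr; linarith

lemma kg_round (t : ℝ) : ∃ z : ℤ, |t - z| ≤ 1 ∧ |(z:ℝ)| ≤ |t| := by
  rcases le_total 0 t with h | h
  · refine ⟨⌊t⌋, ?_, ?_⟩
    · rw [abs_le]; constructor <;> linarith [Int.floor_le t, Int.lt_floor_add_one t]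
    · have : (0:ℝ) ≤ ⌊t⌋ := by exact_mod_cast Int.floor_nonneg.2 h
      rw [abs_of_nonneg this, abs_of_nonneg h]; exact Int.floor_le t
  · refine ⟨⌈t⌉, ?_, ?_⟩
    · rw [abs_le]; constructor <;> linarith [Int.le_ceil t, Int.ceil_lt_add_one t]
    · have : (⌈t⌉:ℝ) ≤ 0 := by
        have : ⌈t⌉ ≤ 0 := Int.ceil_le.2 (by simpa using h)
        exact_mod_cast this
      rw [abs_of_nonpos this, abs_of_nonpos h]; linarith [Int.le_ceil t]

lemma kg_round_vec (k : ℕ) (h : ℝ) (hh : 0 < h) (a : Fin k → ℝ) :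
    ∃ z : Fin k → ℤ, (∀ i, |a i - h * z i| ≤ h) ∧ (∀ i, |h * z i| ≤ |a i|) ∧
      h * ((∑ i, (z i).natAbs : ℕ) : ℝ) ≤ ∑ i, |a i| := by
  choose z h1 h2 using fun i => kg_round (a i / h)
  have key : ∀ i, |h * z i| ≤ |a i| := by
    intro i
    have := h2 i
    rw [abs_div, abs_of_pos hh, le_div_iff₀ hh] at this
    rw [abs_mul, abs_of_pos hh]; linarith
  refine ⟨z, fun i => ?_, key, ?_⟩
  · have e : a i - h * z i = h * (a i / h - z i) := by field_simp
    rw [e, abs_mul, abs_of_pos hh]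
    nlinarith [h1 i]
  · push_cast
    rw [Finset.mul_sum]
    apply Finset.sum_le_sum
    intro i _
    have := key i
    rw [abs_mul, abs_of_pos hh] at this
    simpa using this

noncomputable def kgBil (k : ℕ) (ε : Fin k → Fin k → Bool) (x y : Fin k → ℝ) : ℝ :=
  ∑ i, ∑ j, x i * y j * sgn (ε i j)

def kgOp (k : ℕ) (ε : Fin k → Fin k → Bool) : Prop :=
  ∀ x y : Fin k → ℝ, ∑ i, x i ^ 2 ≤ 1 → ∑ i, y i ^ 2 ≤ 1 → kgBil k ε x y ≤ 10 * Real.sqrt k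

def kgLow (k : ℕ) (ε : Fin k → Fin k → Bool) : Prop :=
  ∀ a : Fin k → ℝ, ∑ i, a i ^ 2 = 1 →
    (1 / 1200000 * Real.sqrt k ≤ ∑ i, |a i| ∨ 0.005 * (k:ℝ) ≤ ∑ j, |∑ i, a i * sgn (ε j i)|)

lemma kg_bil_add_left (k : ℕ) (ε : Fin k → Fin k → Bool) (x x' y : Fin k → ℝ) (c : ℝ) :
    kgBil k ε (fun i => x i + c * x' i) y = kgBil k ε x y + c * kgBil k ε x' y := by
  simp only [kgBil, Finset.mul_sum, ← Finset.sum_add_distrib]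
  refine Finset.sum_congr rfl fun i _ => Finset.sum_congr rfl fun j _ => ?_
  ring

lemma kg_bil_add_right (k : ℕ) (ε : Fin k → Fin k → Bool) (x y y' : Fin k → ℝ) (c : ℝ) :
    kgBil k ε x (fun i => y i + c * y' i) = kgBil k ε x y + c * kgBil k ε x y' := by
  simp only [kgBil, Finset.mul_sum, ← Finset.sum_add_distrib]
  refine Finset.sum_congr rfl fun i _ => Finset.sum_congr rfl fun j _ => ?_
  ring

lemma kg_abs_le_one {k : ℕ} {x : Fin k → ℝ} (h : ∑ i, x i ^ 2 ≤ 1) (i : Fin k) : |x i| ≤ 1 := by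
  have := Finset.single_le_sum (f := fun i => x i ^ 2) (fun _ _ => sq_nonneg _)
    (Finset.mem_univ i)
  have h2 : x i ^ 2 ≤ 1 := le_trans this h
  exact (sq_le_one_iff_abs_le_one _).1 h2

lemma kg_bil_le (k : ℕ) (ε : Fin k → Fin k → Bool) (x y : Fin k → ℝ)
    (hx : ∑ i, x i ^ 2 ≤ 1) (hy : ∑ i, y i ^ 2 ≤ 1) : kgBil k ε x y ≤ k := by
  have h : ∀ i j, x i * y j * sgn (ε i j) ≤ (x i ^ 2 + y j ^ 2) / 2 := by
    intro i j
    have := sgn_sq (ε i j)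
    nlinarith [sq_nonneg (x i - y j * sgn (ε i j))]
  calc kgBil k ε x y ≤ ∑ i, ∑ j, (x i ^ 2 + y j ^ 2) / 2 :=
        Finset.sum_le_sum fun i _ => Finset.sum_le_sum fun j _ => h i j
    _ = (k * ∑ i, x i ^ 2 + k * ∑ j, y j ^ 2) / 2 := by
        simp only [← Finset.sum_div, Finset.sum_add_distrib, Finset.sum_const, Finset.card_univ,
          Fintype.card_fin, nsmul_eq_mul, ← Finset.mul_sum]
    _ ≤ k := by
        have : (0:ℝ) ≤ k := Nat.cast_nonneg k
        nlinarith

lemma kg_l1_le {k : ℕ} (x : Fin k → ℝ) (r : ℝ) (hr : 0 ≤ r) (hx : ∑ i, x i ^ 2 ≤ r ^ 2) :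
    ∑ i, |x i| ≤ Real.sqrt k * r := by
  have h := sq_sum_le_card_mul_sum_sq (s := Finset.univ) (f := fun i => |x i|)
  simp only [Finset.card_univ, Fintype.card_fin, sq_abs] at h
  apply abs_le_of_sq_le_sq' _ (by positivity) |>.2
  rw [mul_pow, Real.sq_sqrt (Nat.cast_nonneg k)]
  exact h.trans (mul_le_mul_of_nonneg_left hx (Nat.cast_nonneg k))

/-- decomposition for the quarter net -/
lemma kg_decomp (k : ℕ) (hk : 0 < k) (x : Fin k → ℝ) (hx : ∑ i, x i ^ 2 ≤ 1) :
    ∃ z ∈ kgNet k (4 * k), ∃ x' : Fin k → ℝ,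
      ∑ i, ((4 * Real.sqrt k)⁻¹ * z i) ^ 2 ≤ 1 ∧ ∑ i, x' i ^ 2 ≤ 1 ∧
      x = fun i => (4 * Real.sqrt k)⁻¹ * z i + 1 / 4 * x' i := by
  have hk' : (0:ℝ) < k := by exact_mod_cast hk
  have hs : 0 < Real.sqrt k := Real.sqrt_pos.2 hk'
  have hss : Real.sqrt k ^ 2 = k := Real.sq_sqrt hk'.le
  set h := (4 * Real.sqrt k)⁻¹ with hh
  have hpos : 0 < h := by positivity
  obtain ⟨z, h1, h2, h3⟩ := kg_round_vec k h hpos x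
  refine ⟨z, kg_mem_net ?_, fun i => 4 * (x i - h * z i), ?_, ?_, ?_⟩
  · have h4 := h3.trans (kg_l1_le x 1 zero_le_one (by simpa using hx))
    rw [hh, inv_mul_le_iff₀ (by positivity)] at h4
    have : ((∑ i, (z i).natAbs : ℕ) : ℝ) ≤ ((4 * k : ℕ) : ℝ) := by
      push_cast at h4 ⊢; nlinarith
    exact_mod_cast this
  · refine le_trans (Finset.sum_le_sum fun i _ => ?_) hx
    exact sq_le_sq.2 (h2 i)
  · have : ∀ i ∈ Finset.univ, (4 * (x i - h * z i)) ^ 2 ≤ (k:ℝ)⁻¹ := by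
      intro i _
      have h5 : (x i - h * z i) ^ 2 ≤ h ^ 2 := sq_le_sq.2 (by rw [abs_of_pos hpos]; exact h1 i)
      have h6 : h ^ 2 = (k:ℝ)⁻¹ / 16 := by
        rw [hh, inv_pow, mul_pow, hss]; field_simp; norm_num
      nlinarith
    refine (Finset.sum_le_sum this).trans ?_
    simp [hk'.ne']
  · funext i; ring

lemma kg_op_of_net (k : ℕ) (hk : 0 < k) (ε : Fin k → Fin k → Bool)
    (H : ∀ z ∈ kgNet k (4 * k), ∀ w ∈ kgNet k (4 * k),
      ∑ i, ((4 * Real.sqrt k)⁻¹ * z i) ^ 2 ≤ 1 → ∑ i, ((4 * Real.sqrt k)⁻¹ * w i) ^ 2 ≤ 1 →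
      kgBil k ε (fun i => (4 * Real.sqrt k)⁻¹ * z i) (fun i => (4 * Real.sqrt k)⁻¹ * w i) ≤
        5 * Real.sqrt k) : kgOp k ε := by
  set T : Set ℝ := {t | ∃ x y : Fin k → ℝ, ∑ i, x i ^ 2 ≤ 1 ∧ ∑ i, y i ^ 2 ≤ 1 ∧
    t = kgBil k ε x y} with hT
  have hbdd : BddAbove T := ⟨k, by
    rintro t ⟨x, y, hx, hy, rfl⟩; exact kg_bil_le k ε x y hx hy⟩
  have hne : T.Nonempty := ⟨_, 0, 0, by simp, by simp, rfl⟩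
  have hle : ∀ x y : Fin k → ℝ, ∑ i, x i ^ 2 ≤ 1 → ∑ i, y i ^ 2 ≤ 1 →
      kgBil k ε x y ≤ sSup T := fun x y hx hy => le_csSup hbdd ⟨x, y, hx, hy, rfl⟩
  have hS : sSup T ≤ 5 * Real.sqrt k + sSup T / 2 := by
    apply csSup_le hne
    rintro t ⟨x, y, hx, hy, rfl⟩
    obtain ⟨z, hz, x', hz1, hx', ex⟩ := kg_decomp k hk x hx
    obtain ⟨w, hw, y', hw1, hy', ey⟩ := kg_decomp k hk y hy
    have e : kgBil k ε x y = kgBil k ε (fun i => (4 * Real.sqrt k)⁻¹ * z i)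
        (fun i => (4 * Real.sqrt k)⁻¹ * w i)
        + 1 / 4 * kgBil k ε (fun i => (4 * Real.sqrt k)⁻¹ * z i) y' + 1 / 4 * kgBil k ε x' y := by
      conv_lhs => rw [ex]
      rw [kg_bil_add_left]
      conv_lhs => enter [1]; rw [ey]
      rw [kg_bil_add_right]
    rw [e]
    have a1 := H z hz w hw hz1 hw1
    have a2 := hle _ _ hz1 hy'
    have a3 := hle _ _ hx' hy
    linarith
  intro x y hx hy
  have := hle x y hx hy
  linarith

lemma kg_op_sq (k : ℕ) (ε : Fin k → Fin k → Bool) (h : kgOp k ε) (y : Fin k → ℝ)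
    (hy : ∑ i, y i ^ 2 ≤ 1) : ∑ i, (∑ j, y j * sgn (ε i j)) ^ 2 ≤ 100 * k := by
  set v : Fin k → ℝ := fun i => ∑ j, y j * sgn (ε i j) with hv
  change ∑ i, v i ^ 2 ≤ _
  have h0 : 0 ≤ ∑ i, v i ^ 2 := Finset.sum_nonneg fun i _ => sq_nonneg _
  set s := Real.sqrt (∑ i, v i ^ 2) with hs
  have hss : s ^ 2 = ∑ i, v i ^ 2 := Real.sq_sqrt h0
  rcases (Real.sqrt_nonneg (∑ i, v i ^ 2)).eq_or_lt with h1 | h1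
  · rw [← hs] at h1
    rw [← hss, ← h1]; simp
  · rw [← hs] at h1
    have h2 := h (fun i => s⁻¹ * v i) y (by
      simp only [mul_pow, ← Finset.mul_sum, ← hss]
      rw [inv_pow, inv_mul_cancel₀ (by positivity)]) hy
    have e : kgBil k ε (fun i => s⁻¹ * v i) y = s := by
      have : kgBil k ε (fun i => s⁻¹ * v i) y = s⁻¹ * ∑ i, v i ^ 2 := by
        simp only [kgBil, Finset.mul_sum]
        refine Finset.sum_congr rfl fun i _ => ?_
        rw [sq]
        conv_rhs => enter [2, 2]; rw [hv]
        simp only [Finset.mul_sum]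
        refine Finset.sum_congr rfl fun j _ => ?_
        ring
      rw [this, ← hss]; field_simp
    rw [e] at h2
    rw [← hss]
    have h3 : Real.sqrt k ^ 2 = k := Real.sq_sqrt (Nat.cast_nonneg k)
    nlinarith [Real.sqrt_nonneg (k:ℝ)]

lemma kg_op_swap (k : ℕ) (ε : Fin k → Fin k → Bool) (h : kgOp k ε) :
    kgOp k (fun i j => ε j i) := by
  intro x y hx hy
  have := h y x hy hx
  rw [kgBil, Finset.sum_comm] at this
  rw [kgBil]
  refine le_trans (le_of_eq ?_) this
  refine Finset.sum_congr rfl fun i _ => Finset.sum_congr rfl fun j _ => ?_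
  ring

lemma kg_low_of_net (k : ℕ) (hk : 0 < k) (ε : Fin k → Fin k → Bool) (hop : kgOp k ε)
    (H : ∀ z ∈ kgNet k (k / 600),
      (∀ i, |(2000 * Real.sqrt k)⁻¹ * z i| ≤ 1) →
      1 / 2 ≤ ∑ i, ((2000 * Real.sqrt k)⁻¹ * z i) ^ 2 →
      0.01 * (k:ℝ) ≤ ∑ j, |∑ i, (2000 * Real.sqrt k)⁻¹ * z i * sgn (ε j i)|) : kgLow k ε := by
  intro a ha
  by_contra hcon
  push Not at hcon
  obtain ⟨hc1, hc2⟩ := hcon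
  have hk' : (0:ℝ) < k := by exact_mod_cast hk
  have hs : 0 < Real.sqrt k := Real.sqrt_pos.2 hk'
  have hss : Real.sqrt k ^ 2 = k := Real.sq_sqrt hk'.le
  set h := (2000 * Real.sqrt k)⁻¹ with hh
  have hpos : 0 < h := by positivity
  obtain ⟨z, h1, h2, h3⟩ := kg_round_vec k h hpos a
  have hz : z ∈ kgNet k (k / 600) := by
    apply kg_mem_net
    rw [Nat.le_div_iff_mul_le (by norm_num)]
    have h4 := h3.trans hc1.le
    rw [hh, inv_mul_le_iff₀ (by positivity)] at h4
    have : (((∑ i, (z i).natAbs) * 600 : ℕ) : ℝ) ≤ (k : ℝ) := by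
      push_cast at h4 ⊢; nlinarith
    exact_mod_cast this
  have hd : ∑ i, (a i - h * z i) ^ 2 ≤ (1 / 2000) ^ 2 := by
    have : ∀ i ∈ Finset.univ, (a i - h * z i) ^ 2 ≤ (k:ℝ)⁻¹ * (1 / 2000) ^ 2 := by
      intro i _
      have h5 : (a i - h * z i) ^ 2 ≤ h ^ 2 := sq_le_sq.2 (by rw [abs_of_pos hpos]; exact h1 i)
      have h6 : h ^ 2 = (k:ℝ)⁻¹ * (1 / 2000) ^ 2 := by
        rw [hh, inv_pow, mul_pow, hss]; field_simp
      linarith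
    refine (Finset.sum_le_sum this).trans ?_
    simp [hk'.ne']
  have hb : 1 / 2 ≤ ∑ i, (h * z i) ^ 2 := by
    have : ∑ i, a i ^ 2 ≤ ∑ i, (3 / 2 * (h * z i) ^ 2 + 3 * (a i - h * z i) ^ 2) := by
      refine Finset.sum_le_sum fun i _ => ?_
      nlinarith [sq_nonneg (h * z i - 2 * (a i - h * z i))]
    rw [Finset.sum_add_distrib, ← Finset.mul_sum, ← Finset.mul_sum, ha] at this
    norm_num at hd ⊢
    linarith
  have hlow := H z hz (fun i => (h2 i).trans (kg_abs_le_one ha.le i)) hb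
  have hsq := kg_op_sq k ε hop (fun i => 2000 * (a i - h * z i)) (by
    simp only [mul_pow, ← Finset.mul_sum]
    norm_num at hd ⊢
    linarith)
  have hl1 := kg_l1_le _ (10 * Real.sqrt k) (by positivity)
    (hsq.trans (by rw [mul_pow, hss]; norm_num))
  have htri : ∑ j, |∑ i, h * z i * sgn (ε j i)| ≤ ∑ j, |∑ i, a i * sgn (ε j i)| +
      1 / 2000 * ∑ j, |∑ i, 2000 * (a i - h * z i) * sgn (ε j i)| := by
    rw [Finset.mul_sum, ← Finset.sum_add_distrib]
    refine Finset.sum_le_sum fun j _ => ?_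
    have e : ∑ i, h * z i * sgn (ε j i) = ∑ i, a i * sgn (ε j i) -
        1 / 2000 * ∑ i, 2000 * (a i - h * z i) * sgn (ε j i) := by
      rw [Finset.mul_sum, ← Finset.sum_sub_distrib]
      refine Finset.sum_congr rfl fun i _ => ?_
      ring
    rw [e]
    refine (abs_sub _ _).trans ?_
    rw [abs_mul (1 / 2000 : ℝ), abs_of_pos (by norm_num : (0:ℝ) < 1 / 2000)]
  nlinarith

open scoped Classical in
lemma kg_markov {Ω : Type*} [Fintype Ω] (f : Ω → ℝ) (t : ℝ) (p : Ω → Prop)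
    (hp : ∀ ω, p ω → t ≤ f ω) :
    (((Finset.univ : Finset Ω).filter p).card : ℝ) * Real.exp t ≤ ∑ ω, Real.exp (f ω) := by
  calc _ ≤ ∑ ω ∈ (Finset.univ : Finset Ω).filter p, Real.exp (f ω) := by
        rw [← nsmul_eq_mul]
        apply Finset.card_nsmul_le_sum
        intro ω hω
        exact Real.exp_le_exp.2 (hp ω (Finset.mem_filter.1 hω).2)
    _ ≤ _ := Finset.sum_le_sum_of_subset_of_nonneg (Finset.filter_subset _ _)
        fun _ _ _ => (Real.exp_pos _).le

open scoped Classical in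
lemma kg_op_single (k : ℕ) (x y : Fin k → ℝ) :
    (((Finset.univ : Finset (Fin k → Fin k → Bool)).filter (fun ε =>
      ∑ i, x i ^ 2 ≤ 1 ∧ ∑ i, y i ^ 2 ≤ 1 ∧ 5 * Real.sqrt k < kgBil k ε x y)).card : ℝ) ≤
      2 ^ (k * k) * Real.exp (-(12.5 * k)) := by
  by_cases hx : ∑ i, x i ^ 2 ≤ 1
  swap
  · simp only [hx, false_and, Finset.filter_false, Finset.card_empty, Nat.cast_zero]; positivity
  by_cases hy : ∑ i, y i ^ 2 ≤ 1
  swap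
  · simp only [hy, false_and, and_false, Finset.filter_false, Finset.card_empty, Nat.cast_zero]; positivity
  have hss : Real.sqrt k ^ 2 = k := Real.sq_sqrt (Nat.cast_nonneg k)
  have h1 := kg_markov (fun ε : Fin k → Fin k → Bool =>
    ∑ i, ∑ j, (5 * Real.sqrt k * (x i * y j)) * sgn (ε i j)) (25 * k)
    (fun ε => ∑ i, x i ^ 2 ≤ 1 ∧ ∑ i, y i ^ 2 ≤ 1 ∧ 5 * Real.sqrt k < kgBil k ε x y) (by
      rintro ε ⟨_, _, h⟩
      have e : ∑ i, ∑ j, (5 * Real.sqrt k * (x i * y j)) * sgn (ε i j) =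
          5 * Real.sqrt k * kgBil k ε x y := by
        simp only [kgBil, Finset.mul_sum]
        refine Finset.sum_congr rfl fun i _ => Finset.sum_congr rfl fun j _ => ?_
        ring
      rw [e]
      nlinarith [Real.sqrt_nonneg (k:ℝ)])
  have h2 := kg_hoeffding k (fun i j => 5 * Real.sqrt k * (x i * y j))
  have h3 : (∑ i, ∑ j, (5 * Real.sqrt k * (x i * y j)) ^ 2 : ℝ) ≤ 25 * (k:ℝ) := by
    have e : ∑ i, ∑ j, (5 * Real.sqrt k * (x i * y j)) ^ 2 =
        25 * k * ((∑ i, x i ^ 2) * ∑ j, y j ^ 2) := by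
      rw [Finset.sum_mul_sum]
      simp only [Finset.mul_sum]
      refine Finset.sum_congr rfl fun i _ => Finset.sum_congr rfl fun j _ => ?_
      rw [mul_pow, mul_pow, hss]; ring
    rw [e]
    have : (∑ i, x i ^ 2) * ∑ j, y j ^ 2 ≤ 1 :=
      mul_le_one₀ hx (Finset.sum_nonneg fun i _ => sq_nonneg _) hy
    nlinarith [Nat.cast_nonneg (α := ℝ) k]
  have h4 : Real.exp ((∑ i, ∑ j, (5 * Real.sqrt k * (x i * y j)) ^ 2) / 2) ≤
      Real.exp (-(12.5 * k)) * Real.exp (25 * k) := by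
    rw [← Real.exp_add]; apply Real.exp_le_exp.2; linarith
  have h5 := h1.trans (h2.trans (mul_le_mul_of_nonneg_left h4 (by positivity)))
  rw [← mul_assoc] at h5
  have h6 := le_of_mul_le_mul_right h5 (Real.exp_pos _)
  refine le_trans (le_of_eq ?_) h6
  congr!

lemma kg_card48 (k : ℕ) : ((kgNet k (4 * k)).card : ℝ) ≤ Real.exp (4 * k) := by
  have h := kg_net_card k (4 * k) (1 / 2) (by norm_num) (by norm_num)
  have h1 : ((1 + 1 / 2) / (1 - 1 / 2) : ℝ) ^ k = 48 ^ k * (1 / 2) ^ (4 * k) := by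
    rw [pow_mul, ← mul_pow]; norm_num
  rw [h1] at h
  have h2 := le_of_mul_le_mul_right h (by positivity)
  refine h2.trans ?_
  have : (48:ℝ) ≤ Real.exp 4 := by
    have e : Real.exp 4 = Real.exp 1 ^ 4 := by rw [← Real.exp_nat_mul]; norm_num
    have := Real.exp_one_gt_d9
    rw [e]
    calc (48:ℝ) ≤ 2.7 ^ 4 := by norm_num
      _ ≤ _ := by gcongr; linarith
  calc (48:ℝ) ^ k ≤ Real.exp 4 ^ k := by gcongr
    _ = _ := by rw [← Real.exp_nat_mul]; congr 1; ring

lemma kg_card600 (k : ℕ) : ((kgNet k (k / 600)).card : ℝ) ≤ Real.exp (0.02 * k) := by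
  have h := kg_net_card k (k / 600) (1 / 300) (by norm_num) (by norm_num)
  rw [one_div, inv_pow, mul_inv_le_iff₀ (by positivity)] at h
  refine h.trans ?_
  have h1 : ((1 + (300:ℝ)⁻¹) / (1 - (300:ℝ)⁻¹)) ^ k ≤ Real.exp (0.01 * k) := by
    have := Real.add_one_le_exp (0.01 : ℝ)
    calc _ ≤ Real.exp 0.01 ^ k := by gcongr; norm_num at this ⊢; linarith
      _ = _ := by rw [← Real.exp_nat_mul]; congr 1; ring
  have h2 : (300:ℝ) ^ (k / 600) ≤ Real.exp (0.01 * k) := by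
    have : (300:ℝ) ≤ Real.exp 6 := by
      have e : Real.exp 6 = Real.exp 1 ^ 6 := by rw [← Real.exp_nat_mul]; norm_num
      have := Real.exp_one_gt_d9
      rw [e]
      calc (300:ℝ) ≤ 2.7 ^ 6 := by norm_num
        _ ≤ _ := by gcongr; linarith
    calc (300:ℝ) ^ (k / 600) ≤ Real.exp 6 ^ (k / 600) := by gcongr
      _ = Real.exp ((k / 600 : ℕ) * 6) := by rw [← Real.exp_nat_mul]
      _ ≤ _ := by
        apply Real.exp_le_exp.2
        have : ((k / 600 : ℕ) : ℝ) ≤ (k : ℝ) / (600 : ℕ) := Nat.cast_div_le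
        push_cast at this
        linarith
  calc _ ≤ Real.exp (0.01 * k) * Real.exp (0.01 * k) := by gcongr
    _ = _ := by rw [← Real.exp_add]; congr 1; ring

open scoped Classical in
lemma kg_op_count (k : ℕ) (hk : 0 < k) :
    (((Finset.univ : Finset (Fin k → Fin k → Bool)).filter (fun ε => ¬ kgOp k ε)).card : ℝ) ≤
      2 ^ (k * k) * Real.exp (-(0.03 * k)) := by
  set F : (Fin k → ℤ) × (Fin k → ℤ) → Finset (Fin k → Fin k → Bool) := fun p =>
    Finset.univ.filter (fun ε =>
      ∑ i, ((4 * Real.sqrt k)⁻¹ * p.1 i) ^ 2 ≤ 1 ∧ ∑ i, ((4 * Real.sqrt k)⁻¹ * p.2 i) ^ 2 ≤ 1 ∧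
      5 * Real.sqrt k < kgBil k ε (fun i => (4 * Real.sqrt k)⁻¹ * p.1 i)
        (fun i => (4 * Real.sqrt k)⁻¹ * p.2 i)) with hF
  have hsub : (Finset.univ : Finset (Fin k → Fin k → Bool)).filter (fun ε => ¬ kgOp k ε) ⊆
      (kgNet k (4 * k) ×ˢ kgNet k (4 * k)).biUnion F := by
    intro ε hε
    have hε := (Finset.mem_filter.1 hε).2
    by_contra hcon
    apply hε
    apply kg_op_of_net k hk
    intro z hz w hw h1 h2
    by_contra h3
    push Not at h3
    apply hcon
    rw [Finset.mem_biUnion]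
    exact ⟨(z, w), Finset.mem_product.2 ⟨hz, hw⟩, Finset.mem_filter.2 ⟨Finset.mem_univ _, h1, h2, h3⟩⟩
  have h1 : (((Finset.univ : Finset (Fin k → Fin k → Bool)).filter
      (fun ε => ¬ kgOp k ε)).card : ℝ) ≤
      ∑ p ∈ kgNet k (4 * k) ×ˢ kgNet k (4 * k), ((F p).card : ℝ) := by
    exact_mod_cast (Finset.card_le_card hsub).trans Finset.card_biUnion_le
  have h2 : ∑ p ∈ kgNet k (4 * k) ×ˢ kgNet k (4 * k), ((F p).card : ℝ) ≤
      (kgNet k (4 * k) ×ˢ kgNet k (4 * k)).card • (2 ^ (k * k) * Real.exp (-(12.5 * k))) :=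
    Finset.sum_le_card_nsmul _ _ _ fun p _ => kg_op_single k _ _
  refine h1.trans (h2.trans ?_)
  rw [Finset.card_product, nsmul_eq_mul]
  push_cast
  have h3 := kg_card48 k
  calc _ ≤ Real.exp (4 * k) * Real.exp (4 * k) * (2 ^ (k * k) * Real.exp (-(12.5 * k))) := by
        gcongr
    _ = 2 ^ (k * k) * Real.exp (-(4.5 * k)) := by
        rw [mul_left_comm, ← Real.exp_add, ← Real.exp_add]; congr 2; ring
    _ ≤ _ := by
        gcongr
        norm_num

open scoped Classical in
lemma kg_low_single (k : ℕ) (b : Fin k → ℝ) :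
    (((Finset.univ : Finset (Fin k → Fin k → Bool)).filter (fun ε =>
      (∀ i, |b i| ≤ 1) ∧ 1 / 2 ≤ ∑ i, b i ^ 2 ∧
        ∑ j, |∑ i, b i * sgn (ε j i)| < 0.01 * (k:ℝ))).card : ℝ) ≤
      2 ^ (k * k) * Real.exp (-(0.05 * k)) := by
  by_cases hx : ∀ i, |b i| ≤ 1
  swap
  · simp only [hx, false_and, Finset.filter_false, Finset.card_empty, Nat.cast_zero]; positivity
  by_cases hy : 1 / 2 ≤ ∑ i, b i ^ 2
  swap
  · simp only [hy, false_and, and_false, Finset.filter_false, Finset.card_empty, Nat.cast_zero]; positivity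
  have h1 := kg_markov (fun ε : Fin k → Fin k → Bool =>
    -∑ j, |∑ i, b i * sgn (ε j i)|) (-(0.01 * k))
    (fun ε => (∀ i, |b i| ≤ 1) ∧ 1 / 2 ≤ ∑ i, b i ^ 2 ∧
        ∑ j, |∑ i, b i * sgn (ε j i)| < 0.01 * (k:ℝ)) (by
      rintro ε ⟨_, _, h⟩
      linarith)
  have h5 := h1.trans (kg_laplace k b hx hy)
  have h4 : Real.exp (-(0.06 * k)) = Real.exp (-(0.05 * k)) * Real.exp (-(0.01 * k)) := by
    rw [← Real.exp_add]; congr 1; ring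
  rw [h4, ← mul_assoc] at h5
  have h6 := le_of_mul_le_mul_right h5 (Real.exp_pos _)
  refine le_trans (le_of_eq ?_) h6
  congr!

open scoped Classical in
lemma kg_low_count (k : ℕ) (hk : 0 < k) :
    (((Finset.univ : Finset (Fin k → Fin k → Bool)).filter
      (fun ε => kgOp k ε ∧ ¬ kgLow k ε)).card : ℝ) ≤
      2 ^ (k * k) * Real.exp (-(0.03 * k)) := by
  set F : (Fin k → ℤ) → Finset (Fin k → Fin k → Bool) := fun z =>
    Finset.univ.filter (fun ε =>
      (∀ i, |(2000 * Real.sqrt k)⁻¹ * z i| ≤ 1) ∧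
      1 / 2 ≤ ∑ i, ((2000 * Real.sqrt k)⁻¹ * z i) ^ 2 ∧
      ∑ j, |∑ i, (2000 * Real.sqrt k)⁻¹ * z i * sgn (ε j i)| < 0.01 * (k:ℝ)) with hF
  have hsub : (Finset.univ : Finset (Fin k → Fin k → Bool)).filter
      (fun ε => kgOp k ε ∧ ¬ kgLow k ε) ⊆ (kgNet k (k / 600)).biUnion F := by
    intro ε hε
    have ⟨ho, hε⟩ := (Finset.mem_filter.1 hε).2
    by_contra hcon
    apply hε
    apply kg_low_of_net k hk ε ho
    intro z hz h1 h2
    by_contra h3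
    push Not at h3
    apply hcon
    rw [Finset.mem_biUnion]
    exact ⟨z, hz, Finset.mem_filter.2 ⟨Finset.mem_univ _, h1, h2, h3⟩⟩
  have h1 : (((Finset.univ : Finset (Fin k → Fin k → Bool)).filter
      (fun ε => kgOp k ε ∧ ¬ kgLow k ε)).card : ℝ) ≤
      ∑ p ∈ kgNet k (k / 600), ((F p).card : ℝ) := by
    exact_mod_cast (Finset.card_le_card hsub).trans Finset.card_biUnion_le
  have h2 : ∑ p ∈ kgNet k (k / 600), ((F p).card : ℝ) ≤
      (kgNet k (k / 600)).card • (2 ^ (k * k) * Real.exp (-(0.05 * k))) :=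
    Finset.sum_le_card_nsmul _ _ _ fun p _ => kg_low_single k _
  refine h1.trans (h2.trans ?_)
  rw [nsmul_eq_mul]
  have h3 := kg_card600 k
  calc _ ≤ Real.exp (0.02 * k) * (2 ^ (k * k) * Real.exp (-(0.05 * k))) := by
        gcongr
    _ = _ := by
        rw [mul_left_comm, ← Real.exp_add]; congr 2; ring

open scoped Classical in
lemma kg_low_count_swap (k : ℕ) (hk : 0 < k) :
    (((Finset.univ : Finset (Fin k → Fin k → Bool)).filter
      (fun ε => kgOp k ε ∧ ¬ kgLow k (fun i j => ε j i))).card : ℝ) ≤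
      2 ^ (k * k) * Real.exp (-(0.03 * k)) := by
  refine le_trans ?_ (kg_low_count k hk)
  norm_cast
  apply Finset.card_le_card_of_injOn (fun ε i j => ε j i)
  · intro ε hε
    have ⟨h1, h2⟩ := (Finset.mem_filter.1 hε).2
    exact Finset.mem_filter.2 ⟨Finset.mem_univ _, kg_op_swap k ε h1, h2⟩
  · intro ε _ ε' _ h
    funext i j
    exact congrFun (congrFun h j) i

lemma kg_L1_le_L2 (k : ℕ) (hk : 0 < k) (x : Fin k ⊕ Fin k → ℝ) : L1norm k x ≤ L2norm k x := by
  have hk' : (0:ℝ) < k := by exact_mod_cast hk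
  unfold L1norm L2norm
  apply Real.le_sqrt_of_sq_le
  have h := sq_sum_le_card_mul_sum_sq (s := Finset.univ) (f := fun i => |x i|)
  simp only [Finset.card_univ, Fintype.card_sum, Fintype.card_fin, sq_abs] at h
  push_cast at h
  rw [mul_pow, sq (2 * (k:ℝ))⁻¹, mul_assoc]
  apply mul_le_mul_of_nonneg_left _ (by positivity)
  rw [inv_mul_le_iff₀ (by positivity)]
  linarith

lemma kg_half (k : ℕ) (hk : 0 < k) (a w : Fin k → ℝ) (x : Fin k ⊕ Fin k → ℝ)
    (h1 : ∑ j, |x j| = Real.sqrt k * ∑ i, |a i| + ∑ j, |w j|)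
    (h2 : ∑ j, x j ^ 2 = k + ∑ j, w j ^ 2)
    (hlow : 1 / 1200000 * Real.sqrt k ≤ ∑ i, |a i| ∨ 0.005 * (k:ℝ) ≤ ∑ j, |w j|)
    (hup : ∑ j, w j ^ 2 ≤ 100 * k) :
    (2400000 : ℝ)⁻¹ ≤ L1norm k x ∧ L1norm k x ≤ L2norm k x ∧ L2norm k x ≤ 2400000 := by
  have hk' : (0:ℝ) < k := by exact_mod_cast hk
  have hss : Real.sqrt k ^ 2 = k := Real.sq_sqrt hk'.le
  have hs := Real.sqrt_nonneg (k:ℝ)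
  refine ⟨?_, kg_L1_le_L2 k hk x, ?_⟩
  · unfold L1norm
    rw [le_inv_mul_iff₀ (by positivity), h1]
    have p1 : 0 ≤ ∑ i, |a i| := Finset.sum_nonneg fun i _ => abs_nonneg _
    have p2 : 0 ≤ ∑ i, |w i| := Finset.sum_nonneg fun i _ => abs_nonneg _
    rcases hlow with h | h
    · have := mul_le_mul_of_nonneg_left h hs
      nlinarith
    · have := mul_nonneg hs p1
      norm_num at h ⊢
      linarith
  · unfold L2norm
    apply Real.sqrt_le_iff.2 ⟨by norm_num, ?_⟩
    rw [inv_mul_le_iff₀ (by positivity), h2]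
    nlinarith

lemma kg_good (k : ℕ) (hk : 0 < k) (ε : Fin k → Fin k → Bool) (ho : kgOp k ε)
    (hl : kgLow k ε) (hl' : kgLow k (fun i j => ε j i)) : KashinGood k 2400000 ε := by
  have hk' : (0:ℝ) ≤ k := Nat.cast_nonneg k
  have hs := Real.sqrt_nonneg (k:ℝ)
  intro a ha
  constructor
  · apply kg_half k hk a (fun j => ∑ i, a i * sgn (ε i j)) _ _ _ (hl' a ha)
      (kg_op_sq k _ (kg_op_swap k ε ho) a ha.le)
    · simp [rowA, abs_mul, abs_of_nonneg hs, Finset.mul_sum]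
    · simp [rowA, mul_pow, ← Finset.mul_sum, ha]
  · apply kg_half k hk a (fun j => ∑ i, a i * sgn (ε j i)) _ _ _ (hl a ha)
      (kg_op_sq k _ ho a ha.le)
    · simp [rowAbar, abs_mul, abs_of_nonneg hs, Finset.mul_sum, add_comm]
    · simp [rowAbar, mul_pow, ← Finset.mul_sum, ha, add_comm]

lemma kg_small_op (k : ℕ) (hk : k ≤ 100) (ε : Fin k → Fin k → Bool) : kgOp k ε := by
  intro x y hx hy
  refine (kg_bil_le k ε x y hx hy).trans ?_
  have hss : Real.sqrt k ^ 2 = k := Real.sq_sqrt (Nat.cast_nonneg k)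
  have h1 : Real.sqrt k ≤ 10 := by
    rw [Real.sqrt_le_iff]; refine ⟨by norm_num, ?_⟩
    have : (k:ℝ) ≤ 100 := by exact_mod_cast hk
    linarith
  nlinarith [Real.sqrt_nonneg (k:ℝ)]

lemma kg_small_low (k : ℕ) (hk : k ≤ 100) (ε : Fin k → Fin k → Bool) : kgLow k ε := by
  intro a ha
  left
  have h1 : Real.sqrt k ≤ 10 := by
    rw [Real.sqrt_le_iff]; refine ⟨by norm_num, ?_⟩
    have : (k:ℝ) ≤ 100 := by exact_mod_cast hk
    linarith
  have h2 : ∑ i, a i ^ 2 ≤ ∑ i, |a i| := by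
    refine Finset.sum_le_sum fun i _ => ?_
    have := kg_abs_le_one ha.le i
    rw [← sq_abs]
    nlinarith [abs_nonneg (a i)]
  linarith

open scoped Classical in
lemma kg_prob (k : ℕ) (hk : 0 < k) :
    signProb k (fun ε => KashinGood k 2400000 ε) > 1 - Real.exp (-(0.01 * k)) := by
  unfold signProb
  have hcard : (Finset.univ : Finset (Fin k → Fin k → Bool)).card = 2 ^ (k * k) := by
    simp [pow_mul]
  have hpos : (0:ℝ) < 2 ^ (k * k) := by positivity
  rcases le_total k 100 with h | h
  · rw [Finset.filter_true_of_mem, hcard]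
    · push_cast
      rw [div_self hpos.ne']
      linarith [Real.exp_pos (-(0.01 * (k:ℝ)))]
    · intro ε _
      exact kg_good k hk ε (kg_small_op k h ε) (kg_small_low k h ε) (kg_small_low k h _)
  · have hsplit := Finset.card_filter_add_card_filter_not
      (s := (Finset.univ : Finset (Fin k → Fin k → Bool)))
      (fun ε => KashinGood k 2400000 ε)
    rw [hcard] at hsplit
    have hsub : (Finset.univ : Finset (Fin k → Fin k → Bool)).filter
        (fun ε => ¬ KashinGood k 2400000 ε) ⊆
        (Finset.univ.filter (fun ε => ¬ kgOp k ε)) ∪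
        ((Finset.univ.filter (fun ε => kgOp k ε ∧ ¬ kgLow k ε)) ∪
        (Finset.univ.filter (fun ε => kgOp k ε ∧ ¬ kgLow k (fun i j => ε j i)))) := by
      intro ε hε
      have hε := (Finset.mem_filter.1 hε).2
      simp only [Finset.mem_union, Finset.mem_filter, Finset.mem_univ, true_and]
      by_contra hcon
      push Not at hcon
      obtain ⟨h1, h2, h3⟩ := hcon
      exact hε (kg_good k hk ε h1 (h2 h1) (h3 h1))
    have hc := (Finset.card_le_card hsub).trans ((Finset.card_union_le _ _).trans
      (Nat.add_le_add_left (Finset.card_union_le _ _) _))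
    have hc' : (((Finset.univ : Finset (Fin k → Fin k → Bool)).filter
        (fun ε => ¬ KashinGood k 2400000 ε)).card : ℝ) ≤ 
        3 * (2 ^ (k * k) * Real.exp (-(0.03 * k))) := by
      have := kg_op_count k hk
      have := kg_low_count k hk
      have := kg_low_count_swap k hk
      have : (((Finset.univ : Finset (Fin k → Fin k → Bool)).filter
        (fun ε => ¬ KashinGood k 2400000 ε)).card : ℝ) ≤ _ := Nat.cast_le.2 hc
      push_cast at this
      linarith
    have hsplit' : (((Finset.univ : Finset (Fin k → Fin k → Bool)).filter
        (fun ε => KashinGood k 2400000 ε)).card : ℝ) +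
        (((Finset.univ : Finset (Fin k → Fin k → Bool)).filter
        (fun ε => ¬ KashinGood k 2400000 ε)).card : ℝ) = 2 ^ (k * k) := by
      exact_mod_cast hsplit
    have he : 3 * Real.exp (-(0.03 * k)) < Real.exp (-(0.01 * (k:ℝ))) := by
      have e : Real.exp (-(0.01 * (k:ℝ))) = Real.exp (0.02 * k) * Real.exp (-(0.03 * k)) := by
        rw [← Real.exp_add]; congr 1; ring
      rw [e]
      apply mul_lt_mul_of_pos_right _ (Real.exp_pos _)
      have hk' : (100:ℝ) ≤ k := by exact_mod_cast h
      have h2 : Real.exp 2 ≤ Real.exp (0.02 * k) := Real.exp_le_exp.2 (by norm_num; linarith)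
      have e2 : Real.exp 2 = Real.exp 1 ^ 2 := by rw [← Real.exp_nat_mul]; norm_num
      have := Real.exp_one_gt_d9
      nlinarith
    rw [gt_iff_lt, lt_div_iff₀ hpos]
    nlinarith

/-- Main theorem: for some absolute `η > 0` and `C < ∞` and for all `k` there are signs
`{ε_{i,j}}` such that, with `A = [√k I, B]` and `Ā = [−B*, √k I]`, for all `a ∈ S^{k−1}`,
`C⁻¹ ≤ ‖aA‖_{L_1^{2k}} ≤ ‖aA‖_{L_2^{2k}} ≤ C` and likewise for `Ā`. Moreover this holds
with probability larger than `1 − e^{−η k}`. -/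
theorem stmt10 :
    ∃ η C : ℝ, 0 < η ∧ 0 < C ∧ ∀ k : ℕ, 0 < k →
      (∃ ε : Fin k → Fin k → Bool, KashinGood k C ε) ∧
      signProb k (fun ε => KashinGood k C ε) > 1 - Real.exp (-(η * k)) := by
  refine ⟨0.01, 2400000, by norm_num, by norm_num, fun k hk => ?_⟩
  have h := kg_prob k hk
  refine ⟨?_, h⟩
  by_contra hcon
  push Not at hcon
  have h0 : signProb k (fun ε => KashinGood k 2400000 ε) = 0 := by
    unfold signProb
    simp [hcon]
  rw [h0] at h
  have hk' : (0:ℝ) < k := by exact_mod_cast hk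
  have : Real.exp (-(0.01 * (k:ℝ))) ≤ 1 := Real.exp_le_one_iff.2 (by norm_num)
  linarith
end

section
/- There is a constant C < ∞ such that for every positive integer k there exists a k×k matrix B with ±1 entries for which √(2k) · max{ max_{D} Δ₂(D,B)/Δ₁(D,B) , max_{D} Δ₂(D,B*)/Δ₁(D,B*) } ≤ C, where the first inner max is over all l = 1,…,k−1 and all (l+1)×l submatrices D of B for which Δ₁(D,B) ≠ 0, and the second inner max is over all l = 1,…,k−1 and all (l+1)×l submatrices D of B* for which Δ₁(D,B*) ≠ 0 (B* denotes the transpose of B). -/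
open Finset Matrix

/-- The determinant of the submatrix `B_{R,C}` of `B` formed by the rows in `R` and the
columns in `C` (rows and columns taken in increasing order); defined to be `0` when
`R` and `C` do not have the same cardinality. -/
noncomputable def detSub {k : ℕ} (B : Matrix (Fin k) (Fin k) ℝ)
    (R C : Finset (Fin k)) : ℝ :=
  if h : R.card = C.card then
    Matrix.det (Matrix.of fun i j : Fin R.card =>
      B ((R.orderIsoOfFin rfl) i : Fin k) ((C.orderIsoOfFin h.symm) j : Fin k))
  else 0

/-- `Δ_p(D,B)` for the `(l+1)×l` submatrix `D = B_{R,C}` of the `k×k` matrix `B`: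
`Δ_p(D,B) = (k^{p/2} ∑_{i∈R} |det D_{−i}|^p + ∑_{j∉C} |det D^{+j}|^p)^{1/p}`,
where `D_{−i} = B_{R∖{i},C}` and `D^{+j} = B_{R,C∪{j}}`. -/
noncomputable def Delta {k : ℕ} (p : ℝ) (B : Matrix (Fin k) (Fin k) ℝ)
    (R C : Finset (Fin k)) : ℝ :=
  ((k : ℝ) ^ (p / 2) * ∑ i ∈ R, |detSub B (R.erase i) C| ^ p +
      ∑ j ∈ Cᶜ, |detSub B R (insert j C)| ^ p) ^ (1 / p)

lemma abs_detSub_eq {k n : ℕ} (B : Matrix (Fin k) (Fin k) ℝ) (R C : Finset (Fin k))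
    (e f : Fin n → Fin k) (he : Function.Injective e) (hf : Function.Injective f)
    (hR : Finset.univ.image e = R) (hC : Finset.univ.image f = C) :
    |detSub B R C| = |(Matrix.of fun i j => B (e i) (f j)).det| := by
  have hRc : R.card = n := by rw [← hR, card_image_of_injective _ he]; simp
  have hCc : C.card = n := by rw [← hC, card_image_of_injective _ hf]; simp
  subst hRc
  have h : R.card = C.card := hCc.symm
  unfold detSub
  rw [dif_pos h]
  have key : ∀ (S : Finset (Fin k)) (hS : S.card = R.card) (g : Fin R.card → Fin k),
      Function.Injective g → Finset.univ.image g = S →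
      ∃ σ : Equiv.Perm (Fin R.card), ∀ i, g i = (S.orderIsoOfFin hS (σ i) : Fin k) := by
    intro S hS g hg hgS
    have hm : ∀ i, g i ∈ S := fun i => by rw [← hgS]; simp
    let φ : Fin R.card → Fin R.card := fun i => (S.orderIsoOfFin hS).symm ⟨g i, hm i⟩
    have hφ : Function.Injective φ := by
      intro a b hab
      have := (S.orderIsoOfFin hS).symm.injective hab
      exact hg (by simpa using this)
    refine ⟨Equiv.ofBijective φ (Finite.injective_iff_bijective.mp hφ), fun i => ?_⟩
    simp [φ]
  obtain ⟨σ, hσ⟩ := key R rfl e he hR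
  obtain ⟨τ, hτ⟩ := key C h.symm f hf hC
  rw [← Matrix.abs_det_submatrix_equiv_equiv σ τ]
  congr 2
  ext i j
  simp [hσ, hτ]

lemma exists_normal {k l : ℕ} (B : Matrix (Fin k) (Fin k) ℝ) (R C : Finset (Fin k))
    (hR : R.card = l + 1) (hC : C.card = l) :
    ∃ x : Fin k → ℝ, (∀ i ∈ R, |x i| = |detSub B (R.erase i) C|) ∧ (∀ i ∉ R, x i = 0) ∧
      (∀ j ∈ C, ∑ i, Bᵀ j i * x i = 0) ∧
      (∀ j ∉ C, |∑ i, Bᵀ j i * x i| = |detSub B R (insert j C)|) := by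
  classical
  let e : Fin (l+1) → Fin k := fun i => (R.orderIsoOfFin hR i : Fin k)
  let f : Fin l → Fin k := fun i => (C.orderIsoOfFin hC i : Fin k)
  have he : Function.Injective e := fun a b h => by
    simpa using (R.orderIsoOfFin hR).injective (Subtype.ext h)
  have hf : Function.Injective f := fun a b h => by
    simpa using (C.orderIsoOfFin hC).injective (Subtype.ext h)
  have hme : ∀ i ∈ R, ∃ a, e a = i := fun i hi =>
    ⟨(R.orderIsoOfFin hR).symm ⟨i, hi⟩, by show ((R.orderIsoOfFin hR) _ : Fin k) = i; rw [OrderIso.apply_symm_apply]⟩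
  have hmf : ∀ i ∈ C, ∃ a, f a = i := fun i hi =>
    ⟨(C.orderIsoOfFin hC).symm ⟨i, hi⟩, by show ((C.orderIsoOfFin hC) _ : Fin k) = i; rw [OrderIso.apply_symm_apply]⟩
  have heR : ∀ a, e a ∈ R := fun a => (R.orderIsoOfFin hR a).2
  have hfC : ∀ a, f a ∈ C := fun a => (C.orderIsoOfFin hC a).2
  let y : Fin (l+1) → ℝ := fun a =>
    (-1) ^ (a : ℕ) * (Matrix.of fun (i : Fin l) (j : Fin l) => B (e (a.succAbove i)) (f j)).det
  let x : Fin k → ℝ := fun i => ∑ a, if e a = i then y a else 0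
  have hxe : ∀ a, x (e a) = y a := by
    intro a
    simp only [x]
    rw [Finset.sum_eq_single a]
    · simp
    · intro b _ hb
      rw [if_neg (fun h => hb (he h))]
    · simp
  have hsum : ∀ j, ∑ i, Bᵀ j i * x i =
      (Matrix.of fun (a b : Fin (l+1)) => B (e a) ((Fin.cons j f : Fin (l+1) → Fin k) b)).det := by
    intro j
    rw [Matrix.det_succ_column_zero]
    simp only [x, Finset.mul_sum]
    rw [Finset.sum_comm]
    refine Finset.sum_congr rfl fun a _ => ?_
    rw [Finset.sum_eq_single (e a)]
    · simp only [if_true, y, Matrix.transpose_apply, Matrix.of_apply, Fin.cons_zero]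
      have : (Matrix.of fun (i : Fin l) (j : Fin l) => B (e (a.succAbove i)) (f j)) =
        (Matrix.of fun (a b : Fin (l+1)) =>
          B (e a) ((Fin.cons j f : Fin (l+1) → Fin k) b)).submatrix a.succAbove Fin.succ := by
        ext i j; simp
      rw [this]; ring
    · intro b _ hb
      rw [if_neg (fun h => hb h.symm), mul_zero]
    · simp
  refine ⟨x, ?_, ?_, ?_, ?_⟩
  · intro i hi
    obtain ⟨a, rfl⟩ := hme i hi
    rw [hxe, abs_detSub_eq B (R.erase (e a)) C (fun i => e (a.succAbove i)) f
      (he.comp Fin.succAbove_right_injective) hf ?_ ?_]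
    · simp only [y, abs_mul, abs_pow, abs_neg, abs_one, one_pow, one_mul]
    · ext i
      simp only [mem_image, mem_univ, true_and, mem_erase]
      constructor
      · rintro ⟨b, rfl⟩
        exact ⟨fun h => Fin.succAbove_ne a b (he h), heR _⟩
      · rintro ⟨h1, h2⟩
        obtain ⟨b, rfl⟩ := hme i h2
        obtain ⟨c, rfl⟩ := Fin.exists_succAbove_eq (fun h => h1 (congrArg e h) : b ≠ a)
        exact ⟨c, rfl⟩
    · ext i
      simp only [mem_image, mem_univ, true_and]
      exact ⟨by rintro ⟨b, rfl⟩; exact hfC b, fun h => hmf i h⟩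
  · intro i hi
    refine Finset.sum_eq_zero fun a _ => if_neg ?_
    rintro rfl; exact hi (heR a)
  · intro j hj
    rw [hsum]
    obtain ⟨b, rfl⟩ := hmf j hj
    refine Matrix.det_zero_of_column_eq (i := 0) (j := b.succ) (Fin.succ_ne_zero b).symm ?_
    intro i; simp
  · intro j hj
    rw [hsum, abs_detSub_eq B R (insert j C) e (Fin.cons j f) he ?_ ?_ ?_]
    · rw [Fin.cons_injective_iff]
      exact ⟨by rintro ⟨b, rfl⟩; exact hj (hfC b), hf⟩
    · ext i
      simp only [mem_image, mem_univ, true_and]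
      exact ⟨by rintro ⟨b, rfl⟩; exact heR b, fun h => hme i h⟩
    · ext i
      simp only [mem_image, mem_univ, true_and, mem_insert]
      constructor
      · rintro ⟨b, rfl⟩
        refine Fin.cases (by simp) (fun b => ?_) b
        right; simpa using hfC b
      · rintro (rfl | h)
        · exact ⟨0, by simp⟩
        · obtain ⟨b, rfl⟩ := hmf i h
          exact ⟨b.succ, by simp⟩

/-- sign of a boolean -/
def sg (b : Bool) : ℝ := if b then 1 else -1

lemma sum_pi_prod {α β : Type*} [Fintype α] [DecidableEq α] [Fintype β] (g : α → β → ℝ) :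
    ∑ w : α → β, ∏ a, g a (w a) = ∏ a, ∑ b, g a b := by
  rw [Finset.prod_univ_sum]
  simp

lemma mgf_bound {k : ℕ} (a : Fin k → Fin k → ℝ) :
    ∑ w : Fin k → Fin k → Bool, Real.exp (∑ i, ∑ j, a i j * sg (w i j)) ≤
      2 ^ (k * k) * Real.exp ((∑ i, ∑ j, a i j ^ 2) / 2) := by
  simp only [Real.exp_sum]
  rw [sum_pi_prod (fun i (r : Fin k → Bool) => ∏ j, Real.exp (a i j * sg (r j)))]
  have h1 : ∀ i, ∑ r : Fin k → Bool, ∏ j, Real.exp (a i j * sg (r j)) ≤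
      2 ^ k * Real.exp ((∑ j, a i j ^ 2) / 2) := by
    intro i
    rw [sum_pi_prod (fun j (b : Bool) => Real.exp (a i j * sg b))]
    have : ∀ j ∈ Finset.univ, ∑ b : Bool, Real.exp (a i j * sg b) ≤ 2 * Real.exp (a i j ^ 2 / 2) := by
      intro j _
      have := Real.cosh_le_exp_half_sq (a i j)
      rw [Real.cosh_eq] at this
      simp [sg]
      linarith
    refine (Finset.prod_le_prod (fun j _ => Finset.sum_nonneg fun _ _ => (Real.exp_pos _).le) this).trans ?_
    rw [Finset.prod_mul_distrib, ← Real.exp_sum, Finset.sum_div]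
    simp
  refine (Finset.prod_le_prod (fun j _ => Finset.sum_nonneg fun _ _ => ?_) (fun i _ => h1 i)).trans ?_
  · exact Finset.prod_nonneg fun _ _ => (Real.exp_pos _).le
  · rw [Finset.prod_mul_distrib, ← Real.exp_sum, Finset.sum_div]
    simp [pow_mul]

lemma moments (k : ℕ) (v : Fin k → ℝ) :
    (∑ b : Fin k → Bool, (∑ j, sg (b j) * v j) ^ 2 = 2 ^ k * ∑ j, v j ^ 2) ∧
    (∑ b : Fin k → Bool, (∑ j, sg (b j) * v j) ^ 4 ≤ 3 * 2 ^ k * (∑ j, v j ^ 2) ^ 2) := by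
  induction k with
  | zero => simp
  | succ k ih =>
    obtain ⟨h2, h4⟩ := ih (fun j => v j.succ)
    have key : ∀ F : ℝ → ℝ, ∑ b : Fin (k+1) → Bool, F (∑ j, sg (b j) * v j) =
        ∑ b : Fin k → Bool, (F (v 0 + ∑ j, sg (b j) * v j.succ) + F (-v 0 + ∑ j, sg (b j) * v j.succ)) := by
      intro F
      rw [← (Fin.consEquiv (fun _ : Fin (k+1) => Bool)).sum_comp, Fintype.sum_prod_type,
        Fintype.sum_bool, ← Finset.sum_add_distrib]
      refine Finset.sum_congr rfl fun b _ => ?_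
      simp [Fin.consEquiv, Fin.sum_univ_succ, sg]
    constructor
    · rw [key (fun s => s ^ 2), Fin.sum_univ_succ]
      have : ∀ b : Fin k → Bool, (v 0 + ∑ j, sg (b j) * v j.succ) ^ 2 + (-v 0 + ∑ j, sg (b j) * v j.succ) ^ 2
        = 2 * (∑ j, sg (b j) * v j.succ) ^ 2 + 2 * v 0 ^ 2 := fun b => by ring
      simp only [this, Finset.sum_add_distrib, ← Finset.mul_sum, h2]
      simp
      ring
    · rw [key (fun s => s ^ 4), Fin.sum_univ_succ]
      have : ∀ b : Fin k → Bool, (v 0 + ∑ j, sg (b j) * v j.succ) ^ 4 + (-v 0 + ∑ j, sg (b j) * v j.succ) ^ 4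
        = 2 * (∑ j, sg (b j) * v j.succ) ^ 4 + (12 * v 0 ^ 2) * (∑ j, sg (b j) * v j.succ) ^ 2 + 2 * v 0 ^ 4 :=
          fun b => by ring
      simp only [this, Finset.sum_add_distrib, ← Finset.mul_sum, h2]
      simp
      have hp : (0:ℝ) ≤ 2 ^ k * v 0 ^ 4 := by positivity
      rw [pow_succ (2:ℝ) k]
      nlinarith

lemma exp_neg_abs_le (s : ℝ) : Real.exp (-|s|) ≤ 1 - s ^ 2 / 8 + s ^ 4 / 64 := by
  have h0 := abs_nonneg s
  rw [← sq_abs s, show s ^ 4 = |s| ^ 4 by rw [Even.pow_abs ⟨2, rfl⟩]]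
  generalize |s| = u at *
  rcases le_or_gt u 1 with h | h
  · have h1 : Real.exp (-u) ≤ 1 / (1 + u) := by
      rw [Real.exp_neg, ← one_div]
      apply one_div_le_one_div_of_le (by linarith)
      linarith [Real.add_one_le_exp u]
    refine h1.trans ?_
    rw [div_le_iff₀ (by linarith)]
    nlinarith [mul_nonneg h0 h0, pow_nonneg h0 4, pow_nonneg h0 5, mul_nonneg h0 (sub_nonneg.2 h),
      mul_nonneg (mul_nonneg h0 h0) (sub_nonneg.2 h)]
  · have h1 : Real.exp (-u) ≤ 1 / 2 := by
      rw [Real.exp_neg, ← one_div]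
      apply one_div_le_one_div_of_le (by linarith)
      linarith [Real.add_one_le_exp u]
    nlinarith [sq_nonneg (u ^ 2 - 4)]

lemma row_bound (k : ℕ) (v : Fin k → ℝ) (h1 : 1 / 2 ≤ ∑ j, v j ^ 2) (h2 : ∑ j, v j ^ 2 ≤ 1) :
    ∑ b : Fin k → Bool, Real.exp (-|∑ j, sg (b j) * v j|) ≤ 2 ^ k * Real.exp (-(5 / 128)) := by
  obtain ⟨m2, m4⟩ := moments k v
  refine (Finset.sum_le_sum fun b _ => exp_neg_abs_le _).trans ?_
  rw [Finset.sum_add_distrib, Finset.sum_sub_distrib, ← Finset.sum_div, ← Finset.sum_div, m2]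
  have hp : (0:ℝ) < 2 ^ k := by positivity
  have : 1 - (∑ j, v j ^ 2) / 8 + 3 * (∑ j, v j ^ 2) ^ 2 / 64 ≤ Real.exp (-(5 / 128)) := by
    have := Real.add_one_le_exp (-(5 / 128) : ℝ)
    nlinarith
  have := mul_le_mul_of_nonneg_left this hp.le
  simp
  nlinarith

lemma small_ball (k : ℕ) (v : Fin k → ℝ) (h1 : 1 / 2 ≤ ∑ j, v j ^ 2) (h2 : ∑ j, v j ^ 2 ≤ 1) :
    ∑ w : Fin k → Fin k → Bool, Real.exp (-∑ i, |∑ j, sg (w i j) * v j|) ≤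
      2 ^ (k * k) * Real.exp (-(5 / 128) * k) := by
  simp only [← Finset.sum_neg_distrib, Real.exp_sum]
  rw [sum_pi_prod (fun i (r : Fin k → Bool) => Real.exp (-|∑ j, sg (r j) * v j|))]
  refine (Finset.prod_le_prod (fun j _ => Finset.sum_nonneg fun _ _ => (Real.exp_pos _).le)
    (fun i _ => row_bound k v h1 h2)).trans ?_
  simp [mul_pow, pow_mul, ← Real.exp_nat_mul, mul_comm]

lemma trunc_exists (u : ℝ) : ∃ n : ℤ, |(n : ℝ)| ≤ |u| ∧ |u - n| ≤ 1 := by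
  rcases le_total 0 u with h | h
  · refine ⟨⌊u⌋, ?_, ?_⟩
    · have : (0:ℝ) ≤ ⌊u⌋ := by exact_mod_cast Int.floor_nonneg.2 h
      rw [abs_of_nonneg this, abs_of_nonneg h]; exact Int.floor_le u
    · rw [abs_le]; constructor <;> linarith [Int.floor_le u, Int.lt_floor_add_one u]
  · refine ⟨⌈u⌉, ?_, ?_⟩
    · have : (⌈u⌉ : ℝ) ≤ 0 := by exact_mod_cast Int.ceil_le.2 (by simpa using h)
      rw [abs_of_nonpos this, abs_of_nonpos h]; linarith [Int.le_ceil u]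
    · rw [abs_le]; constructor <;> linarith [Int.le_ceil u, Int.ceil_lt_add_one u]

lemma geom_bound (t : ℝ) (h0 : 0 < t) (h1 : t < 1) (N : ℕ) :
    ∑ n ∈ Finset.Icc (-(N : ℤ)) N, t ^ n.natAbs ≤ (1 + t) / (1 - t) := by
  have key : ∑ n ∈ Finset.Icc (-(N : ℤ)) N, t ^ n.natAbs = (1 + t - 2 * t ^ (N + 1)) / (1 - t) := by
    have ht : 1 - t ≠ 0 := by linarith
    induction N with
    | zero => simp; field_simp; ring
    | succ N ih =>
      have hs : Finset.Icc (-((N + 1 : ℕ) : ℤ)) ((N + 1 : ℕ) : ℤ) =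
          insert (-((N + 1 : ℕ) : ℤ)) (insert ((N + 1 : ℕ) : ℤ) (Finset.Icc (-(N : ℤ)) N)) := by
        ext a; simp only [Finset.mem_Icc, Finset.mem_insert]; omega
      rw [hs, Finset.sum_insert, Finset.sum_insert, ih]
      · simp only [Int.natAbs_neg, Int.natAbs_natCast]
        field_simp
        ring
      · simp
      · simp only [Finset.mem_insert, Finset.mem_Icc]; omega
  rw [key]
  apply div_le_div_of_nonneg_right _ (by linarith)
  have := pow_pos h0 (N + 1)
  linarith

/-- integer vectors of bounded l1 norm -/
noncomputable def net (k : ℕ) (M : ℝ) : Finset (Fin k → ℤ) :=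
  (Fintype.piFinset fun _ : Fin k => Finset.Icc (-(⌊M⌋₊ : ℤ)) ⌊M⌋₊).filter
    (fun z => ∑ i, |(z i : ℝ)| ≤ M)

lemma mem_net {k : ℕ} {M : ℝ} {z : Fin k → ℤ} : z ∈ net k M ↔ ∑ i, |(z i : ℝ)| ≤ M := by
  unfold net
  rw [Finset.mem_filter, and_iff_right_iff_imp]
  intro h
  rw [Fintype.mem_piFinset]
  intro i
  have h1 : |(z i : ℝ)| ≤ M :=
    (Finset.single_le_sum (f := fun i => |(z i : ℝ)|) (fun _ _ => abs_nonneg _) (Finset.mem_univ i)).trans h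
  have h2 : (z i).natAbs ≤ ⌊M⌋₊ := by
    apply Nat.le_floor
    rw [Nat.cast_natAbs]; exact_mod_cast h1
  rw [Finset.mem_Icc]; omega

lemma card_net (k : ℕ) (M θ q : ℝ) (hθ : 0 < θ)
    (hq : 1 + Real.exp (-θ) ≤ Real.exp q * (1 - Real.exp (-θ))) :
    ((net k M).card : ℝ) ≤ Real.exp (θ * M + q * k) := by
  have ht1 : Real.exp (-θ) < 1 := by simpa using hθ
  have h1 : ∑ z ∈ net k M, Real.exp (-θ * M) ≤ ∑ z ∈ net k M, ∏ i, Real.exp (-θ) ^ (z i).natAbs := by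
    refine Finset.sum_le_sum fun z hz => ?_
    rw [mem_net] at hz
    simp only [← Real.exp_nat_mul]
    rw [← Real.exp_sum, Real.exp_le_exp, ← Finset.sum_mul]
    have : ∑ i, ((z i).natAbs : ℝ) = ∑ i, |(z i : ℝ)| :=
      Finset.sum_congr rfl fun i _ => by rw [Nat.cast_natAbs]; push_cast; rfl
    rw [this]; nlinarith
  have h2 : ∑ z ∈ net k M, ∏ i, Real.exp (-θ) ^ (z i).natAbs ≤ Real.exp q ^ k := by
    refine (Finset.sum_le_sum_of_subset_of_nonneg (Finset.filter_subset _ _) fun z _ _ =>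
      Finset.prod_nonneg fun _ _ => by positivity).trans ?_
    rw [← Finset.prod_univ_sum (fun _ : Fin k => Finset.Icc (-(⌊M⌋₊ : ℤ)) ⌊M⌋₊)
      (fun _ n => Real.exp (-θ) ^ n.natAbs)]
    rw [Finset.prod_const, Finset.card_univ, Fintype.card_fin]
    refine pow_le_pow_left₀ (Finset.sum_nonneg fun _ _ => by positivity) ?_ k
    refine (geom_bound _ (Real.exp_pos _) ht1 _).trans ?_
    rw [div_le_iff₀ (by linarith)]; exact hq
  have h3 := h1.trans h2
  rw [Finset.sum_const, nsmul_eq_mul, ← Real.exp_nat_mul] at h3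
  have h4 := mul_le_mul_of_nonneg_right h3 (Real.exp_pos (θ * M)).le
  rw [mul_assoc, ← Real.exp_add, ← Real.exp_add] at h4
  simp at h4
  rw [show θ * M + q * k = k * q + θ * M by ring]; exact h4

lemma trunc_vec {k : ℕ} (hk : 0 < k) (x : Fin k → ℝ) (δ : ℝ) (hδ : 0 < δ) :
    ∃ z : Fin k → ℤ, ∑ i, |(z i : ℝ)| ≤ √k / δ * ∑ i, |x i| ∧
      ∑ i, (δ / √k * z i) ^ 2 ≤ ∑ i, x i ^ 2 ∧ ∑ i, (x i - δ / √k * z i) ^ 2 ≤ δ ^ 2 := by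
  have hs : 0 < √(k : ℝ) := by positivity
  choose z h1 h2 using fun i => trunc_exists (√k / δ * x i)
  have hc : 0 < √(k : ℝ) / δ := by positivity
  have hid : ∀ i, x i = δ / √k * (√k / δ * x i) := fun i => by field_simp
  refine ⟨z, ?_, ?_, ?_⟩
  · rw [Finset.mul_sum]
    refine Finset.sum_le_sum fun i _ => ?_
    have := h1 i
    rwa [abs_mul, abs_of_pos hc] at this
  · refine Finset.sum_le_sum fun i _ => ?_
    rw [hid i, mul_pow, mul_pow (δ / √k)]
    exact mul_le_mul_of_nonneg_left (sq_le_sq.2 (h1 i)) (sq_nonneg _)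
  · have : ∀ i ∈ Finset.univ, (x i - δ / √k * z i) ^ 2 ≤ δ ^ 2 / k := by
      intro i _
      conv_lhs => rw [hid i, ← mul_sub, mul_pow, div_pow, Real.sq_sqrt (Nat.cast_nonneg k)]
      have h3 : (√k / δ * x i - z i) ^ 2 ≤ 1 := by
        rw [← sq_abs]; exact pow_le_one₀ (abs_nonneg _) (h2 i)
      exact mul_le_of_le_one_right (by positivity) h3
    refine (Finset.sum_le_sum this).trans ?_
    have : (k : ℝ) ≠ 0 := by positivity
    simp
    field_simp
    rfl

lemma l1_le {k : ℕ} (x : Fin k → ℝ) : ∑ i, |x i| ≤ √k * √(∑ i, x i ^ 2) := by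
  rw [← Real.sqrt_mul (Nat.cast_nonneg k)]
  apply Real.le_sqrt_of_sq_le
  have := sq_sum_le_card_mul_sum_sq (s := Finset.univ) (f := fun i => |x i|)
  simpa using this

lemma op_bound {k : ℕ} (hk : 0 < k) (A : Matrix (Fin k) (Fin k) ℝ)
    (hN : ∀ z ∈ net k (4 * k), ∀ w ∈ net k (4 * k), ∑ i, (z i : ℝ) ^ 2 ≤ 16 * k →
      ∑ i, (w i : ℝ) ^ 2 ≤ 16 * k →
      (fun i => (z i : ℝ)) ⬝ᵥ A *ᵥ (fun i => (w i : ℝ)) ≤ 80 * k * √k)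
    (y x : Fin k → ℝ) (hy : ∑ i, y i ^ 2 ≤ 1) (hx : ∑ i, x i ^ 2 ≤ 1) :
    y ⬝ᵥ A *ᵥ x ≤ 10 * √k := by
  have hk' : (0 : ℝ) < k := by exact_mod_cast hk
  have hs : 0 < √(k : ℝ) := by positivity
  have hss : √(k : ℝ) * √k = k := Real.mul_self_sqrt hk'.le
  let S : Set ℝ := {r | ∃ y x : Fin k → ℝ, ∑ i, y i ^ 2 ≤ 1 ∧ ∑ i, x i ^ 2 ≤ 1 ∧ r = y ⬝ᵥ A *ᵥ x}
  have hle1 : ∀ x : Fin k → ℝ, ∑ i, x i ^ 2 ≤ 1 → ∀ i, |x i| ≤ 1 := by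
    intro x hx i
    have : x i ^ 2 ≤ 1 := (Finset.single_le_sum (f := fun i => x i ^ 2)
      (fun _ _ => sq_nonneg _) (Finset.mem_univ i)).trans hx
    rwa [sq_le_one_iff_abs_le_one] at this
  have hbdd : BddAbove S := by
    refine ⟨∑ i, ∑ j, |A i j|, ?_⟩
    rintro r ⟨y, x, hy, hx, rfl⟩
    simp only [dotProduct, mulVec, Finset.mul_sum]
    refine Finset.sum_le_sum fun i _ => Finset.sum_le_sum fun j _ => ?_
    refine (le_abs_self _).trans ?_
    rw [abs_mul, abs_mul]
    have h1 := hle1 y hy i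
    have h2 := hle1 x hx j
    calc |y i| * (|A i j| * |x j|) ≤ 1 * (|A i j| * 1) := by gcongr
      _ = |A i j| := by ring
  have hmem : ∀ y x : Fin k → ℝ, ∑ i, y i ^ 2 ≤ 1 → ∑ i, x i ^ 2 ≤ 1 → y ⬝ᵥ A *ᵥ x ≤ sSup S :=
    fun y x hy hx => le_csSup hbdd ⟨y, x, hy, hx, rfl⟩
  have htr : ∀ x : Fin k → ℝ, ∑ i, x i ^ 2 ≤ 1 → ∃ z ∈ net k (4 * k), ∑ i, (z i : ℝ) ^ 2 ≤ 16 * k ∧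
      ∑ i, (((1 / 4 / √k) • fun i => (z i : ℝ)) i) ^ 2 ≤ 1 ∧
      ∑ i, (((4 : ℝ) • (x - (1 / 4 / √k) • fun i => (z i : ℝ))) i) ^ 2 ≤ 1 := by
    intro x hx
    obtain ⟨z, h1, h2, h3⟩ := trunc_vec hk x (1 / 4) (by norm_num)
    have h2' := h2.trans hx
    refine ⟨z, ?_, ?_, ?_, ?_⟩
    · rw [mem_net]
      refine h1.trans ?_
      have h4 : √(∑ i, x i ^ 2) ≤ 1 := Real.sqrt_le_iff.2 ⟨zero_le_one, by simpa using hx⟩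
      have h5 := l1_le x
      have h6 : ∑ i, |x i| ≤ √k := h5.trans (mul_le_of_le_one_right hs.le h4)
      calc √k / (1 / 4) * ∑ i, |x i| ≤ √k / (1 / 4) * √k := by gcongr
        _ = 4 * (√k * √k) := by ring
        _ = 4 * k := by rw [hss]
    · simp only [mul_pow, ← Finset.mul_sum, div_pow, Real.sq_sqrt hk'.le] at h2'
      rw [div_mul_eq_mul_div, div_le_one hk'] at h2'
      linarith
    · simpa using h2'
    · simp only [Pi.smul_apply, Pi.sub_apply, smul_eq_mul, mul_pow, ← Finset.mul_sum]
      linarith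
  have hstep : ∀ y x : Fin k → ℝ, ∑ i, y i ^ 2 ≤ 1 → ∑ i, x i ^ 2 ≤ 1 →
      y ⬝ᵥ A *ᵥ x ≤ 5 * √k + sSup S / 2 := by
    intro y x hy hx
    obtain ⟨z, hz, hz2, hz3, hz4⟩ := htr y hy
    obtain ⟨w, hw, hw2, hw3, hw4⟩ := htr x hx
    have e1 := hN z hz w hw hz2 hw2
    have e2 := hmem _ _ hz4 hw3
    have e3 := hmem _ _ hy hw4
    simp only [smul_dotProduct, dotProduct_smul, mulVec_smul, sub_dotProduct, dotProduct_sub,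
      mulVec_sub, smul_eq_mul] at e1 e2 e3
    generalize (fun i => (z i : ℝ)) ⬝ᵥ A *ᵥ (fun i => (w i : ℝ)) = p at *
    generalize y ⬝ᵥ A *ᵥ (fun i => (w i : ℝ)) = q at *
    have : 1 / 4 / √k * (1 / 4 / √k * p) ≤ 5 * √k := by
      have : 1 / 4 / √k * (1 / 4 / √k * p) = p / (16 * (√k * √k)) := by field_simp; ring
      rw [this, hss, div_le_iff₀ (by positivity)]
      linarith
    nlinarith
  have hne : S.Nonempty := ⟨_, 0, 0, by simp, by simp, rfl⟩
  have : sSup S ≤ 5 * √k + sSup S / 2 := by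
    refine csSup_le hne ?_
    rintro r ⟨y, x, hy, hx, rfl⟩
    exact hstep y x hy hx
  have := hmem y x hy hx
  linarith

lemma l2_bound {k : ℕ} (A : Matrix (Fin k) (Fin k) ℝ) (K : ℝ)
    (h : ∀ y x : Fin k → ℝ, ∑ i, y i ^ 2 ≤ 1 → ∑ i, x i ^ 2 ≤ 1 → y ⬝ᵥ A *ᵥ x ≤ K)
    (x : Fin k → ℝ) : ∑ i, (A *ᵥ x) i ^ 2 ≤ K ^ 2 * ∑ i, x i ^ 2 := by
  have ha : 0 ≤ ∑ i, x i ^ 2 := Finset.sum_nonneg fun _ _ => sq_nonneg _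
  have hb : 0 ≤ ∑ i, (A *ᵥ x) i ^ 2 := Finset.sum_nonneg fun _ _ => sq_nonneg _
  rcases hb.eq_or_lt with hb0 | hb0
  · rw [← hb0]; positivity
  rcases ha.eq_or_lt with ha0 | ha0
  · have : x = 0 := by
      ext i
      have := (Finset.sum_eq_zero_iff_of_nonneg (fun i _ => sq_nonneg (x i))).1 ha0.symm i (Finset.mem_univ i)
      simpa using this
    rw [this] at hb0; simp at hb0
  have hyy : (A *ᵥ x) ⬝ᵥ (A *ᵥ x) = ∑ i, (A *ᵥ x) i ^ 2 := by simp [dotProduct, sq]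
  have ea := Real.sq_sqrt ha
  have eb := Real.sq_sqrt hb
  have pa := Real.sqrt_pos.2 ha0
  have pb := Real.sqrt_pos.2 hb0
  have := h ((√(∑ i, (A *ᵥ x) i ^ 2))⁻¹ • (A *ᵥ x)) ((√(∑ i, x i ^ 2))⁻¹ • x) ?_ ?_
  · rw [mulVec_smul, smul_dotProduct, dotProduct_smul, hyy, smul_eq_mul, smul_eq_mul] at this
    rw [← ea, ← eb]
    rw [← eb] at this
    generalize √(∑ i, x i ^ 2) = a at *
    rw [eb] at this
    generalize √(∑ i, (A *ᵥ x) i ^ 2) = b at *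
    rw [← eb] at this
    have e : b⁻¹ * (a⁻¹ * b ^ 2) = b / a := by field_simp
    rw [e, div_le_iff₀ pa] at this
    rw [← mul_pow]
    exact pow_le_pow_left₀ pb.le this 2
  · simp only [Pi.smul_apply, smul_eq_mul, mul_pow, ← Finset.mul_sum, inv_pow, eb]
    rw [inv_mul_cancel₀ hb0.ne']
  · simp only [Pi.smul_apply, smul_eq_mul, mul_pow, ← Finset.mul_sum, inv_pow, ea]
    rw [inv_mul_cancel₀ ha0.ne']

lemma lower_unit {k : ℕ} (hk : 0 < k) (A : Matrix (Fin k) (Fin k) ℝ)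
    (hop : ∀ x : Fin k → ℝ, ∑ i, (A *ᵥ x) i ^ 2 ≤ (10 * √k) ^ 2 * ∑ i, x i ^ 2)
    (hs : ∀ z ∈ net k (k / 1000), 1 / 2 ≤ ∑ j, (1 / 2560 / √k * (z j : ℝ)) ^ 2 →
      ∑ j, (1 / 2560 / √k * (z j : ℝ)) ^ 2 ≤ 1 →
      (k : ℝ) / 128 ≤ ∑ i, |(A *ᵥ fun j => 1 / 2560 / √k * (z j : ℝ)) i|)
    (x : Fin k → ℝ) (hx : ∑ i, x i ^ 2 = 1) :
    (k : ℝ) / 2560000 ≤ √k * ∑ i, |x i| + ∑ i, |(A *ᵥ x) i| := by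
  have hk' : (0 : ℝ) < k := by exact_mod_cast hk
  have hsq : 0 < √(k : ℝ) := by positivity
  have hss : √(k : ℝ) * √k = k := Real.mul_self_sqrt hk'.le
  have hn1 : 0 ≤ ∑ i, |(A *ᵥ x) i| := Finset.sum_nonneg fun _ _ => abs_nonneg _
  have hn2 : 0 ≤ ∑ i, |x i| := Finset.sum_nonneg fun _ _ => abs_nonneg _
  by_contra hcon
  push Not at hcon
  obtain ⟨z, h1, h2, h3⟩ := trunc_vec hk x (1 / 2560) (by norm_num)
  have hz : z ∈ net k (k / 1000) := by
    rw [mem_net]; refine h1.trans ?_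
    have : √k / (1 / 2560) * ∑ i, |x i| = 2560 * (√k * ∑ i, |x i|) := by ring
    rw [this]; linarith
  have hlow : 1 / 2 ≤ ∑ j, (1 / 2560 / √k * (z j : ℝ)) ^ 2 := by
    have : ∑ i, x i ^ 2 ≤ ∑ i, (3 / 2 * (1 / 2560 / √k * (z i : ℝ)) ^ 2 +
        3 * (x i - 1 / 2560 / √k * (z i : ℝ)) ^ 2) := by
      refine Finset.sum_le_sum fun i _ => ?_
      generalize 1 / 2560 / √k * (z i : ℝ) = p
      nlinarith [sq_nonneg (3 * p - 2 * x i)]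
    rw [Finset.sum_add_distrib, ← Finset.mul_sum, ← Finset.mul_sum, hx] at this
    norm_num at this h3 ⊢
    linarith
  have hbig := hs z hz hlow (hx ▸ h2)
  let v : Fin k → ℝ := fun j => 1 / 2560 / √k * (z j : ℝ)
  have herr : ∑ i, |(A *ᵥ (x - v)) i| ≤ k / 256 := by
    refine (l1_le _).trans ?_
    have h4 : √(∑ i, (A *ᵥ (x - v)) i ^ 2) ≤ 10 * √k * (1 / 2560) := by
      apply Real.sqrt_le_iff.2
      refine ⟨by positivity, (hop _).trans ?_⟩
      rw [mul_pow (10 * √k)]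
      exact mul_le_mul_of_nonneg_left h3 (sq_nonneg _)
    calc √k * √(∑ i, (A *ᵥ (x - v)) i ^ 2) ≤ √k * (10 * √k * (1 / 2560)) := by gcongr
      _ = (√k * √k) / 256 := by ring
      _ = k / 256 := by rw [hss]
  have htri : ∑ i, |(A *ᵥ v) i| ≤ ∑ i, |(A *ᵥ x) i| + ∑ i, |(A *ᵥ (x - v)) i| := by
    rw [← Finset.sum_add_distrib]
    refine Finset.sum_le_sum fun i _ => ?_
    have : (A *ᵥ v) i = (A *ᵥ x) i - (A *ᵥ (x - v)) i := by rw [mulVec_sub]; simp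
    rw [this]; exact abs_sub _ _
  have : 0 ≤ √k * ∑ i, |x i| := by positivity
  change _ ≤ ∑ i, |(A *ᵥ v) i| at hbig
  linarith

lemma lower_all {k : ℕ} (A : Matrix (Fin k) (Fin k) ℝ)
    (h : ∀ x : Fin k → ℝ, ∑ i, x i ^ 2 = 1 →
      (k : ℝ) / 2560000 ≤ √k * ∑ i, |x i| + ∑ i, |(A *ᵥ x) i|) (x : Fin k → ℝ) :
    (k : ℝ) / 2560000 * √(∑ i, x i ^ 2) ≤ √k * ∑ i, |x i| + ∑ i, |(A *ᵥ x) i| := by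
  have ha : 0 ≤ ∑ i, x i ^ 2 := Finset.sum_nonneg fun _ _ => sq_nonneg _
  rcases ha.eq_or_lt with ha0 | ha0
  · rw [← ha0]; simp; positivity
  have ea := Real.sq_sqrt ha
  have pa := Real.sqrt_pos.2 ha0
  have := h ((√(∑ i, x i ^ 2))⁻¹ • x) ?_
  · simp only [mulVec_smul, Pi.smul_apply, smul_eq_mul, abs_mul, ← Finset.mul_sum,
      abs_of_pos (inv_pos.2 pa)] at this
    generalize √(∑ i, x i ^ 2) = a at *
    have h2 := mul_le_mul_of_nonneg_right this pa.le
    refine h2.trans (le_of_eq ?_)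
    field_simp
  · simp only [Pi.smul_apply, smul_eq_mul, mul_pow, ← Finset.mul_sum, inv_pow, ea]
    rw [inv_mul_cancel₀ ha0.ne']

lemma net_op (k : ℕ) (hk : 0 < k) (z w : Fin k → ℝ) (hz : ∑ i, z i ^ 2 ≤ 16 * k)
    (hw : ∑ i, w i ^ 2 ≤ 16 * k) :
    ∑ ω : Fin k → Fin k → Bool, Real.exp (5 / (16 * √k) *
      (z ⬝ᵥ (Matrix.of fun i j => sg (ω i j)) *ᵥ w - 80 * k * √k)) ≤
      2 ^ (k * k) * Real.exp (-(25 / 2) * k) := by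
  have hk' : (0 : ℝ) < k := by exact_mod_cast hk
  have hsq : 0 < √(k : ℝ) := by positivity
  have hss : √(k : ℝ) ^ 2 = k := Real.sq_sqrt hk'.le
  have h := mgf_bound (fun i j => 5 / (16 * √k) * (z i * w j))
  have h1 : ∀ ω : Fin k → Fin k → Bool, Real.exp (5 / (16 * √k) *
      (z ⬝ᵥ (Matrix.of fun i j => sg (ω i j)) *ᵥ w - 80 * k * √k)) =
      Real.exp (∑ i, ∑ j, 5 / (16 * √k) * (z i * w j) * sg (ω i j)) * Real.exp (-25 * k) := by
    intro ω
    rw [← Real.exp_add, mul_sub]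
    congr 1
    have : 5 / (16 * √k) * (80 * k * √k) = 25 * (k : ℝ) := by field_simp; norm_num
    rw [this]
    have : 5 / (16 * √k) * z ⬝ᵥ (Matrix.of fun i j => sg (ω i j)) *ᵥ w =
      ∑ i, ∑ j, 5 / (16 * √k) * (z i * w j) * sg (ω i j) := by
      simp only [dotProduct, mulVec, Finset.mul_sum, Matrix.of_apply]
      refine Finset.sum_congr rfl fun i _ => Finset.sum_congr rfl fun j _ => by ring
    rw [this]; ring
  simp only [h1]
  rw [← Finset.sum_mul]
  refine (mul_le_mul_of_nonneg_right h (Real.exp_pos _).le).trans ?_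
  rw [mul_assoc, ← Real.exp_add]
  refine mul_le_mul_of_nonneg_left (Real.exp_le_exp.2 ?_) (by positivity)
  have h2 : ∑ i, ∑ j, (5 / (16 * √k) * (z i * w j)) ^ 2 =
      25 / (256 * k) * ((∑ i, z i ^ 2) * ∑ j, w j ^ 2) := by
    rw [Finset.sum_mul_sum]
    simp only [Finset.mul_sum]
    refine Finset.sum_congr rfl fun i _ => Finset.sum_congr rfl fun j _ => ?_
    rw [mul_pow, mul_pow, div_pow, mul_pow, hss]; norm_num
  rw [h2]
  have h3 : (∑ i, z i ^ 2) * ∑ j, w j ^ 2 ≤ 16 * k * (16 * k) :=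
    mul_le_mul hz hw (Finset.sum_nonneg fun _ _ => sq_nonneg _) (by positivity)
  have h4 : 25 / (256 * k) * ((∑ i, z i ^ 2) * ∑ j, w j ^ 2) ≤ 25 / (256 * k) * (16 * k * (16 * k)) :=
    mul_le_mul_of_nonneg_left h3 (by positivity)
  have h5 : 25 / (256 * k) * (16 * k * (16 * k)) = 25 * (k : ℝ) := by field_simp; norm_num
  linarith

lemma net_sb (k : ℕ) (v : Fin k → ℝ) (h1 : 1 / 2 ≤ ∑ j, v j ^ 2) (h2 : ∑ j, v j ^ 2 ≤ 1) :
    ∑ ω : Fin k → Fin k → Bool, Real.exp ((k : ℝ) / 128 -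
      ∑ i, |((Matrix.of fun i j => sg (ω i j)) *ᵥ v) i|) ≤
      2 ^ (k * k) * Real.exp (-(1 / 32) * k) := by
  simp only [sub_eq_add_neg, Real.exp_add, ← Finset.mul_sum]
  have := small_ball k v h1 h2
  refine (mul_le_mul_of_nonneg_left this (Real.exp_pos _).le).trans ?_
  rw [mul_left_comm, ← Real.exp_add]
  refine mul_le_mul_of_nonneg_left (Real.exp_le_exp.2 (by linarith)) (by positivity)

lemma net_sb_t (k : ℕ) (v : Fin k → ℝ) (h1 : 1 / 2 ≤ ∑ j, v j ^ 2) (h2 : ∑ j, v j ^ 2 ≤ 1) :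
    ∑ ω : Fin k → Fin k → Bool, Real.exp ((k : ℝ) / 128 -
      ∑ i, |((Matrix.of fun i j => sg (ω i j))ᵀ *ᵥ v) i|) ≤
      2 ^ (k * k) * Real.exp (-(1 / 32) * k) := by
  refine le_trans (le_of_eq ?_) (net_sb k v h1 h2)
  rw [← (Equiv.piComm (fun (_ : Fin k) (_ : Fin k) => Bool)).sum_comp]
  rfl

lemma card_big (k : ℕ) : ((net k (4 * k)).card : ℝ) ≤ Real.exp (5 * k) := by
  refine (card_net k (4 * k) 1 1 one_pos ?_).trans (le_of_eq (by ring_nf))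
  have h1 := Real.exp_one_gt_d9
  have h2 : Real.exp (-1) * Real.exp 1 = 1 := by rw [← Real.exp_add]; simp
  nlinarith [Real.exp_pos (-1)]

lemma card_small (k : ℕ) : ((net k (k / 1000)).card : ℝ) ≤ Real.exp (2 / 125 * k) := by
  refine (card_net k (k / 1000) 6 (1 / 100) (by norm_num) ?_).trans (le_of_eq (by ring_nf))
  have h1 := Real.exp_one_gt_d9
  have h2 : Real.exp (-6) * Real.exp 6 = 1 := by rw [← Real.exp_add]; simp
  have h3 : (2.7 : ℝ) ^ 6 ≤ Real.exp 6 := by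
    rw [show (6 : ℝ) = ((6 : ℕ) : ℝ) * 1 by norm_num, Real.exp_nat_mul]
    exact pow_le_pow_left₀ (by norm_num) (by linarith) 6
  have h4 := Real.add_one_le_exp (1 / 100 : ℝ)
  have h6 := Real.exp_pos (-6)
  have h5 : Real.exp (-6) ≤ 1 / 300 := by
    norm_num at h3
    nlinarith
  nlinarith

lemma exists_good (k : ℕ) (hk : 200 ≤ k) : ∃ B : Matrix (Fin k) (Fin k) ℝ,
    (∀ i j, B i j = 1 ∨ B i j = -1) ∧
    (∀ z ∈ net k (4 * k), ∀ w ∈ net k (4 * k), ∑ i, (z i : ℝ) ^ 2 ≤ 16 * k →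
      ∑ i, (w i : ℝ) ^ 2 ≤ 16 * k →
      (fun i => (z i : ℝ)) ⬝ᵥ B *ᵥ (fun i => (w i : ℝ)) ≤ 80 * k * √k) ∧
    (∀ z ∈ net k (k / 1000), 1 / 2 ≤ ∑ j, (1 / 2560 / √k * (z j : ℝ)) ^ 2 →
      ∑ j, (1 / 2560 / √k * (z j : ℝ)) ^ 2 ≤ 1 →
      (k : ℝ) / 128 ≤ ∑ i, |(B *ᵥ fun j => 1 / 2560 / √k * (z j : ℝ)) i|) ∧
    (∀ z ∈ net k (k / 1000), 1 / 2 ≤ ∑ j, (1 / 2560 / √k * (z j : ℝ)) ^ 2 →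
      ∑ j, (1 / 2560 / √k * (z j : ℝ)) ^ 2 ≤ 1 →
      (k : ℝ) / 128 ≤ ∑ i, |(Bᵀ *ᵥ fun j => 1 / 2560 / √k * (z j : ℝ)) i|) := by
  classical
  have hk0 : 0 < k := by omega
  have hk' : (200 : ℝ) ≤ k := by exact_mod_cast hk
  by_contra hcon
  let N1 := (net k (4 * k)).filter fun z => ∑ i, (z i : ℝ) ^ 2 ≤ 16 * k
  let N2 := (net k (k / 1000)).filter fun z => 1 / 2 ≤ ∑ j, (1 / 2560 / √k * (z j : ℝ)) ^ 2 ∧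
      ∑ j, (1 / 2560 / √k * (z j : ℝ)) ^ 2 ≤ 1
  let F1 : (Fin k → Fin k → Bool) → (Fin k → ℤ) → (Fin k → ℤ) → ℝ := fun ω z w =>
    Real.exp (5 / (16 * √k) * ((fun i => (z i : ℝ)) ⬝ᵥ (Matrix.of fun i j => sg (ω i j)) *ᵥ
      (fun i => (w i : ℝ)) - 80 * k * √k))
  let F2 : (Fin k → Fin k → Bool) → (Fin k → ℤ) → ℝ := fun ω z => Real.exp ((k : ℝ) / 128 -
      ∑ i, |((Matrix.of fun i j => sg (ω i j)) *ᵥ fun j => 1 / 2560 / √k * (z j : ℝ)) i|)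
  let F3 : (Fin k → Fin k → Bool) → (Fin k → ℤ) → ℝ := fun ω z => Real.exp ((k : ℝ) / 128 -
      ∑ i, |((Matrix.of fun i j => sg (ω i j))ᵀ *ᵥ fun j => 1 / 2560 / √k * (z j : ℝ)) i|)
  have p1 : ∀ ω z w, 0 ≤ F1 ω z w := fun _ _ _ => (Real.exp_pos _).le
  have p2 : ∀ ω z, 0 ≤ F2 ω z := fun _ _ => (Real.exp_pos _).le
  have p3 : ∀ ω z, 0 ≤ F3 ω z := fun _ _ => (Real.exp_pos _).le
  have hall : ∀ ω, 1 ≤ ∑ z ∈ N1, ∑ w ∈ N1, F1 ω z w + ∑ z ∈ N2, F2 ω z + ∑ z ∈ N2, F3 ω z := by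
    intro ω
    have q1 : 0 ≤ ∑ z ∈ N1, ∑ w ∈ N1, F1 ω z w :=
      Finset.sum_nonneg fun _ _ => Finset.sum_nonneg fun _ _ => p1 _ _ _
    have q2 : 0 ≤ ∑ z ∈ N2, F2 ω z := Finset.sum_nonneg fun _ _ => p2 _ _
    have q3 : 0 ≤ ∑ z ∈ N2, F3 ω z := Finset.sum_nonneg fun _ _ => p3 _ _
    by_contra hlt
    push Not at hlt
    apply hcon
    refine ⟨Matrix.of fun i j => sg (ω i j), ?_, ?_, ?_, ?_⟩
    · intro i j
      simp only [Matrix.of_apply, sg]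
      split_ifs <;> simp
    · intro z hz w hw hz2 hw2
      by_contra hb
      push Not at hb
      have a1 : 1 ≤ F1 ω z w := by
        apply Real.one_le_exp
        have : 0 ≤ 5 / (16 * √(k : ℝ)) := by positivity
        exact mul_nonneg this (by linarith)
      have a2 : F1 ω z w ≤ ∑ w ∈ N1, F1 ω z w :=
        Finset.single_le_sum (f := fun w => F1 ω z w) (fun _ _ => p1 _ _ _)
          (Finset.mem_filter.2 ⟨hw, hw2⟩)
      have a3 : ∑ w ∈ N1, F1 ω z w ≤ ∑ z ∈ N1, ∑ w ∈ N1, F1 ω z w :=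
        Finset.single_le_sum (f := fun z => ∑ w ∈ N1, F1 ω z w)
          (fun _ _ => Finset.sum_nonneg fun _ _ => p1 _ _ _) (Finset.mem_filter.2 ⟨hz, hz2⟩)
      linarith
    · intro z hz h1 h2
      by_contra hb
      push Not at hb
      have a1 : 1 ≤ F2 ω z := Real.one_le_exp (by linarith)
      have a2 : F2 ω z ≤ ∑ z ∈ N2, F2 ω z :=
        Finset.single_le_sum (f := fun z => F2 ω z) (fun _ _ => p2 _ _)
          (Finset.mem_filter.2 ⟨hz, h1, h2⟩)
      linarith
    · intro z hz h1 h2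
      by_contra hb
      push Not at hb
      have a1 : 1 ≤ F3 ω z := Real.one_le_exp (by linarith)
      have a2 : F3 ω z ≤ ∑ z ∈ N2, F3 ω z :=
        Finset.single_le_sum (f := fun z => F3 ω z) (fun _ _ => p3 _ _)
          (Finset.mem_filter.2 ⟨hz, h1, h2⟩)
      linarith
  have hsum := Finset.sum_le_sum (s := Finset.univ) fun ω _ => hall ω
  have hP : (0 : ℝ) < 2 ^ (k * k) := by positivity
  have c1 : (N1.card : ℝ) ≤ Real.exp (5 * k) :=
    le_trans (Nat.cast_le.2 (Finset.card_filter_le _ _)) (card_big k)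
  have c2 : (N2.card : ℝ) ≤ Real.exp (2 / 125 * k) :=
    le_trans (Nat.cast_le.2 (Finset.card_filter_le _ _)) (card_small k)
  have s1 : ∑ ω, ∑ z ∈ N1, ∑ w ∈ N1, F1 ω z w ≤ 2 ^ (k * k) * Real.exp (-(5 / 2) * k) := by
    rw [Finset.sum_comm]
    have : ∀ z ∈ N1, ∑ ω, ∑ w ∈ N1, F1 ω z w ≤
        Real.exp (5 * k) * (2 ^ (k * k) * Real.exp (-(25 / 2) * k)) := by
      intro z hz
      rw [Finset.sum_comm]
      refine (Finset.sum_le_sum fun w hw => net_op k hk0 _ _ (Finset.mem_filter.1 hz).2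
        (Finset.mem_filter.1 hw).2).trans ?_
      rw [Finset.sum_const, nsmul_eq_mul]
      exact mul_le_mul_of_nonneg_right c1 (by positivity)
    refine (Finset.sum_le_sum this).trans ?_
    rw [Finset.sum_const, nsmul_eq_mul]
    refine (mul_le_mul_of_nonneg_right c1 (by positivity)).trans (le_of_eq ?_)
    rw [show -(5 / 2) * (k : ℝ) = 5 * k + (5 * k + -(25 / 2) * k) by ring, Real.exp_add, Real.exp_add]
    ring
  have s2 : ∑ ω, ∑ z ∈ N2, F2 ω z ≤ 2 ^ (k * k) * Real.exp (-(61 / 4000) * k) := by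
    rw [Finset.sum_comm]
    refine (Finset.sum_le_sum fun z hz => net_sb k _ (Finset.mem_filter.1 hz).2.1
        (Finset.mem_filter.1 hz).2.2).trans ?_
    rw [Finset.sum_const, nsmul_eq_mul]
    refine (mul_le_mul_of_nonneg_right c2 (by positivity)).trans (le_of_eq ?_)
    rw [show -(61 / 4000) * (k : ℝ) = 2 / 125 * k + -(1 / 32) * k by ring, Real.exp_add]
    ring
  have s3 : ∑ ω, ∑ z ∈ N2, F3 ω z ≤ 2 ^ (k * k) * Real.exp (-(61 / 4000) * k) := by
    rw [Finset.sum_comm]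
    refine (Finset.sum_le_sum fun z hz => net_sb_t k _ (Finset.mem_filter.1 hz).2.1
        (Finset.mem_filter.1 hz).2.2).trans ?_
    rw [Finset.sum_const, nsmul_eq_mul]
    refine (mul_le_mul_of_nonneg_right c2 (by positivity)).trans (le_of_eq ?_)
    rw [show -(61 / 4000) * (k : ℝ) = 2 / 125 * k + -(1 / 32) * k by ring, Real.exp_add]
    ring
  have hexp : ∀ u : ℝ, u ≤ -3 → Real.exp u ≤ 1 / 4 := by
    intro u hu
    have h1 := Real.add_one_le_exp (-u)
    have h2 : Real.exp u * Real.exp (-u) = 1 := by rw [← Real.exp_add]; simp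
    nlinarith [Real.exp_pos u]
  have e1 := hexp (-(5 / 2) * k) (by linarith)
  have e2 := hexp (-(61 / 4000) * k) (by linarith)
  rw [Finset.sum_add_distrib, Finset.sum_add_distrib] at hsum
  have hc : ∑ ω : Fin k → Fin k → Bool, (1 : ℝ) = 2 ^ (k * k) := by
    simp [pow_mul]
  rw [hc] at hsum
  have m1 := mul_le_mul_of_nonneg_left e1 hP.le
  have m2 := mul_le_mul_of_nonneg_left e2 hP.le
  linarith

lemma delta_facts {k l : ℕ} (B : Matrix (Fin k) (Fin k) ℝ) (R C : Finset (Fin k))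
    (hR : R.card = l + 1) (hC : C.card = l) : ∃ x : Fin k → ℝ,
    Delta 1 B R C = √k * ∑ i, |x i| + ∑ j, |(Bᵀ *ᵥ x) j| ∧ 0 ≤ Delta 2 B R C ∧
    Delta 2 B R C ^ 2 = k * ∑ i, x i ^ 2 + ∑ j, (Bᵀ *ᵥ x) j ^ 2 := by
  obtain ⟨x, h1, h2, h3, h4⟩ := exists_normal B R C hR hC
  have h3' : ∀ j ∈ C, (Bᵀ *ᵥ x) j = 0 := h3
  have h4' : ∀ j ∉ C, |(Bᵀ *ᵥ x) j| = |detSub B R (insert j C)| := h4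
  have g1 : ∀ F : ℝ → ℝ, F 0 = 0 → ∑ i ∈ R, F |detSub B (R.erase i) C| = ∑ i, F |x i| := by
    intro F hF
    rw [← Finset.sum_subset (Finset.subset_univ R)]
    · exact Finset.sum_congr rfl fun i hi => by rw [h1 i hi]
    · intro i _ hi; simp [h2 i hi, hF]
  have g2 : ∀ F : ℝ → ℝ, F 0 = 0 →
      ∑ j ∈ Cᶜ, F |detSub B R (insert j C)| = ∑ j, F |(Bᵀ *ᵥ x) j| := by
    intro F hF
    rw [← Finset.sum_subset (Finset.subset_univ Cᶜ)]
    · exact Finset.sum_congr rfl fun i hi => by rw [h4' i (by simpa using hi)]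
    · intro i _ hi; simp [h3' i (by simpa using hi), hF]
  have n2 : 0 ≤ k * ∑ i, x i ^ 2 + ∑ j, (Bᵀ *ᵥ x) j ^ 2 := by positivity
  have hD2 : Delta 2 B R C = √(k * ∑ i, x i ^ 2 + ∑ j, (Bᵀ *ᵥ x) j ^ 2) := by
    unfold Delta
    rw [g1 (fun s => s ^ (2 : ℝ)) (by norm_num), g2 (fun s => s ^ (2 : ℝ)) (by norm_num),
      Real.sqrt_eq_rpow]
    norm_num
  refine ⟨x, ?_, ?_, ?_⟩
  · unfold Delta
    rw [g1 (fun s => s ^ (1 : ℝ)) (by norm_num), g2 (fun s => s ^ (1 : ℝ)) (by norm_num),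
      Real.sqrt_eq_rpow]
    norm_num
  · rw [hD2]; positivity
  · rw [hD2, Real.sq_sqrt n2]

lemma delta_small {k l : ℕ} (hk : k < 200) (B : Matrix (Fin k) (Fin k) ℝ) (R C : Finset (Fin k))
    (hR : R.card = l + 1) (hC : C.card = l) (h0 : Delta 1 B R C ≠ 0) :
    √(2 * k) * (Delta 2 B R C / Delta 1 B R C) ≤ 51200000 := by
  obtain ⟨x, h1, h2, h3⟩ := delta_facts B R C hR hC
  have n1 : 0 ≤ ∑ i, |x i| := Finset.sum_nonneg fun _ _ => abs_nonneg _
  have n2 : 0 ≤ ∑ j, |(Bᵀ *ᵥ x) j| := Finset.sum_nonneg fun _ _ => abs_nonneg _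
  have hp : 0 ≤ Delta 1 B R C := by rw [h1]; positivity
  have hp' : 0 < Delta 1 B R C := lt_of_le_of_ne hp h0.symm
  have hle : Delta 2 B R C ≤ Delta 1 B R C := by
    refine le_of_sq_le_sq ?_ hp
    rw [h3, h1]
    have a1 := Finset.sum_sq_le_sq_sum_of_nonneg (s := Finset.univ) (f := fun i => |x i|) fun _ _ => abs_nonneg _
    have a2 := Finset.sum_sq_le_sq_sum_of_nonneg (s := Finset.univ) (f := fun j => |(Bᵀ *ᵥ x) j|) fun _ _ => abs_nonneg _
    simp only [sq_abs] at a1 a2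
    have a3 : √(k : ℝ) ^ 2 = k := Real.sq_sqrt (Nat.cast_nonneg k)
    have a4 := mul_le_mul_of_nonneg_left a1 (Nat.cast_nonneg (α := ℝ) k)
    have a5 : 0 ≤ √(k : ℝ) * (∑ i, |x i|) * ∑ j, |(Bᵀ *ᵥ x) j| := by positivity
    rw [add_sq, mul_pow, a3]
    linarith
  have hd : Delta 2 B R C / Delta 1 B R C ≤ 1 := (div_le_one hp').2 hle
  have hs : √(2 * (k : ℝ)) ≤ 20 := by
    apply Real.sqrt_le_iff.2
    have : (k : ℝ) ≤ 200 := by exact_mod_cast hk.le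
    constructor <;> linarith
  have hd0 : 0 ≤ Delta 2 B R C / Delta 1 B R C := by positivity
  nlinarith [Real.sqrt_nonneg (2 * (k : ℝ))]

lemma delta_big {k l : ℕ} (B : Matrix (Fin k) (Fin k) ℝ) (R C : Finset (Fin k))
    (hR : R.card = l + 1) (hC : C.card = l) (h0 : Delta 1 B R C ≠ 0)
    (hop : ∀ x : Fin k → ℝ, ∑ i, (Bᵀ *ᵥ x) i ^ 2 ≤ (10 * √k) ^ 2 * ∑ i, x i ^ 2)
    (hlow : ∀ x : Fin k → ℝ,
      (k : ℝ) / 2560000 * √(∑ i, x i ^ 2) ≤ √k * ∑ i, |x i| + ∑ i, |(Bᵀ *ᵥ x) i|) :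
    √(2 * k) * (Delta 2 B R C / Delta 1 B R C) ≤ 51200000 := by
  obtain ⟨x, h1, h2, h3⟩ := delta_facts B R C hR hC
  have n1 : 0 ≤ ∑ i, |x i| := Finset.sum_nonneg fun _ _ => abs_nonneg _
  have n2 : 0 ≤ ∑ j, |(Bᵀ *ᵥ x) j| := Finset.sum_nonneg fun _ _ => abs_nonneg _
  have hp : 0 ≤ Delta 1 B R C := by rw [h1]; positivity
  have hp' : 0 < Delta 1 B R C := lt_of_le_of_ne hp h0.symm
  have hx := hop x
  have hl := hlow x
  rw [← h1] at hl
  rw [mul_pow, Real.sq_sqrt (Nat.cast_nonneg k)] at hx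
  have hn : 0 ≤ ∑ i, x i ^ 2 := Finset.sum_nonneg fun _ _ => sq_nonneg _
  have hle : √(2 * k) * Delta 2 B R C ≤ 20 * (k * √(∑ i, x i ^ 2)) := by
    refine le_of_sq_le_sq ?_ (by positivity)
    rw [mul_pow, Real.sq_sqrt (by positivity), mul_pow, mul_pow, Real.sq_sqrt hn, h3]
    have hk : (0 : ℝ) ≤ k := Nat.cast_nonneg k
    have := mul_le_mul_of_nonneg_left hx hk
    have : 0 ≤ (k : ℝ) ^ 2 * ∑ i, x i ^ 2 := by positivity
    nlinarith
  rw [← mul_div_assoc, div_le_iff₀ hp']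
  linarith

theorem stmt11 :
    ∃ C : ℝ, 0 < C ∧ ∀ k : ℕ, 0 < k →
      ∃ B : Matrix (Fin k) (Fin k) ℝ, (∀ i j, B i j = 1 ∨ B i j = -1) ∧
        ∀ l : ℕ, 1 ≤ l → l ≤ k - 1 →
          ∀ R Co : Finset (Fin k), R.card = l + 1 → Co.card = l →
            (Delta 1 B R Co ≠ 0 →
              Real.sqrt (2 * k) * (Delta 2 B R Co / Delta 1 B R Co) ≤ C) ∧
            (Delta 1 Bᵀ R Co ≠ 0 →
              Real.sqrt (2 * k) * (Delta 2 Bᵀ R Co / Delta 1 Bᵀ R Co) ≤ C) := by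
  refine ⟨51200000, by norm_num, fun k hk => ?_⟩
  rcases lt_or_ge k 200 with h | h
  · refine ⟨Matrix.of fun _ _ => 1, fun i j => Or.inl rfl, fun l _ _ R Co hR hC => ⟨?_, ?_⟩⟩
    · exact fun h0 => delta_small h _ R Co hR hC h0
    · exact fun h0 => delta_small h _ R Co hR hC h0
  · obtain ⟨B, hB, b1, b2, b3⟩ := exists_good k h
    have o1 := op_bound hk B b1
    have o2 : ∀ y x : Fin k → ℝ, ∑ i, y i ^ 2 ≤ 1 → ∑ i, x i ^ 2 ≤ 1 → y ⬝ᵥ Bᵀ *ᵥ x ≤ 10 * √k := by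
      intro y x hy hx
      have := o1 x y hx hy
      rwa [Matrix.mulVec_transpose, dotProduct_comm, ← Matrix.dotProduct_mulVec]
    have p1 := l2_bound B _ o1
    have p2 := l2_bound Bᵀ _ o2
    have q1 := lower_all B (lower_unit hk B p1 b2)
    have q2 := lower_all Bᵀ (lower_unit hk Bᵀ p2 b3)
    refine ⟨B, hB, fun l _ _ R Co hR hC => ⟨fun h0 => ?_, fun h0 => ?_⟩⟩
    · exact delta_big B R Co hR hC h0 p2 q2
    · exact delta_big Bᵀ R Co hR hC h0 (by simpa using p1) (by simpa using q1)
end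

section
/- For every 0 < λ < 1 and every positive integer n there is a ⌊λn⌋ × n matrix A with ±1 entries such that for all a ∈ S^{⌊λn⌋−1}: C(λ)^{-1} ≤ ‖aA‖_{L_1^n} ≤ ‖aA‖_{L_2^n} ≤ C(λ), where C(λ) < ∞ depends on λ only. -/
open Finset

namespace KS

def sg (b : Bool) : ℝ := if b then 1 else -1

def ip {m : ℕ} (b : Fin m → ℝ) (x : Fin m → Bool) : ℝ := ∑ i, b i * sg (x i)

lemma sum_exp_ip {m : ℕ} (b : Fin m → ℝ) (v : ℝ) :
    ∑ x : Fin m → Bool, Real.exp (v * ip b x) ≤ 2 ^ m * Real.exp (v ^ 2 * (∑ i, b i ^ 2) / 2) := by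
  have h1 : ∀ x : Fin m → Bool, Real.exp (v * ip b x) = ∏ i, Real.exp (v * b i * sg (x i)) := by
    intro x
    rw [← Real.exp_sum, ip, Finset.mul_sum]
    congr 1
    exact Finset.sum_congr rfl fun i _ => by ring
  simp_rw [h1]
  have h2 := Finset.prod_univ_sum (fun _ : Fin m => (Finset.univ : Finset Bool))
    (fun i c => Real.exp (v * b i * sg c))
  rw [Fintype.piFinset_univ] at h2
  rw [← h2]
  calc ∏ i : Fin m, ∑ j : Bool, Real.exp (v * b i * sg j)
      ≤ ∏ i : Fin m, (2 * Real.exp ((v * b i) ^ 2 / 2)) := by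
        refine Finset.prod_le_prod (fun i _ => by positivity) fun i _ => ?_
        have := Real.cosh_le_exp_half_sq (v * b i)
        rw [Real.cosh_eq] at this
        simp [sg]
        linarith
    _ = _ := by
        rw [Finset.prod_mul_distrib, ← Real.exp_sum]
        simp only [Finset.prod_const, Finset.card_univ, Fintype.card_fin]
        congr 2
        rw [Finset.mul_sum, Finset.sum_div]
        exact Finset.sum_congr rfl fun i _ => by ring

lemma sum_cos_ip {m : ℕ} (b : Fin m → ℝ) (v : ℝ) :
    ∑ x : Fin m → Bool, Real.cos (v * ip b x) = 2 ^ m * ∏ i, Real.cos (v * b i) := by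
  have h1 : ∀ x : Fin m → Bool, Complex.exp ((v * ip b x : ℝ) * Complex.I)
      = ∏ i, Complex.exp ((v * b i * sg (x i) : ℝ) * Complex.I) := by
    intro x
    rw [← Complex.exp_sum, ip, Finset.mul_sum, Complex.ofReal_sum, Finset.sum_mul]
    congr 1
    exact Finset.sum_congr rfl fun i _ => by push_cast; ring
  have h2 := Finset.prod_univ_sum (fun _ : Fin m => (Finset.univ : Finset Bool))
    (fun i c => Complex.exp ((v * b i * sg c : ℝ) * Complex.I))
  rw [Fintype.piFinset_univ] at h2
  simp_rw [← h1] at h2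
  have h3 : ∀ i : Fin m, ∑ c : Bool, Complex.exp ((v * b i * sg c : ℝ) * Complex.I)
      = ((2 * Real.cos (v * b i) : ℝ) : ℂ) := by
    intro i
    simp [sg, Complex.cos]
    ring
  simp_rw [h3] at h2
  rw [← Complex.ofReal_prod] at h2
  have h4 := congrArg Complex.re h2
  rw [Complex.ofReal_re, Complex.re_sum] at h4
  simp_rw [Complex.exp_ofReal_mul_I_re] at h4
  rw [← h4, Finset.prod_mul_distrib]
  simp

lemma cos_le_exp (x : ℝ) (hx : |x| ≤ 1) : |Real.cos x| ≤ Real.exp (-(x ^ 2 / 5)) := by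
  have h3 := Real.pi_gt_three
  have h4 := Real.pi_lt_d2
  have h0 : 0 ≤ Real.cos x := by
    apply Real.cos_nonneg_of_mem_Icc
    have := abs_le.1 hx
    constructor <;> linarith
  rw [abs_of_nonneg h0]
  have h5 := Real.cos_le_one_sub_mul_cos_sq (x := x) (by linarith)
  have h6 : 1 / 5 ≤ 2 / Real.pi ^ 2 := by
    rw [div_le_div_iff₀ (by norm_num) (by positivity)]
    nlinarith
  have h7 := Real.add_one_le_exp (-(x ^ 2 / 5))
  nlinarith [sq_nonneg x]

lemma prod_cos_le {m : ℕ} (b : Fin m → ℝ) (I : Finset (Fin m)) (v kap : ℝ)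
    (h1 : ∀ i ∈ I, |v * b i| ≤ 1) (h2 : 5 * kap ≤ ∑ i ∈ I, b i ^ 2) :
    ∏ i, Real.cos (v * b i) ≤ Real.exp (-(kap * v ^ 2)) := by
  calc ∏ i, Real.cos (v * b i) ≤ |∏ i, Real.cos (v * b i)| := le_abs_self _
    _ = ∏ i, |Real.cos (v * b i)| := by rw [Finset.abs_prod]
    _ ≤ ∏ i ∈ I, |Real.cos (v * b i)| := by
        rw [← Finset.prod_mul_prod_compl I]
        refine mul_le_of_le_one_right (Finset.prod_nonneg fun i _ => abs_nonneg _) ?_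
        exact Finset.prod_le_one (fun i _ => abs_nonneg _) fun i _ => Real.abs_cos_le_one _
    _ ≤ ∏ i ∈ I, Real.exp (-((v * b i) ^ 2 / 5)) :=
        Finset.prod_le_prod (fun i _ => abs_nonneg _) fun i hi => cos_le_exp _ (h1 i hi)
    _ = Real.exp (-(v ^ 2 / 5 * ∑ i ∈ I, b i ^ 2)) := by
        rw [← Real.exp_sum, Finset.mul_sum, ← Finset.sum_neg_distrib]
        congr 1
        exact Finset.sum_congr rfl fun i _ => by ring
    _ ≤ _ := by
        apply Real.exp_le_exp.2
        nlinarith [sq_nonneg v]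

lemma exp_abs_le_cos (x : ℝ) : Real.exp (-|x|) ≤ 2 / 3 + Real.cos x / 3 := by
  have h1 : Real.exp (-|x|) ≤ 1 / (1 + |x|) := by
    rw [Real.exp_neg, ← one_div]
    apply one_div_le_one_div_of_le (by positivity)
    linarith [Real.add_one_le_exp |x|]
  have h2 := Real.one_sub_sq_div_two_le_cos (x := x)
  have h3 := Real.neg_one_le_cos x
  have h0 := abs_nonneg x
  refine h1.trans ?_
  rw [div_le_iff₀ (by positivity)]
  rw [← sq_abs] at h2
  rcases le_total |x| 2 with h | h
  · nlinarith [mul_nonneg h0 (sub_nonneg.2 h), mul_nonneg (mul_nonneg h0 h0) (sub_nonneg.2 h)]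
  · nlinarith

lemma comp_moment {m : ℕ} (b : Fin m → ℝ) (h1 : 1 / 4 ≤ ∑ i, b i ^ 2) (h2 : ∑ i, b i ^ 2 ≤ 1) :
    ∑ x : Fin m → Bool, Real.exp (-|ip b x|) ≤ 2 ^ m * (2 / 3 + Real.exp (-(1 / 20)) / 3) := by
  have hb : ∀ i, |1 * b i| ≤ 1 := by
    intro i
    rw [one_mul]
    apply abs_le_one_iff_mul_self_le_one.2
    have := Finset.single_le_sum (f := fun i => b i ^ 2) (fun i _ => sq_nonneg _) (Finset.mem_univ i)
    nlinarith
  have h3 := prod_cos_le b Finset.univ 1 (1 / 20) (fun i _ => hb i) (by linarith)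
  have h4 := sum_cos_ip b 1
  calc ∑ x : Fin m → Bool, Real.exp (-|ip b x|)
      ≤ ∑ x : Fin m → Bool, (2 / 3 + Real.cos (1 * ip b x) / 3) :=
        Finset.sum_le_sum fun x _ => by rw [one_mul]; exact exp_abs_le_cos _
    _ = 2 ^ m * (2 / 3 + (∏ i, Real.cos (1 * b i)) / 3) := by
        rw [Finset.sum_add_distrib, ← Finset.sum_div _ (fun x => Real.cos (1 * ip b x)) (3 : ℝ), h4]
        simp
        ring
    _ ≤ _ := by
        norm_num at h3 ⊢
        gcongr

open MeasureTheory in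
lemma laplace (y : ℝ) : IntegrableOn (fun v : ℝ => Real.exp (-v) * Real.cos (v * y)) (Set.Ioi 0) ∧
    ∫ v in Set.Ioi (0 : ℝ), Real.exp (-v) * Real.cos (v * y) = 1 / (1 + y ^ 2) := by
  have hi : IntegrableOn (fun v : ℝ => Real.exp (-v) * Real.cos (v * y)) (Set.Ioi 0) := by
    have := integrableOn_exp_neg_Ioi 0
    refine Integrable.mono' this (by fun_prop) ?_
    filter_upwards with v
    rw [Real.norm_eq_abs, abs_mul, abs_of_pos (Real.exp_pos _)]
    exact mul_le_of_le_one_right (Real.exp_pos _).le (Real.abs_cos_le_one _)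
  refine ⟨hi, ?_⟩
  have hpos : (1 + y ^ 2) ≠ 0 := by positivity
  have hd : ∀ v ∈ Set.Ici (0 : ℝ), HasDerivAt
      (fun v => Real.exp (-v) * ((y * Real.sin (v * y) - Real.cos (v * y)) / (1 + y ^ 2)))
      (Real.exp (-v) * Real.cos (v * y)) v := by
    intro v _
    have e1 : HasDerivAt (fun v : ℝ => Real.exp (-v)) (-Real.exp (-v)) v := by
      simpa using (hasDerivAt_neg v).exp
    have e2 : HasDerivAt (fun v : ℝ => v * y) y v := by
      simpa using (hasDerivAt_id v).mul_const y
    have e3 := e1.mul (((e2.sin.const_mul y).sub e2.cos).div_const (1 + y ^ 2))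
    refine e3.congr_deriv ?_
    simp only [Pi.sub_apply]
    field_simp
    ring
  have ht : Filter.Tendsto
      (fun v => Real.exp (-v) * ((y * Real.sin (v * y) - Real.cos (v * y)) / (1 + y ^ 2)))
      Filter.atTop (nhds 0) := by
    apply Filter.Tendsto.zero_mul_isBoundedUnder_le
    · exact Real.tendsto_exp_neg_atTop_nhds_zero
    · refine Filter.isBoundedUnder_of ⟨(|y| + 1) / (1 + y ^ 2), fun v => ?_⟩
      simp only [Function.comp, Real.norm_eq_abs]
      rw [abs_div, abs_of_pos (show 0 < 1 + y ^ 2 by positivity)]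
      gcongr
      refine (abs_sub _ _).trans ?_
      rw [abs_mul]
      gcongr
      · exact mul_le_of_le_one_right (abs_nonneg _) (Real.abs_sin_le_one _)
      · exact Real.abs_cos_le_one _
  rw [integral_Ioi_of_hasDerivAt_of_tendsto' hd hi ht]
  simp
  ring

lemma exp_abs_le_inv (x : ℝ) : Real.exp (-|x|) ≤ 2 * (1 / (1 + x ^ 2)) := by
  have := Real.quadratic_le_exp_of_nonneg (abs_nonneg x)
  rw [Real.exp_neg, ← sq_abs x, ← one_div, ← mul_div_assoc, div_le_div_iff₀ (Real.exp_pos _) (by positivity)]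
  nlinarith [abs_nonneg x]

open MeasureTheory in
lemma incomp_moment {m : ℕ} (b : Fin m → ℝ) (I : Finset (Fin m)) (kap V s : ℝ) (hs : 0 < s)
    (hk : 0 < kap) (hV : 0 < V)
    (h1 : ∀ i ∈ I, V * |b i| ≤ 1) (h2 : 5 * kap ≤ ∑ i ∈ I, b i ^ 2) :
    ∑ x : Fin m → Bool, Real.exp (-(s * |ip b x|)) ≤
      2 ^ m * (Real.sqrt (Real.pi / kap) / s + 2 * Real.exp (-(V / s))) := by
  have key : ∑ x : Fin m → Bool, 1 / (1 + (s * ip b x) ^ 2) ≤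
      2 ^ m * (Real.sqrt (Real.pi / kap) / s / 2 + Real.exp (-(V / s))) := by
    have e1 : ∑ x : Fin m → Bool, 1 / (1 + (s * ip b x) ^ 2) =
        ∫ v in Set.Ioi (0 : ℝ), ∑ x : Fin m → Bool, Real.exp (-v) * Real.cos (v * (s * ip b x)) := by
      rw [integral_finsetSum _ fun x _ => (laplace (s * ip b x)).1]
      exact Finset.sum_congr rfl fun x _ => (laplace _).2.symm
    have e2 : ∀ v : ℝ, ∑ x : Fin m → Bool, Real.exp (-v) * Real.cos (v * (s * ip b x))
        = Real.exp (-v) * (2 ^ m * ∏ i, Real.cos (v * s * b i)) := by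
      intro v
      rw [← sum_cos_ip, Finset.mul_sum]
      simp_rw [mul_assoc]
    have hpos : 0 < kap * s ^ 2 := by positivity
    have i1 : Integrable (fun v : ℝ => Real.exp (-(kap * s ^ 2) * v ^ 2)) (volume.restrict (Set.Ioi 0)) :=
      (integrable_exp_neg_mul_sq hpos).restrict
    have i2 : Integrable ((Set.Ioi (V / s)).indicator (fun v : ℝ => Real.exp (-v)))
        (volume.restrict (Set.Ioi 0)) :=
      Integrable.indicator (integrableOn_exp_neg_Ioi 0) measurableSet_Ioi
    have hle : ∫ v in Set.Ioi (0 : ℝ), ∑ x : Fin m → Bool, Real.exp (-v) * Real.cos (v * (s * ip b x))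
        ≤ ∫ v in Set.Ioi (0 : ℝ), 2 ^ m * (Real.exp (-(kap * s ^ 2) * v ^ 2) +
          (Set.Ioi (V / s)).indicator (fun v : ℝ => Real.exp (-v)) v) := by
      apply setIntegral_mono_on
      · exact integrable_finsetSum _ fun x _ => (laplace (s * ip b x)).1
      · exact (i1.add i2).const_mul _
      · exact measurableSet_Ioi
      · intro v hv
        have hv : 0 < v := hv
        rw [e2, mul_left_comm]
        apply mul_le_mul_of_nonneg_left _ (by positivity)
        by_cases hvV : V / s < v
        · rw [Set.indicator_of_mem (by exact hvV)]
          have : ∏ i, Real.cos (v * s * b i) ≤ 1 := by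
            refine (le_abs_self _).trans ?_
            rw [Finset.abs_prod]
            exact Finset.prod_le_one (fun i _ => abs_nonneg _) fun i _ => Real.abs_cos_le_one _
          have h5 := mul_le_of_le_one_right (Real.exp_pos (-v)).le this
          have := Real.exp_pos (-(kap * s ^ 2) * v ^ 2)
          linarith
        · rw [Set.indicator_of_notMem (by exact hvV), add_zero]
          have hvV : v ≤ V / s := not_lt.1 hvV
          rw [le_div_iff₀ hs] at hvV
          have h3 := prod_cos_le b I (v * s) kap (fun i hi => by
            rw [abs_mul, abs_of_pos (mul_pos hv hs)]
            exact (mul_le_mul_of_nonneg_right hvV (abs_nonneg _)).trans (h1 i hi)) h2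
          have h4 : Real.exp (-v) ≤ 1 := Real.exp_le_one_iff.2 (by linarith)
          have h5 : -(kap * s ^ 2) * v ^ 2 = -(kap * (v * s) ^ 2) := by ring
          rw [h5]
          calc _ ≤ Real.exp (-v) * Real.exp (-(kap * (v * s) ^ 2)) :=
                mul_le_mul_of_nonneg_left h3 (Real.exp_pos _).le
            _ ≤ _ := mul_le_of_le_one_left (Real.exp_pos _).le h4
    rw [e1]
    refine hle.trans (le_of_eq ?_)
    rw [integral_const_mul, integral_add i1 i2, integral_gaussian_Ioi,
      setIntegral_indicator measurableSet_Ioi]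
    have : Set.Ioi (0 : ℝ) ∩ Set.Ioi (V / s) = Set.Ioi (V / s) := by
      rw [Set.Ioi_inter_Ioi, max_eq_right (by positivity)]
    rw [this, integral_exp_neg_Ioi, ← div_div, Real.sqrt_div' _ (by positivity), Real.sqrt_sq hs.le]
  calc ∑ x : Fin m → Bool, Real.exp (-(s * |ip b x|))
      ≤ ∑ x : Fin m → Bool, 2 * (1 / (1 + (s * ip b x) ^ 2)) := by
        refine Finset.sum_le_sum fun x _ => ?_
        have := exp_abs_le_inv (s * ip b x)
        rwa [abs_mul, abs_of_pos hs] at this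
    _ = 2 * ∑ x : Fin m → Bool, (1 / (1 + (s * ip b x) ^ 2)) := by rw [Finset.mul_sum]
    _ ≤ 2 * _ := mul_le_mul_of_nonneg_left key (by norm_num)
    _ = _ := by ring

end KS

namespace KS

lemma geom_bd (s : ℝ) (hs : 0 < s) (K : ℕ) :
    ∑ i ∈ range K, Real.exp (-(s * ((i : ℝ) + 1))) ≤ 1 / s := by
  have key : ∀ K : ℕ, s * ∑ i ∈ range K, Real.exp (-(s * ((i : ℝ) + 1))) ≤ 1 - Real.exp (-(s * K)) := by
    intro K
    induction K with
    | zero => simp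
    | succ K ih =>
      rw [Finset.sum_range_succ, mul_add]
      push_cast
      have e : Real.exp (-(s * K)) = Real.exp s * Real.exp (-(s * ((K : ℝ) + 1))) := by
        rw [← Real.exp_add]; congr 1; ring
      have := Real.add_one_le_exp s
      have h2 := mul_le_mul_of_nonneg_right this (Real.exp_pos (-(s * ((K : ℝ) + 1)))).le
      rw [e] at ih
      linarith
  rw [le_div_iff₀ hs, mul_comm]
  have := key K
  have := Real.exp_pos (-(s * K))
  linarith

lemma weight_bd (s u : ℝ) (hs : 0 < s) (K : ℕ) :
    ∑ k ∈ Finset.Icc (-(K : ℤ)) K, Real.exp (-(s * |(k : ℝ)|) - u * (if k ≠ 0 then 1 else 0))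
      ≤ 1 + 2 * Real.exp (-u) / s := by
  rw [Finset.sum_Icc_of_even_eq_range (by intro k; simp)]
  rw [Finset.sum_range_succ']
  have h : ∀ i ∈ range K, Real.exp (-(s * |(((i + 1 : ℕ) : ℤ) : ℝ)|) -
      u * (if ((i + 1 : ℕ) : ℤ) ≠ 0 then 1 else 0)) = Real.exp (-u) * Real.exp (-(s * ((i : ℝ) + 1))) := by
    intro i _
    rw [← Real.exp_add, if_pos (by positivity)]
    push_cast
    rw [abs_of_nonneg (by positivity)]
    congr 1
    ring
  rw [Finset.sum_congr rfl h, ← Finset.mul_sum]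
  have := mul_le_mul_of_nonneg_left (geom_bd s hs K) (Real.exp_pos (-u)).le
  simp only [ne_eq, Nat.cast_zero, Int.cast_zero, abs_zero, not_true_eq_false, if_false, mul_zero,
    neg_zero, sub_zero, Real.exp_zero, nsmul_eq_mul]
  rw [mul_one_div] at this
  have e : 2 * Real.exp (-u) / s = 2 * (Real.exp (-u) / s) := by ring
  rw [e]
  push_cast
  linarith

lemma grid_card {m : ℕ} (G : Finset (Fin m → ℤ)) (R gam s u : ℝ) (hs : 0 < s) (hu : 0 ≤ u)
    (h : ∀ k ∈ G, ∑ i, |(k i : ℝ)| ≤ R * m ∧ ((#{i | k i ≠ 0} : ℕ) : ℝ) ≤ gam * m) :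
    (#G : ℝ) ≤ (Real.exp (s * R + u * gam) * (1 + 2 * Real.exp (-u) / s)) ^ m := by
  set K : ℕ := ⌈R * m⌉₊
  have hK : G ⊆ Fintype.piFinset fun _ : Fin m => Finset.Icc (-(K : ℤ)) K := by
    intro k hk
    rw [Fintype.mem_piFinset]
    intro i
    have h1 := Finset.single_le_sum (f := fun i => |(k i : ℝ)|) (fun i _ => abs_nonneg _)
      (Finset.mem_univ i)
    have h2 : |(k i : ℝ)| ≤ (K : ℝ) := (h1.trans (h k hk).1).trans (Nat.le_ceil _)
    have h3 : |k i| ≤ (K : ℤ) := by exact_mod_cast h2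
    rw [Finset.mem_Icc]
    exact abs_le.1 h3
  set w : ℤ → ℝ := fun k => Real.exp (-(s * |(k : ℝ)|) - u * (if k ≠ 0 then 1 else 0)) with hw
  have hw0 : ∀ k, 0 ≤ w k := fun k => (Real.exp_pos _).le
  have h1 : ∀ k ∈ G, (1 : ℝ) ≤ Real.exp (s * R + u * gam) ^ m * ∏ i, w (k i) := by
    intro k hk
    obtain ⟨a1, a2⟩ := h k hk
    rw [← Real.exp_nat_mul, hw, ← Real.exp_sum, ← Real.exp_add]
    apply Real.one_le_exp
    rw [Finset.sum_sub_distrib, Finset.sum_neg_distrib, ← Finset.mul_sum, ← Finset.mul_sum,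
      Finset.sum_boole]
    nlinarith [mul_le_mul_of_nonneg_left a1 hs.le, mul_le_mul_of_nonneg_left a2 hu]
  calc (#G : ℝ) = ∑ k ∈ G, (1 : ℝ) := by simp
    _ ≤ ∑ k ∈ G, Real.exp (s * R + u * gam) ^ m * ∏ i, w (k i) := Finset.sum_le_sum h1
    _ ≤ ∑ k ∈ Fintype.piFinset fun _ : Fin m => Finset.Icc (-(K : ℤ)) K,
        Real.exp (s * R + u * gam) ^ m * ∏ i, w (k i) :=
        Finset.sum_le_sum_of_subset_of_nonneg hK fun k _ _ =>
          mul_nonneg (by positivity) (Finset.prod_nonneg fun i _ => hw0 _)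
    _ = (Real.exp (s * R + u * gam) * ∑ k ∈ Finset.Icc (-(K : ℤ)) K, w k) ^ m := by
        rw [← Finset.mul_sum, ← Finset.prod_univ_sum, mul_pow]
        simp
    _ ≤ _ := by
        have := weight_bd s u hs K
        have h0 : 0 ≤ ∑ k ∈ Finset.Icc (-(K : ℤ)) K, w k := Finset.sum_nonneg fun k _ => hw0 k
        gcongr

lemma grid_finite {m : ℕ} (P : (Fin m → ℤ) → Prop) (R : ℝ)
    (h : ∀ k, P k → ∑ i, |(k i : ℝ)| ≤ R * m) : {k | P k}.Finite := by
  refine (Set.finite_Icc (fun _ => -(⌈R * m⌉₊ : ℤ)) (fun _ => (⌈R * m⌉₊ : ℤ))).subset ?_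
  intro k hk
  have : ∀ i, |k i| ≤ (⌈R * m⌉₊ : ℤ) := by
    intro i
    have h1 := Finset.single_le_sum (f := fun i => |(k i : ℝ)|) (fun i _ => abs_nonneg _)
      (Finset.mem_univ i)
    have h2 : |(k i : ℝ)| ≤ (⌈R * m⌉₊ : ℝ) := (h1.trans (h k hk)).trans (Nat.le_ceil _)
    exact_mod_cast h2
  rw [Set.mem_Icc]
  exact ⟨fun i => (abs_le.1 (this i)).1, fun i => (abs_le.1 (this i)).2⟩

lemma sum_col {m n : ℕ} (f : Fin n → (Fin m → Bool) → ℝ) :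
    ∑ X : Fin n → Fin m → Bool, ∏ j, f j (X j) = ∏ j, ∑ x, f j x := by
  have h2 := Finset.prod_univ_sum (fun _ : Fin n => (Finset.univ : Finset (Fin m → Bool))) f
  rw [Fintype.piFinset_univ] at h2
  exact h2.symm

open Classical in
lemma union_bd {m n : ℕ} (P : (Fin m → ℤ) → Prop) (h R gam s u t q tau : ℝ) (hs : 0 < s) (hu : 0 ≤ u)
    (ht : 0 < t) (hq0 : 0 ≤ q)
    (hP : ∀ k, P k → ∑ i, |(k i : ℝ)| ≤ R * m ∧ ((#{i | k i ≠ 0} : ℕ) : ℝ) ≤ gam * m)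
    (hq : ∀ k, P k → ∑ x : Fin m → Bool, Real.exp (-(t * |ip (fun i => h * k i) x|)) ≤ 2 ^ m * q) :
    ((#{X : Fin n → Fin m → Bool | ∃ k, P k ∧ ∑ j, |ip (fun i => h * k i) (X j)| ≤ tau * n} : ℕ) : ℝ)
      ≤ (Real.exp (s * R + u * gam) * (1 + 2 * Real.exp (-u) / s)) ^ m * (Real.exp (t * tau) * q) ^ n
        * (2 ^ m) ^ n := by
  have hfin := grid_finite P R fun k hk => (hP k hk).1
  set G := hfin.toFinset with hG
  have hG' : ∀ k, k ∈ G ↔ P k := by intro k; simp [hG]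
  have hcard := grid_card G R gam s u hs hu fun k hk => hP k ((hG' k).1 hk)
  have h1 : ({X : Fin n → Fin m → Bool | ∃ k, P k ∧ ∑ j, |ip (fun i => h * k i) (X j)| ≤ tau * n} : Finset _)
      ⊆ G.biUnion fun k => {X : Fin n → Fin m → Bool | ∑ j, |ip (fun i => h * k i) (X j)| ≤ tau * n} := by
    intro X hX
    simp only [Finset.mem_filter, Finset.mem_univ, true_and, Finset.mem_biUnion] at hX ⊢
    obtain ⟨k, hk, hk2⟩ := hX
    exact ⟨k, (hG' k).2 hk, hk2⟩
  have h2 : ∀ k ∈ G, ((#{X : Fin n → Fin m → Bool | ∑ j, |ip (fun i => h * k i) (X j)| ≤ tau * n} : ℕ) : ℝ)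
      ≤ (Real.exp (t * tau) * q) ^ n * (2 ^ m) ^ n := by
    intro k hk
    calc ((#{X : Fin n → Fin m → Bool | ∑ j, |ip (fun i => h * k i) (X j)| ≤ tau * n} : ℕ) : ℝ)
        = ∑ X ∈ ({X : Fin n → Fin m → Bool | ∑ j, |ip (fun i => h * k i) (X j)| ≤ tau * n} : Finset _), (1 : ℝ) := by
          simp
      _ ≤ ∑ X ∈ ({X : Fin n → Fin m → Bool | ∑ j, |ip (fun i => h * k i) (X j)| ≤ tau * n} : Finset _),
          Real.exp (t * tau) ^ n * ∏ j, Real.exp (-(t * |ip (fun i => h * k i) (X j)|)) := by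
          refine Finset.sum_le_sum fun X hX => ?_
          simp only [Finset.mem_filter, Finset.mem_univ, true_and] at hX
          rw [← Real.exp_nat_mul, ← Real.exp_sum, ← Real.exp_add]
          apply Real.one_le_exp
          rw [Finset.sum_neg_distrib, ← Finset.mul_sum]
          nlinarith
      _ ≤ ∑ X : Fin n → Fin m → Bool,
          Real.exp (t * tau) ^ n * ∏ j, Real.exp (-(t * |ip (fun i => h * k i) (X j)|)) :=
          Finset.sum_le_sum_of_subset_of_nonneg (Finset.filter_subset _ _) fun _ _ _ => by positivity
      _ = Real.exp (t * tau) ^ n * (∑ x : Fin m → Bool, Real.exp (-(t * |ip (fun i => h * k i) x|))) ^ n := by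
          rw [← Finset.mul_sum, sum_col (fun _ x => Real.exp (-(t * |ip (fun i => h * k i) x|)))]
          simp
      _ ≤ Real.exp (t * tau) ^ n * (2 ^ m * q) ^ n := by
          have := hq k ((hG' k).1 hk)
          gcongr
      _ = _ := by rw [mul_pow, mul_pow]; ring
  calc _ ≤ ((#(G.biUnion fun k => {X : Fin n → Fin m → Bool | ∑ j, |ip (fun i => h * k i) (X j)| ≤ tau * n}) : ℕ) : ℝ) := by
        exact_mod_cast Finset.card_le_card h1
    _ ≤ ∑ k ∈ G, ((#{X : Fin n → Fin m → Bool | ∑ j, |ip (fun i => h * k i) (X j)| ≤ tau * n} : ℕ) : ℝ) := by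
        exact_mod_cast Finset.card_biUnion_le
    _ ≤ ∑ k ∈ G, (Real.exp (t * tau) * q) ^ n * (2 ^ m) ^ n := Finset.sum_le_sum h2
    _ = #G * ((Real.exp (t * tau) * q) ^ n * (2 ^ m) ^ n) := by simp
    _ ≤ _ := by
        rw [mul_assoc]
        gcongr

lemma bilin_card {m n : ℕ} (b : Fin m → ℝ) (z : Fin n → ℝ) (hb : ∑ i, b i ^ 2 ≤ 1)
    (hz : ∑ i, z i ^ 2 ≤ 1) (r : ℝ) (hr : 0 ≤ r) :
    ((#{X : Fin n → Fin m → Bool | r ≤ ∑ j, z j * ip b (X j)} : ℕ) : ℝ)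
      ≤ Real.exp (-(r ^ 2 / 2)) * (2 ^ m) ^ n := by
  calc ((#{X : Fin n → Fin m → Bool | r ≤ ∑ j, z j * ip b (X j)} : ℕ) : ℝ)
      = ∑ X ∈ ({X : Fin n → Fin m → Bool | r ≤ ∑ j, z j * ip b (X j)} : Finset _), (1 : ℝ) := by simp
    _ ≤ ∑ X ∈ ({X : Fin n → Fin m → Bool | r ≤ ∑ j, z j * ip b (X j)} : Finset _),
        Real.exp (-r ^ 2) * ∏ j, Real.exp ((r * z j) * ip b (X j)) := by
        refine Finset.sum_le_sum fun X hX => ?_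
        simp only [Finset.mem_filter, Finset.mem_univ, true_and] at hX
        rw [← Real.exp_sum, ← Real.exp_add]
        apply Real.one_le_exp
        simp_rw [mul_assoc]
        rw [← Finset.mul_sum]
        nlinarith
    _ ≤ ∑ X : Fin n → Fin m → Bool, Real.exp (-r ^ 2) * ∏ j, Real.exp ((r * z j) * ip b (X j)) :=
        Finset.sum_le_sum_of_subset_of_nonneg (Finset.filter_subset _ _) fun _ _ _ => by positivity
    _ = Real.exp (-r ^ 2) * ∏ j, ∑ x, Real.exp ((r * z j) * ip b x) := by
        rw [← Finset.mul_sum, sum_col (fun j x => Real.exp ((r * z j) * ip b x))]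
    _ ≤ Real.exp (-r ^ 2) * ∏ j, (2 ^ m * Real.exp ((r * z j) ^ 2 / 2)) := by
        refine mul_le_mul_of_nonneg_left (Finset.prod_le_prod (fun _ _ => by positivity) fun j _ => ?_) (by positivity)
        refine (sum_exp_ip b _).trans ?_
        gcongr
        exact mul_le_of_le_one_right (sq_nonneg _) hb
    _ = (Real.exp (-r ^ 2) * Real.exp (r ^ 2 / 2 * ∑ j, z j ^ 2)) * (2 ^ m) ^ n := by
        rw [Finset.prod_mul_distrib, ← Real.exp_sum, Finset.mul_sum]
        simp only [Finset.prod_const, Finset.card_univ, Fintype.card_fin]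
        have : ∀ j, (r * z j) ^ 2 / 2 = r ^ 2 / 2 * z j ^ 2 := fun j => by ring
        simp_rw [this]
        ring
    _ ≤ _ := by
        rw [← Real.exp_add]
        gcongr
        nlinarith [sq_nonneg r]

open Classical in
lemma op_bd {m n : ℕ} (hmn : m ≤ n) (hn : 0 < n) (h g : ℝ) :
    3 * ((#{X : Fin n → Fin m → Bool | ∃ (k : Fin m → ℤ) (l : Fin n → ℤ),
      ∑ i, |(k i : ℝ)| ≤ 4 * m ∧ ∑ i, |(l i : ℝ)| ≤ 4 * n ∧ ∑ i, (h * k i) ^ 2 ≤ 1 ∧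
      ∑ i, (g * l i) ^ 2 ≤ 1 ∧ 4 * Real.sqrt n ≤ ∑ j, (g * l j) * ip (fun i => h * k i) (X j)} : ℕ) : ℝ)
      < (2 ^ m) ^ n := by
  have hfin := grid_finite (fun k : Fin m → ℤ => ∑ i, |(k i : ℝ)| ≤ 4 * m ∧ ∑ i, (h * k i) ^ 2 ≤ 1) 4
    fun k hk => hk.1
  have hfin2 := grid_finite (fun k : Fin n → ℤ => ∑ i, |(k i : ℝ)| ≤ 4 * n ∧ ∑ i, (g * k i) ^ 2 ≤ 1) 4
    fun k hk => hk.1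
  set G := hfin.toFinset with hG
  set H := hfin2.toFinset with hH
  have hGc : (#G : ℝ) ≤ 25 ^ m := by
    refine (grid_card G 4 1 (1 / 4) 0 (by norm_num) le_rfl ?_).trans ?_
    · intro k hk
      simp [hG] at hk
      refine ⟨hk.1, ?_⟩
      rw [one_mul]
      exact_mod_cast (Finset.card_le_univ _).trans (by simp)
    · gcongr
      norm_num
      have := Real.exp_one_lt_d9
      linarith
  have hHc : (#H : ℝ) ≤ 25 ^ n := by
    refine (grid_card H 4 1 (1 / 4) 0 (by norm_num) le_rfl ?_).trans ?_
    · intro k hk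
      simp [hH] at hk
      refine ⟨hk.1, ?_⟩
      rw [one_mul]
      exact_mod_cast (Finset.card_le_univ _).trans (by simp)
    · gcongr
      norm_num
      have := Real.exp_one_lt_d9
      linarith
  set B : (Fin m → ℤ) × (Fin n → ℤ) → Finset (Fin n → Fin m → Bool) := fun p =>
    {X | 4 * Real.sqrt n ≤ ∑ j, (g * p.2 j) * ip (fun i => h * p.1 i) (X j)} with hB
  have hBc : ∀ p ∈ G ×ˢ H, ((#(B p) : ℕ) : ℝ) ≤ Real.exp (-8) ^ n * (2 ^ m) ^ n := by
    intro p hp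
    simp [hG, hH] at hp
    refine (bilin_card (fun i => h * p.1 i) (fun j => g * p.2 j) hp.1.2 hp.2.2 (4 * Real.sqrt n) (by positivity)).trans ?_
    rw [← Real.exp_nat_mul, mul_pow, Real.sq_sqrt (by positivity)]
    gcongr
    linarith
  have e8 : Real.exp (-8) ≤ 1 / 2048 := by
    rw [Real.exp_neg, ← one_div]
    apply one_div_le_one_div_of_le (by norm_num)
    have e : Real.exp 8 = Real.exp 1 ^ 8 := by rw [← Real.exp_nat_mul]; norm_num
    rw [e]
    have := Real.exp_one_gt_d9
    calc (2048 : ℝ) ≤ 2.7 ^ 8 := by norm_num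
      _ ≤ _ := by gcongr; linarith
  have hT : (0 : ℝ) < (2 ^ m) ^ n := by positivity
  calc _ ≤ 3 * ((#((G ×ˢ H).biUnion B) : ℕ) : ℝ) := by
        gcongr
        intro X hX
        simp only [Finset.mem_filter, Finset.mem_univ, true_and, Finset.mem_biUnion] at hX ⊢
        obtain ⟨k, l, a1, a2, a3, a4, a5⟩ := hX
        refine ⟨(k, l), ?_, ?_⟩
        · simp [hG, hH]
          exact ⟨⟨a1, a3⟩, ⟨a2, a4⟩⟩
        · simp [hB]
          exact a5
    _ ≤ 3 * ∑ p ∈ G ×ˢ H, ((#(B p) : ℕ) : ℝ) := by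
        gcongr
        exact_mod_cast Finset.card_biUnion_le
    _ ≤ 3 * ∑ p ∈ G ×ˢ H, Real.exp (-8) ^ n * (2 ^ m) ^ n := by
        gcongr with p hp
        exact hBc p hp
    _ = 3 * ((#G * #H) * (Real.exp (-8) ^ n * (2 ^ m) ^ n)) := by simp
    _ ≤ 3 * ((25 ^ n * 25 ^ n) * ((1 / 2048) ^ n * (2 ^ m) ^ n)) := by
        have : (25 : ℝ) ^ m ≤ 25 ^ n := pow_le_pow_right₀ (by norm_num) hmn
        have := hGc.trans this
        gcongr
    _ = (3 * (625 / 2048) ^ n) * (2 ^ m) ^ n := by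
        rw [← mul_pow, ← mul_assoc, ← mul_assoc, mul_assoc 3, ← mul_pow]
        norm_num
    _ < 1 * (2 ^ m) ^ n := by
        apply mul_lt_mul_of_pos_right _ hT
        have : ((625 : ℝ) / 2048) ^ n ≤ (625 / 2048) ^ 1 :=
          pow_le_pow_of_le_one (by norm_num) (by norm_num) hn
        linarith
    _ = _ := one_mul _

end KS

namespace KS

open Classical in
lemma comp_lemma : ∃ (e0 c gam : ℝ) (N : ℕ), 0 < e0 ∧ e0 ≤ 1 / 2 ∧ 0 < c ∧ 0 < gam ∧ 16 * e0 ≤ c ∧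
    ∀ (n m : ℕ) (h : ℝ), N ≤ n → m ≤ n →
    3 * ((#{X : Fin n → Fin m → Bool | ∃ k : Fin m → ℤ,
      (∑ i, |(k i : ℝ)| ≤ (1 / e0) * m ∧ ((#{i | k i ≠ 0} : ℕ) : ℝ) ≤ gam * m ∧
        1 / 4 ≤ ∑ i, (h * k i) ^ 2 ∧ ∑ i, (h * k i) ^ 2 ≤ 1) ∧
      ∑ j, |ip (fun i => h * k i) (X j)| ≤ c * n} : ℕ) : ℝ) < (2 ^ m) ^ n := by
  set q : ℝ := 2 / 3 + Real.exp (-(1 / 20)) / 3 with hq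
  have hq0 : 0 < q := by positivity
  have hq1 : q < 1 := by
    have : Real.exp (-(1 / 20)) < 1 := Real.exp_lt_one_iff.2 (by norm_num)
    rw [hq]; linarith
  set η : ℝ := -Real.log q with hη
  have hη0 : 0 < η := by
    have := Real.log_neg hq0 hq1
    rw [hη]; linarith
  have hqe : q = Real.exp (-η) := by rw [hη, neg_neg, Real.exp_log hq0]
  set e0 : ℝ := min (1 / 2) (η / 32) with he0
  have he0pos : 0 < e0 := by rw [he0]; positivity
  set s : ℝ := e0 * η / 16 with hs
  have hs0 : 0 < s := by rw [hs]; positivity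
  set u : ℝ := Real.log (1 + 32 / (s * η)) with hu
  have h32 : 0 < 32 / (s * η) := by positivity
  have hu0 : 0 < u := Real.log_pos (by linarith)
  have hue : 2 * Real.exp (-u) / s ≤ η / 16 := by
    rw [hu, Real.exp_neg, Real.exp_log (by linarith)]
    have : (1 + 32 / (s * η))⁻¹ ≤ (32 / (s * η))⁻¹ := by
      apply inv_anti₀ h32; linarith
    rw [inv_div] at this
    rw [div_le_iff₀ hs0]
    linarith
  refine ⟨e0, η / 2, η / (16 * u), ⌈8 / η⌉₊, he0pos, min_le_left _ _, by positivity, by positivity, ?_, ?_⟩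
  · have : e0 ≤ η / 32 := min_le_right _ _
    linarith
  intro n m h hn hmn
  have hub := union_bd (n := n) (fun k : Fin m → ℤ => ∑ i, |(k i : ℝ)| ≤ (1 / e0) * m ∧
        ((#{i | k i ≠ 0} : ℕ) : ℝ) ≤ η / (16 * u) * m ∧
        1 / 4 ≤ ∑ i, (h * k i) ^ 2 ∧ ∑ i, (h * k i) ^ 2 ≤ 1) h (1 / e0) (η / (16 * u)) s u 1 q (η / 2)
        hs0 hu0.le one_pos hq0.le (fun k hk => ⟨hk.1, hk.2.1⟩) (fun k hk => by
          simp_rw [one_mul]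
          exact comp_moment _ hk.2.2.1 hk.2.2.2)
  refine (mul_le_mul_of_nonneg_left hub (by norm_num)).trans_lt ?_
  have b1 : Real.exp (s * (1 / e0) + u * (η / (16 * u))) * (1 + 2 * Real.exp (-u) / s) ≤ Real.exp (η / 4) := by
    have e1 : s * (1 / e0) + u * (η / (16 * u)) = η / 8 := by
      rw [hs]; field_simp; norm_num
    rw [e1]
    have e2 : 1 + 2 * Real.exp (-u) / s ≤ Real.exp (η / 16) := by
      linarith [Real.add_one_le_exp (η / 16)]
    calc _ ≤ Real.exp (η / 8) * Real.exp (η / 16) := by gcongr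
      _ ≤ _ := by rw [← Real.exp_add]; apply Real.exp_le_exp.2; linarith
  have b2 : Real.exp (1 * (η / 2)) * q = Real.exp (-(η / 2)) := by
    rw [hqe, ← Real.exp_add]; congr 1; ring
  rw [b2]
  have b3 : (Real.exp (s * (1 / e0) + u * (η / (16 * u))) * (1 + 2 * Real.exp (-u) / s)) ^ m ≤
      Real.exp (η / 4) ^ n := by
    refine (pow_le_pow_left₀ (by positivity) b1 m).trans ?_
    exact pow_le_pow_right₀ (Real.one_le_exp (by positivity)) hmn
  have hT : (0 : ℝ) < (2 ^ m) ^ n := by positivity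
  calc _ ≤ 3 * (Real.exp (η / 4) ^ n * Real.exp (-(η / 2)) ^ n * (2 ^ m) ^ n) := by gcongr
    _ = (3 * Real.exp (-(n * (η / 4)))) * (2 ^ m) ^ n := by
        rw [← mul_pow, ← Real.exp_add, ← Real.exp_nat_mul, ← mul_assoc]
        congr 3; ring
    _ < 1 * (2 ^ m) ^ n := by
        apply mul_lt_mul_of_pos_right _ hT
        have hn' : 8 / η ≤ n := Nat.ceil_le.1 hn
        rw [div_le_iff₀ hη0] at hn'
        have : Real.exp (-(n * (η / 4))) ≤ Real.exp (-2) := Real.exp_le_exp.2 (by linarith)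
        have h2 : Real.exp (-2) * Real.exp 2 = 1 := by rw [← Real.exp_add]; norm_num
        have h3 : 1 + 2 + 2 ^ 2 / 2 ≤ Real.exp 2 := Real.quadratic_le_exp_of_nonneg (by norm_num)
        nlinarith [Real.exp_pos (-2)]
    _ = _ := one_mul _

lemma choose_s (lam A B e0 : ℝ) (hl : lam < 1) (hA : 0 < A) (hB : 0 < B) :
    ∃ s : ℝ, 1 ≤ s ∧ 1 / (8 * e0) ≤ s ∧ (A * s) ^ lam * (B / s) ≤ 1 / 4 := by
  have h1 := (tendsto_rpow_neg_atTop (y := 1 - lam) (by linarith)).const_mul (A ^ lam * B)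
  rw [mul_zero] at h1
  have h2 := h1.eventually (gt_mem_nhds (show (0 : ℝ) < 1 / 4 by norm_num))
  obtain ⟨s, a, b, c⟩ := (h2.and ((Filter.eventually_ge_atTop 1).and
    (Filter.eventually_ge_atTop (1 / (8 * e0))))).exists
  refine ⟨s, b, c, ?_⟩
  have hs : 0 < s := by linarith
  refine le_trans (le_of_eq ?_) a.le
  rw [Real.mul_rpow hA.le hs.le, neg_sub, Real.rpow_sub hs, Real.rpow_one]
  ring

open Classical in
lemma incomp_lemma (lam e0 gam : ℝ) (hl0 : 0 < lam) (hl1 : lam < 1) (he : 0 < e0) (hg : 0 < gam) :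
    ∃ (e1 c : ℝ) (N : ℕ), 0 < e1 ∧ 2 * e1 ≤ e0 ∧ 0 < c ∧ 16 * e1 ≤ c ∧
    ∀ (n m : ℕ) (h : ℝ), N ≤ n → 0 < n → (m : ℝ) ≤ lam * n → lam * n / 2 ≤ m →
    3 * ((#{X : Fin n → Fin m → Bool | ∃ k : Fin m → ℤ,
      (∑ i, |(k i : ℝ)| ≤ (1 / e1) * m ∧ ∃ I : Finset (Fin m), gam * m / 2 ≤ ((#I : ℕ) : ℝ) ∧
        ∀ i ∈ I, e0 ^ 2 / (4 * m) ≤ (h * k i) ^ 2 ∧ (h * k i) ^ 2 ≤ 2 / (gam * m)) ∧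
      ∑ j, |ip (fun i => h * k i) (X j)| ≤ c * n} : ℕ) : ℝ) < (2 ^ m) ^ n := by
  set kap : ℝ := e0 ^ 2 * gam / 40 with hkap
  have hk0 : 0 < kap := by rw [hkap]; positivity
  set B : ℝ := Real.sqrt (Real.pi / kap) + 1 with hB
  have hB0 : 0 < B := by rw [hB]; positivity
  set A : ℝ := Real.exp 1 * 33 with hA
  have hA1 : 1 ≤ A := by
    have := Real.one_le_exp (zero_le_one (α := ℝ))
    rw [hA]; linarith
  obtain ⟨s, hs1, hs2, hs3⟩ := choose_s lam A (Real.exp 1 * B) e0 hl1 (by linarith) (by positivity)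
  have hs0 : 0 < s := by linarith
  refine ⟨1 / (16 * s), 1 / s, ⌈16 * s ^ 4 / (gam * lam)⌉₊, by positivity, ?_, by positivity, ?_, ?_⟩
  · rw [div_le_iff₀ (by positivity)] at hs2
    rw [mul_one_div, div_le_iff₀ (by positivity)]
    nlinarith
  · rw [mul_one_div, mul_comm, ← div_div]
    apply le_of_eq
    field_simp
  intro n m h hn hn0 hm1 hm2
  have hn' : 16 * s ^ 4 / (gam * lam) ≤ n := Nat.ceil_le.1 hn
  rw [div_le_iff₀ (by positivity)] at hn'
  have hnr : (0 : ℝ) < n := by exact_mod_cast hn0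
  have hm0 : (0 : ℝ) < m := by
    have : 0 < lam * n := by positivity
    linarith
  have hmV : 4 * s ^ 4 ≤ gam * m / 2 := by nlinarith
  set V : ℝ := Real.sqrt (gam * m / 2) with hV
  have hV0 : 0 < V := by rw [hV]; positivity
  have hVs : 2 * s ^ 2 ≤ V := by
    apply Real.le_sqrt_of_sq_le
    linarith [show (2 * s ^ 2) ^ 2 = 4 * s ^ 4 by ring]
  have hexp : 2 * Real.exp (-(V / s)) ≤ 1 / s := by
    have h1 : 2 * s ≤ V / s := by
      rw [le_div_iff₀ hs0]; linarith [show 2 * s * s = 2 * s ^ 2 by ring]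
    have h2 : 2 * s ≤ Real.exp (V / s) := by linarith [Real.add_one_le_exp (V / s)]
    rw [Real.exp_neg, ← div_eq_mul_inv, div_le_div_iff₀ (Real.exp_pos _) hs0]
    linarith
  have hub := union_bd (n := n) (fun k : Fin m → ℤ => ∑ i, |(k i : ℝ)| ≤ (1 / (1 / (16 * s))) * m ∧
        ∃ I : Finset (Fin m), gam * m / 2 ≤ ((#I : ℕ) : ℝ) ∧
        ∀ i ∈ I, e0 ^ 2 / (4 * m) ≤ (h * k i) ^ 2 ∧ (h * k i) ^ 2 ≤ 2 / (gam * m))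
        h (16 * s) 1 (1 / (16 * s)) 0 s (B / s) (1 / s)
        (by positivity) le_rfl hs0 (by positivity) (fun k hk => ⟨by simpa using hk.1, by
          rw [one_mul]
          exact_mod_cast (Finset.card_le_univ _).trans (by simp)⟩) (fun k hk => by
          obtain ⟨_, I, hI, hI2⟩ := hk
          refine (incomp_moment (fun i => h * k i) I kap V s hs0 hk0 hV0 ?_ ?_).trans ?_
          · intro i hi
            have := (hI2 i hi).2
            rw [← abs_of_pos hV0, ← abs_mul]
            apply abs_le_one_iff_mul_self_le_one.2
            rw [le_div_iff₀ (by positivity)] at this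
            have hVV : V ^ 2 = gam * m / 2 := Real.sq_sqrt (by positivity)
            calc V * (h * k i) * (V * (h * k i)) = V ^ 2 * (h * k i) ^ 2 := by ring
              _ ≤ 1 := by rw [hVV]; linarith
          · calc 5 * kap = (gam * m / 2) * (e0 ^ 2 / (4 * m)) := by
                  rw [hkap]; field_simp; norm_num
              _ ≤ #I * (e0 ^ 2 / (4 * m)) := by gcongr
              _ = ∑ i ∈ I, e0 ^ 2 / (4 * m) := by simp
              _ ≤ _ := Finset.sum_le_sum fun i hi => (hI2 i hi).1
          · gcongr
            rw [hB, add_div]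
            linarith)
  refine (mul_le_mul_of_nonneg_left hub (by norm_num)).trans_lt ?_
  have b1 : (Real.exp (1 / (16 * s) * (16 * s) + 0 * 1) * (1 + 2 * Real.exp (-0) / (1 / (16 * s)))) ≤ A * s := by
    have e1 : 1 / (16 * s) * (16 * s) + 0 * 1 = 1 := by field_simp; norm_num
    rw [e1, hA, mul_assoc]
    gcongr
    rw [neg_zero, Real.exp_zero, div_div_eq_mul_div, div_one]
    linarith
  have b2 : Real.exp (s * (1 / s)) * (B / s) = Real.exp 1 * B / s := by
    rw [mul_one_div_cancel hs0.ne']; ring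
  rw [b2]
  have hAs : 1 ≤ A * s := by nlinarith
  have b3 : (Real.exp (1 / (16 * s) * (16 * s) + 0 * 1) * (1 + 2 * Real.exp (-0) / (1 / (16 * s)))) ^ m ≤
      ((A * s) ^ lam) ^ n := by
    refine (pow_le_pow_left₀ (by positivity) b1 m).trans ?_
    rw [← Real.rpow_natCast, ← Real.rpow_natCast, ← Real.rpow_mul (by linarith)]
    exact Real.rpow_le_rpow_of_exponent_le hAs hm1
  have hT : (0 : ℝ) < (2 ^ m) ^ n := by positivity
  calc _ ≤ 3 * (((A * s) ^ lam) ^ n * (Real.exp 1 * B / s) ^ n * (2 ^ m) ^ n) := by gcongr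
    _ = (3 * ((A * s) ^ lam * (Real.exp 1 * B / s)) ^ n) * (2 ^ m) ^ n := by
        rw [← mul_pow, ← mul_assoc]
    _ ≤ (3 * (1 / 4) ^ n) * (2 ^ m) ^ n := by
        gcongr
    _ < 1 * (2 ^ m) ^ n := by
        apply mul_lt_mul_of_pos_right _ hT
        have : ((1 : ℝ) / 4) ^ n ≤ (1 / 4) ^ 1 :=
          pow_le_pow_of_le_one (by norm_num) (by norm_num) hn0
        linarith
    _ = _ := one_mul _

end KS

namespace KS

lemma rounding {m : ℕ} (hm : 0 < m) (a : Fin m → ℝ) (ha : ∑ i, a i ^ 2 ≤ 1) (e : ℝ) (he : 0 < e) :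
    ∃ k : Fin m → ℤ, (∀ i, |e / Real.sqrt m * k i| ≤ |a i|) ∧
      (∀ i, |a i - e / Real.sqrt m * k i| ≤ e / Real.sqrt m) ∧
      ∑ i, |(k i : ℝ)| ≤ (1 / e) * m ∧ ∑ i, (a i - e / Real.sqrt m * k i) ^ 2 ≤ e ^ 2 ∧
      ∑ i, (e / Real.sqrt m * k i) ^ 2 ≤ ∑ i, a i ^ 2 := by
  have hmr : (0 : ℝ) < m := by exact_mod_cast hm
  have hsm : 0 < Real.sqrt m := Real.sqrt_pos.2 hmr
  set h : ℝ := e / Real.sqrt m with hh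
  have hh0 : 0 < h := by positivity
  have hex : ∀ x : ℝ, ∃ k : ℤ, |h * k| ≤ |x| ∧ |x - h * k| ≤ h := by
    have pos : ∀ x : ℝ, 0 ≤ x → ∃ k : ℤ, |h * k| ≤ |x| ∧ |x - h * k| ≤ h := by
      intro x hx
      have f1 := Int.floor_le (x / h)
      have f2 := Int.lt_floor_add_one (x / h)
      have f0 : (0 : ℝ) ≤ ⌊x / h⌋ := by
        exact_mod_cast Int.floor_nonneg.2 (by positivity)
      rw [le_div_iff₀ hh0] at f1
      rw [div_lt_iff₀ hh0] at f2
      refine ⟨⌊x / h⌋, ?_, ?_⟩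
      · rw [abs_of_nonneg hx, abs_of_nonneg (by positivity)]; linarith
      · rw [abs_le]; constructor <;> linarith
    intro x
    rcases le_total 0 x with hx | hx
    · exact pos x hx
    · obtain ⟨k, h1, h2⟩ := pos (-x) (by linarith)
      refine ⟨-k, ?_, ?_⟩
      · push_cast
        rw [mul_neg, abs_neg]; rwa [abs_neg] at h1
      · push_cast
        rw [← abs_neg]
        convert h2 using 2
        ring
  choose f hf1 hf2 using hex
  refine ⟨fun i => f (a i), fun i => hf1 _, fun i => hf2 _, ?_, ?_, ?_⟩
  · have h1 : ∑ i, |a i| ≤ Real.sqrt m := by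
      apply Real.le_sqrt_of_sq_le
      have := sq_sum_le_card_mul_sum_sq (s := Finset.univ) (f := fun i => |a i|)
      simp only [sq_abs, Finset.card_univ, Fintype.card_fin] at this
      nlinarith
    have h2 : h * ∑ i, |(f (a i) : ℝ)| ≤ Real.sqrt m := by
      rw [Finset.mul_sum]
      refine le_trans (Finset.sum_le_sum fun i _ => ?_) h1
      have := hf1 (a i)
      rwa [abs_mul, abs_of_pos hh0] at this
    rw [hh, div_mul_eq_mul_div, div_le_iff₀ hsm, Real.mul_self_sqrt hmr.le] at h2
    rw [one_div, ← div_eq_inv_mul, le_div_iff₀ he]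
    linarith
  · calc ∑ i, (a i - h * f (a i)) ^ 2 ≤ ∑ i : Fin m, h ^ 2 :=
          Finset.sum_le_sum fun i _ => sq_le_sq' (abs_le.1 (hf2 _)).1 (abs_le.1 (hf2 _)).2
      _ = e ^ 2 := by
          simp only [Finset.sum_const, Finset.card_univ, Fintype.card_fin, nsmul_eq_mul]
          rw [hh, div_pow, Real.sq_sqrt hmr.le]
          field_simp
  · exact Finset.sum_le_sum fun i _ => sq_le_sq.2 (hf1 _)

lemma ip_sub {m : ℕ} (a b : Fin m → ℝ) (x : Fin m → Bool) :
    ip (fun i => a i - b i) x = ip a x - ip b x := by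
  simp [ip, sub_mul, Finset.sum_sub_distrib]

lemma ip_smul {m : ℕ} (r : ℝ) (b : Fin m → ℝ) (x : Fin m → Bool) :
    ip (fun i => r * b i) x = r * ip b x := by
  simp [ip, Finset.mul_sum, mul_assoc]

lemma op_det {m n : ℕ} (hm : 0 < m) (hn : 0 < n) (X : Fin n → Fin m → Bool)
    (hX : ¬ ∃ (k : Fin m → ℤ) (l : Fin n → ℤ),
      ∑ i, |(k i : ℝ)| ≤ 4 * m ∧ ∑ i, |(l i : ℝ)| ≤ 4 * n ∧
      ∑ i, ((1 / 4) / Real.sqrt m * k i) ^ 2 ≤ 1 ∧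
      ∑ i, ((1 / 4) / Real.sqrt n * l i) ^ 2 ≤ 1 ∧
      4 * Real.sqrt n ≤ ∑ j, ((1 / 4) / Real.sqrt n * l j) * ip (fun i => (1 / 4) / Real.sqrt m * k i) (X j))
    (a : Fin m → ℝ) (ha : ∑ i, a i ^ 2 ≤ 1) : ∑ j, ip a (X j) ^ 2 ≤ 64 * n := by
  set Q : (Fin m → ℝ) × (Fin n → ℝ) → ℝ := fun p => ∑ j, p.2 j * ip p.1 (X j) with hQ
  have hQc : Continuous Q := by
    rw [hQ]; unfold ip; fun_prop
  set S : Set ((Fin m → ℝ) × (Fin n → ℝ)) := {p | ∑ i, p.1 i ^ 2 ≤ 1 ∧ ∑ i, p.2 i ^ 2 ≤ 1} with hS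
  have hSc : IsCompact S := by
    have hb : ∀ (r : ℕ) (v : Fin r → ℝ), ∑ i, v i ^ 2 ≤ 1 → ∀ i, v i ∈ Set.Icc (-1 : ℝ) 1 := by
      intro r v hv i
      have := Finset.single_le_sum (f := fun i => v i ^ 2) (fun i _ => sq_nonneg _) (Finset.mem_univ i)
      apply abs_le.1
      apply abs_le_one_iff_mul_self_le_one.2
      nlinarith
    refine IsCompact.of_isClosed_subset
      ((isCompact_univ_pi fun _ : Fin m => isCompact_Icc (a := (-1 : ℝ)) (b := 1)).prod
        (isCompact_univ_pi fun _ : Fin n => isCompact_Icc (a := (-1 : ℝ)) (b := 1))) ?_ ?_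
    · apply IsClosed.inter
      · exact isClosed_le (f := fun p : (Fin m → ℝ) × (Fin n → ℝ) => ∑ i, p.1 i ^ 2) (by fun_prop) continuous_const
      · exact isClosed_le (f := fun p : (Fin m → ℝ) × (Fin n → ℝ) => ∑ i, p.2 i ^ 2) (by fun_prop) continuous_const
    · intro p hp
      exact ⟨fun i _ => hb _ _ hp.1 i, fun i _ => hb _ _ hp.2 i⟩
  obtain ⟨⟨a0, y0⟩, hp0, hmax⟩ := hSc.exists_isMaxOn ⟨(0, 0), by simp [hS]⟩ hQc.continuousOn
  have hmax' : ∀ b z, ∑ i, b i ^ 2 ≤ 1 → ∑ i, z i ^ 2 ≤ 1 → Q (b, z) ≤ Q (a0, y0) :=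
    fun b z h1 h2 => hmax (show (b, z) ∈ S from ⟨h1, h2⟩)
  have hM : Q (a0, y0) ≤ 8 * Real.sqrt n := by
    obtain ⟨k, _, _, k3, k4, k5⟩ := rounding hm a0 hp0.1 (1 / 4) (by norm_num)
    obtain ⟨l, _, _, l3, l4, l5⟩ := rounding hn y0 hp0.2 (1 / 4) (by norm_num)
    push Not at hX
    have h1 := hX k l (by linarith) (by linarith) (k5.trans hp0.1) (l5.trans hp0.2)
    set b : Fin m → ℝ := fun i => (1 / 4) / Real.sqrt m * k i with hb
    set z : Fin n → ℝ := fun i => (1 / 4) / Real.sqrt n * l i with hz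
    have h2 := hmax' (fun i => 4 * (a0 i - b i)) y0 (by
      simp_rw [mul_pow]; rw [← Finset.mul_sum]; norm_num at k4 ⊢; linarith) hp0.2
    have h3 := hmax' b (fun i => 4 * (y0 i - z i)) (k5.trans hp0.1) (by
      simp_rw [mul_pow]; rw [← Finset.mul_sum]; norm_num at l4 ⊢; linarith)
    have e2 : Q (fun i => 4 * (a0 i - b i), y0) = 4 * (Q (a0, y0) - Q (b, y0)) := by
      simp only [hQ]
      rw [← Finset.sum_sub_distrib, Finset.mul_sum]
      refine Finset.sum_congr rfl fun j _ => ?_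
      rw [ip_smul 4 (fun i => a0 i - b i), ip_sub]; ring
    have e3 : Q (b, fun i => 4 * (y0 i - z i)) = 4 * (Q (b, y0) - Q (b, z)) := by
      simp only [hQ]
      rw [← Finset.sum_sub_distrib, Finset.mul_sum]
      refine Finset.sum_congr rfl fun j _ => ?_
      ring
    have e1 : Q (b, z) < 4 * Real.sqrt n := h1
    linarith
  set W : ℝ := ∑ j, ip a (X j) ^ 2 with hW
  have hW0 : 0 ≤ W := Finset.sum_nonneg fun _ _ => sq_nonneg _
  rcases hW0.eq_or_lt with h0 | h0
  · rw [← h0]; positivity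
  · have hsW : 0 < Real.sqrt W := Real.sqrt_pos.2 h0
    have h1 := hmax' a (fun j => ip a (X j) / Real.sqrt W) ha (by
      simp_rw [div_pow]
      rw [← Finset.sum_div, Real.sq_sqrt hW0, ← hW, div_self h0.ne'])
    have e1 : Q (a, fun j => ip a (X j) / Real.sqrt W) = Real.sqrt W := by
      simp only [hQ]
      have : ∀ j, ip a (X j) / Real.sqrt W * ip a (X j) = ip a (X j) ^ 2 / Real.sqrt W := fun j => by ring
      simp_rw [this]
      rw [← Finset.sum_div, ← hW, Real.div_sqrt]
    have h2 : Real.sqrt W ≤ 8 * Real.sqrt n := by rw [← e1]; exact h1.trans hM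
    calc W = Real.sqrt W ^ 2 := (Real.sq_sqrt hW0).symm
      _ ≤ (8 * Real.sqrt n) ^ 2 := by gcongr
      _ = 64 * n := by rw [mul_pow, Real.sq_sqrt (by positivity)]; norm_num

lemma l1_pert {m n : ℕ} (X : Fin n → Fin m → Bool)
    (hX : ∀ a : Fin m → ℝ, ∑ i, a i ^ 2 ≤ 1 → ∑ j, ip a (X j) ^ 2 ≤ 64 * n)
    (a b : Fin m → ℝ) (e : ℝ) (he : 0 < e) (hab : ∑ i, (a i - b i) ^ 2 ≤ e ^ 2) :
    ∑ j, |ip b (X j)| - 8 * e * n ≤ ∑ j, |ip a (X j)| := by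
  have h1 := hX (fun i => e⁻¹ * (a i - b i)) (by
    simp_rw [mul_pow]
    rw [← Finset.mul_sum, inv_pow, ← div_eq_inv_mul, div_le_one (by positivity)]
    exact hab)
  have h2 : ∀ j, ip (fun i => e⁻¹ * (a i - b i)) (X j) = e⁻¹ * (ip a (X j) - ip b (X j)) := by
    intro j; rw [ip_smul e⁻¹ (fun i => a i - b i), ip_sub]
  simp_rw [h2, mul_pow] at h1
  rw [← Finset.mul_sum, inv_pow, ← div_eq_inv_mul, div_le_iff₀ (by positivity)] at h1
  have h3 := sq_sum_le_card_mul_sum_sq (s := Finset.univ) (f := fun j => |ip a (X j) - ip b (X j)|)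
  simp only [sq_abs, Finset.card_univ, Fintype.card_fin] at h3
  have h4 : ∑ j, |ip a (X j) - ip b (X j)| ≤ 8 * e * n := by
    apply abs_le_of_sq_le_sq' _ (by positivity) |>.2
    calc _ ≤ _ := h3
      _ ≤ n * (64 * n * e ^ 2) := by gcongr
      _ = _ := by ring
  have h5 : ∑ j, |ip b (X j)| ≤ ∑ j, |ip a (X j)| + ∑ j, |ip a (X j) - ip b (X j)| := by
    rw [← Finset.sum_add_distrib]
    refine Finset.sum_le_sum fun j _ => ?_
    have := abs_sub_abs_le_abs_sub (ip b (X j)) (ip a (X j))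
    rw [abs_sub_comm] at this
    linarith
  linarith

open Classical in
lemma exists_good {n m : ℕ} (P1 P2 P3 : (Fin n → Fin m → Bool) → Prop)
    (B1 : 3 * ((#{X | P1 X} : ℕ) : ℝ) < (2 ^ m) ^ n)
    (B2 : 3 * ((#{X | P2 X} : ℕ) : ℝ) < (2 ^ m) ^ n)
    (B3 : 3 * ((#{X | P3 X} : ℕ) : ℝ) < (2 ^ m) ^ n) : ∃ X, ¬ P1 X ∧ ¬ P2 X ∧ ¬ P3 X := by
  by_contra hcon
  push Not at hcon
  have hcov : (Finset.univ : Finset (Fin n → Fin m → Bool)) ⊆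
      ({X | P1 X} : Finset _) ∪ (({X | P2 X} : Finset _) ∪ ({X | P3 X} : Finset _)) := by
    intro X _
    simp only [Finset.mem_union, Finset.mem_filter, Finset.mem_univ, true_and]
    have := hcon X
    tauto
  have hc := (Finset.card_le_card hcov).trans ((Finset.card_union_le _ _).trans
    (Nat.add_le_add_left (Finset.card_union_le _ _) _))
  have hT : (Finset.univ : Finset (Fin n → Fin m → Bool)).card = (2 ^ m) ^ n := by simp
  rw [hT] at hc
  have hc' : ((2 : ℝ) ^ m) ^ n ≤ (#{X | P1 X} : ℕ) + ((#{X | P2 X} : ℕ) + (#{X | P3 X} : ℕ)) := by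
    exact_mod_cast hc
  linarith

set_option maxHeartbeats 2000000 in
lemma large (lam : ℝ) (hl0 : 0 < lam) (hl1 : lam < 1) : ∃ (c : ℝ) (N : ℕ), 0 < c ∧
    ∀ n : ℕ, N ≤ n → 0 < n → ∃ X : Fin n → Fin ⌊lam * n⌋₊ → Bool,
      ∀ a : Fin ⌊lam * n⌋₊ → ℝ, ∑ i, a i ^ 2 = 1 →
        c * n ≤ ∑ j, |ip a (X j)| ∧ ∑ j, ip a (X j) ^ 2 ≤ 64 * n := by
  classical
  obtain ⟨e0, c0, gam, N0, he0, he02, hc0, hg, hec0, hcomp⟩ := comp_lemma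
  obtain ⟨e1, c1, N1, he1, he12, hc1, hec1, hincomp⟩ := incomp_lemma lam e0 gam hl0 hl1 he0 hg
  refine ⟨min (c0 / 2) (c1 / 2), max (max N0 N1) ⌈2 / lam⌉₊, by positivity, ?_⟩
  intro n hn hn0
  have hN0 : N0 ≤ n := (le_max_left _ _).trans ((le_max_left _ _).trans hn)
  have hN1 : N1 ≤ n := (le_max_right _ _).trans ((le_max_left _ _).trans hn)
  have hN2 : 2 / lam ≤ n := Nat.ceil_le.1 ((le_max_right _ _).trans hn)
  rw [div_le_iff₀ hl0] at hN2
  have hnr : (0 : ℝ) < n := by exact_mod_cast hn0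
  set m := ⌊lam * n⌋₊ with hmdef
  have hm1 : (m : ℝ) ≤ lam * n := Nat.floor_le (by positivity)
  have hm2 : lam * n / 2 ≤ m := by
    have := Nat.lt_floor_add_one (lam * n)
    rw [← hmdef] at this
    linarith
  have hmr : (0 : ℝ) < m := by nlinarith
  have hm : 0 < m := by exact_mod_cast hmr
  have hmn : m ≤ n := by
    have : (m : ℝ) ≤ n := by nlinarith
    exact_mod_cast this
  have hsm : 0 < Real.sqrt m := Real.sqrt_pos.2 hmr
  have B1 := op_bd hmn hn0 ((1 / 4) / Real.sqrt m) ((1 / 4) / Real.sqrt n)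
  have B2 := hcomp n m (e0 / Real.sqrt m) hN0 hmn
  have B3 := hincomp n m (e1 / Real.sqrt m) hN1 hn0 hm1 hm2
  have hex : ∃ X : Fin n → Fin m → Bool, (¬ ∃ (k : Fin m → ℤ) (l : Fin n → ℤ),
      ∑ i, |(k i : ℝ)| ≤ 4 * m ∧ ∑ i, |(l i : ℝ)| ≤ 4 * n ∧
      ∑ i, ((1 / 4) / Real.sqrt m * k i) ^ 2 ≤ 1 ∧
      ∑ i, ((1 / 4) / Real.sqrt n * l i) ^ 2 ≤ 1 ∧
      4 * Real.sqrt n ≤ ∑ j, ((1 / 4) / Real.sqrt n * l j) * ip (fun i => (1 / 4) / Real.sqrt m * k i) (X j)) ∧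
      (¬ ∃ k : Fin m → ℤ,
      (∑ i, |(k i : ℝ)| ≤ (1 / e0) * m ∧ ((#{i | k i ≠ 0} : ℕ) : ℝ) ≤ gam * m ∧
        1 / 4 ≤ ∑ i, (e0 / Real.sqrt m * k i) ^ 2 ∧ ∑ i, (e0 / Real.sqrt m * k i) ^ 2 ≤ 1) ∧
      ∑ j, |ip (fun i => e0 / Real.sqrt m * k i) (X j)| ≤ c0 * n) ∧
      (¬ ∃ k : Fin m → ℤ,
      (∑ i, |(k i : ℝ)| ≤ (1 / e1) * m ∧ ∃ I : Finset (Fin m), gam * m / 2 ≤ ((#I : ℕ) : ℝ) ∧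
        ∀ i ∈ I, e0 ^ 2 / (4 * m) ≤ (e1 / Real.sqrt m * k i) ^ 2 ∧
          (e1 / Real.sqrt m * k i) ^ 2 ≤ 2 / (gam * m)) ∧
      ∑ j, |ip (fun i => e1 / Real.sqrt m * k i) (X j)| ≤ c1 * n) := by
    exact exists_good _ _ _ B1 B2 B3
  obtain ⟨X, g1, g2, g3⟩ := hex
  have hop := op_det hm hn0 X g1
  refine ⟨X, fun a ha => ⟨?_, hop a ha.le⟩⟩
  push Not at g2 g3
  by_cases hcase : ((#{i | e0 / Real.sqrt m ≤ |a i|} : ℕ) : ℝ) ≤ gam * m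
  · obtain ⟨k, k1, k2, k3, k4, k5⟩ := rounding hm a ha.le e0 he0
    have hh0 : 0 < e0 / Real.sqrt m := by positivity
    have h1 := g2 k ⟨k3, ?_, ?_, by rw [← ha]; exact k5⟩
    · have := l1_pert X hop a _ e0 he0 k4
      have hmin := min_le_left (c0 / 2) (c1 / 2)
      nlinarith
    · refine le_trans ?_ hcase
      norm_cast
      apply Finset.card_le_card
      intro i hi
      simp only [Finset.mem_filter, Finset.mem_univ, true_and] at hi ⊢
      refine le_trans ?_ (k1 i)
      rw [abs_mul, abs_of_pos hh0]
      apply le_mul_of_one_le_right hh0.le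
      exact_mod_cast Int.one_le_abs hi
    · have : ∑ i, a i ^ 2 ≤ 2 * ∑ i, (e0 / Real.sqrt m * k i) ^ 2 +
          2 * ∑ i, (a i - e0 / Real.sqrt m * k i) ^ 2 := by
        rw [Finset.mul_sum, Finset.mul_sum, ← Finset.sum_add_distrib]
        refine Finset.sum_le_sum fun i _ => ?_
        nlinarith [sq_nonneg (a i - e0 / Real.sqrt m * k i - e0 / Real.sqrt m * k i)]
      nlinarith
  · obtain ⟨k, k1, k2, k3, k4, k5⟩ := rounding hm a ha.le e1 he1
    push Not at hcase
    set J : Finset (Fin m) := {i | e0 / Real.sqrt m ≤ |a i|} with hJ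
    set J2 : Finset (Fin m) := {i | 2 / (gam * m) < a i ^ 2} with hJ2
    have hJ2c : (#J2 : ℝ) ≤ gam * m / 2 := by
      have : #J2 * (2 / (gam * m)) ≤ 1 := by
        calc #J2 * (2 / (gam * m)) = ∑ i ∈ J2, 2 / (gam * m) := by simp
          _ ≤ ∑ i ∈ J2, a i ^ 2 := Finset.sum_le_sum fun i hi => by
              simp [hJ2] at hi; exact hi.le
          _ ≤ ∑ i, a i ^ 2 := Finset.sum_le_univ_sum_of_nonneg fun i => sq_nonneg _
          _ = 1 := ha
      rw [← mul_div_assoc, div_le_one (by positivity)] at this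
      linarith
    have hI : (#J : ℝ) ≤ #(J \ J2) + #J2 := by
      exact_mod_cast (Finset.card_le_card_sdiff_add_card (s := J) (t := J2))
    have h1 := g3 k ⟨k3, J \ J2, by linarith, ?_⟩
    · have := l1_pert X hop a _ e1 he1 k4
      have hmin := min_le_right (c0 / 2) (c1 / 2)
      nlinarith
    · intro i hi
      simp only [hJ, hJ2, Finset.mem_sdiff, Finset.mem_filter, Finset.mem_univ, true_and, not_lt] at hi
      constructor
      · have a1 : e0 / Real.sqrt m ≤ |e1 / Real.sqrt m * k i| + e1 / Real.sqrt m := by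
          have := abs_sub_abs_le_abs_sub (a i) (e1 / Real.sqrt m * k i)
          linarith [k2 i, hi.1]
        have a2 : e1 / Real.sqrt m ≤ e0 / Real.sqrt m / 2 := by
          rw [div_div, mul_comm, ← div_div]; gcongr; linarith
        have a3 : e0 / Real.sqrt m / 2 ≤ |e1 / Real.sqrt m * k i| := by linarith
        rw [← sq_abs (e1 / Real.sqrt m * k i)]
        calc e0 ^ 2 / (4 * m) = (e0 / Real.sqrt m / 2) ^ 2 := by
              rw [div_pow, div_pow, Real.sq_sqrt hmr.le]; field_simp; norm_num
          _ ≤ _ := by gcongr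
      · exact (sq_le_sq.2 (k1 i)).trans hi.2

lemma small_aux {m : ℕ} (a : Fin m → ℝ) (i : Fin m) :
    (∑ j : Fin m, a j * (if (i : ℕ) ≤ j then (1 : ℝ) else -1)) -
      (∑ j : Fin m, a j * (if (i : ℕ) + 1 ≤ j then (1 : ℝ) else -1)) = 2 * a i := by
  rw [← Finset.sum_sub_distrib, Finset.sum_eq_single i]
  · rw [if_pos le_rfl, if_neg (by omega)]; ring
  · intro j _ hj
    have hj' : (j : ℕ) ≠ i := fun h => hj (Fin.ext h)
    by_cases h : (i : ℕ) ≤ j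
    · rw [if_pos h, if_pos (by omega)]; ring
    · rw [if_neg h, if_neg (by omega)]; ring
  · simp

lemma small (n m : ℕ) (hmn : m < n) (a : Fin m → ℝ) (ha : ∑ i, a i ^ 2 = 1) :
    1 ≤ n * ∑ j : Fin n, |∑ i : Fin m, a i * (if (j : ℕ) ≤ i then (1 : ℝ) else -1)| := by
  set f : Fin n → ℝ := fun j => ∑ i : Fin m, a i * (if (j : ℕ) ≤ i then (1 : ℝ) else -1) with hf
  set F : ℝ := ∑ j, |f j| with hF
  have hF0 : 0 ≤ F := Finset.sum_nonneg fun _ _ => abs_nonneg _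
  have hle : ∀ j, |f j| ≤ F := fun j =>
    Finset.single_le_sum (f := fun j => |f j|) (fun _ _ => abs_nonneg _) (Finset.mem_univ j)
  have hai : ∀ i : Fin m, |a i| ≤ F := by
    intro i
    have h1 : f ⟨i, by omega⟩ - f ⟨i + 1, by omega⟩ = 2 * a i := small_aux a i
    have h2 := abs_sub (f ⟨i, by omega⟩) (f ⟨i + 1, by omega⟩)
    rw [h1, abs_mul, abs_two] at h2
    linarith [hle ⟨i, by omega⟩, hle ⟨i + 1, by omega⟩]
  have h1 : 1 ≤ n * F ^ 2 := by
    calc 1 = ∑ i, a i ^ 2 := ha.symm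
      _ ≤ ∑ i : Fin m, F ^ 2 := Finset.sum_le_sum fun i _ =>
          sq_le_sq.2 (by rw [abs_of_nonneg hF0]; exact hai i)
      _ = m * F ^ 2 := by simp
      _ ≤ n * F ^ 2 := by gcongr
  have hn : (1 : ℝ) ≤ n := by exact_mod_cast (by omega : 1 ≤ n)
  by_contra hcon
  push Not at hcon
  have : (n * F) * (n * F) < 1 := by nlinarith [mul_nonneg (by linarith : (0 : ℝ) ≤ n) hF0]
  nlinarith [mul_nonneg (by linarith : (0 : ℝ) ≤ n) (sq_nonneg F)]

lemma mid (n : ℕ) (hn : 0 < n) (f : Fin n → ℝ) :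
    (n : ℝ)⁻¹ * ∑ j, |f j| ≤ Real.sqrt ((n : ℝ)⁻¹ * ∑ j, f j ^ 2) := by
  have hnr : (0 : ℝ) < n := by exact_mod_cast hn
  apply Real.le_sqrt_of_sq_le
  have := sq_sum_le_card_mul_sum_sq (s := Finset.univ) (f := fun j => |f j|)
  simp only [sq_abs, Finset.card_univ, Fintype.card_fin] at this
  calc ((n : ℝ)⁻¹ * ∑ j, |f j|) ^ 2 = (n : ℝ)⁻¹ ^ 2 * (∑ j, |f j|) ^ 2 := by ring
    _ ≤ (n : ℝ)⁻¹ ^ 2 * (n * ∑ j, f j ^ 2) := by gcongr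
    _ = _ := by field_simp

end KS

/-- For every `0 < λ < 1` there is a constant `C(λ) < ∞` such that for every positive
integer `n` there is a `⌊λn⌋ × n` matrix `A` with `±1` entries such that for all
`a ∈ S^{⌊λn⌋−1}`: `C(λ)⁻¹ ≤ ‖aA‖_{L_1^n} ≤ ‖aA‖_{L_2^n} ≤ C(λ)`. -/
theorem stmt13 (lam : ℝ) (hlam0 : 0 < lam) (hlam1 : lam < 1) :
    ∃ C : ℝ, 0 < C ∧ ∀ n : ℕ, 0 < n →
      ∃ A : Matrix (Fin ⌊lam * n⌋₊) (Fin n) ℝ,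
        (∀ i j, A i j = 1 ∨ A i j = -1) ∧
        ∀ a : Fin ⌊lam * n⌋₊ → ℝ, (∑ i, a i ^ 2) = 1 →
          C⁻¹ ≤ (n : ℝ)⁻¹ * ∑ j, |∑ i, a i * A i j| ∧
          (n : ℝ)⁻¹ * ∑ j, |∑ i, a i * A i j|
            ≤ Real.sqrt ((n : ℝ)⁻¹ * ∑ j, (∑ i, a i * A i j) ^ 2) ∧
          Real.sqrt ((n : ℝ)⁻¹ * ∑ j, (∑ i, a i * A i j) ^ 2) ≤ C := by
  obtain ⟨c, N, hc, hL⟩ := KS.large lam hlam0 hlam1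
  have hC : 0 < (N : ℝ) ^ 2 + 8 + 1 / c := by positivity
  refine ⟨(N : ℝ) ^ 2 + 8 + 1 / c, hC, ?_⟩
  intro n hn
  have hnr : (0 : ℝ) < n := by exact_mod_cast hn
  have hc' : 0 < 1 / c := by positivity
  have hN2 : (0 : ℝ) ≤ (N : ℝ) ^ 2 := by positivity
  by_cases hnN : N ≤ n
  · obtain ⟨X, hX⟩ := hL n hnN hn
    refine ⟨fun i j => KS.sg (X j i), ?_, ?_⟩
    · intro i j
      dsimp only [KS.sg]
      split_ifs <;> simp
    · intro a ha
      obtain ⟨h1, h2⟩ := hX a ha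
      refine ⟨?_, KS.mid n hn (fun j => ∑ i, a i * KS.sg (X j i)), ?_⟩
      · change _ ≤ (n : ℝ)⁻¹ * ∑ j, |KS.ip a (X j)|
        rw [← div_eq_inv_mul, le_div_iff₀ hnr]
        refine le_trans ?_ h1
        gcongr
        rw [inv_le_comm₀ hC hc, ← one_div]
        linarith
      · change Real.sqrt ((n : ℝ)⁻¹ * ∑ j, KS.ip a (X j) ^ 2) ≤ _
        rw [Real.sqrt_le_left hC.le, ← div_eq_inv_mul, div_le_iff₀ hnr]
        refine h2.trans ?_
        gcongr
        nlinarith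
  · push Not at hnN
    have hNr : (n : ℝ) ≤ N := by exact_mod_cast hnN.le
    have hn1 : (1 : ℝ) ≤ n := by exact_mod_cast hn
    have hm1 : (⌊lam * n⌋₊ : ℝ) ≤ lam * n := Nat.floor_le (by positivity)
    have hmn : ⌊lam * n⌋₊ < n := by
      have : (⌊lam * n⌋₊ : ℝ) < n := by nlinarith
      exact_mod_cast this
    refine ⟨fun i j => if (j : ℕ) ≤ i then (1 : ℝ) else -1, ?_, ?_⟩
    · intro i j
      dsimp only
      split_ifs <;> simp
    · intro a ha
      have h1 := KS.small n _ hmn a ha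
      refine ⟨?_, KS.mid n hn (fun j => ∑ i, a i * if (j : ℕ) ≤ i then (1 : ℝ) else -1), ?_⟩
      · rw [← div_eq_inv_mul, le_div_iff₀ hnr, ← div_eq_inv_mul, div_le_iff₀ hC]
        set F := ∑ j : Fin n, |∑ i, a i * (if (j : ℕ) ≤ i then (1 : ℝ) else -1)|
        have hF0 : 0 ≤ F := Finset.sum_nonneg fun _ _ => abs_nonneg _
        have h3 : (n : ℝ) ^ 2 ≤ (N : ℝ) ^ 2 := by gcongr
        nlinarith
      · rw [Real.sqrt_le_left hC.le, ← div_eq_inv_mul, div_le_iff₀ hnr]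
        have h2 : ∀ j : Fin n, (∑ i, a i * if (j : ℕ) ≤ i then (1 : ℝ) else -1) ^ 2 ≤ n := by
          intro j
          have := sq_sum_le_card_mul_sum_sq (s := Finset.univ)
            (f := fun i : Fin ⌊lam * n⌋₊ => a i * if (j : ℕ) ≤ i then (1 : ℝ) else -1)
          refine this.trans ?_
          have e : ∀ i : Fin ⌊lam * n⌋₊, (a i * if (j : ℕ) ≤ i then (1 : ℝ) else -1) ^ 2 = a i ^ 2 := by
            intro i; split_ifs <;> ring
          simp_rw [e]
          rw [ha]
          simp
          exact hmn.le
        calc _ ≤ ∑ j : Fin n, (n : ℝ) := Finset.sum_le_sum fun j _ => h2 j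
          _ = n * n := by simp
          _ ≤ _ := by
            gcongr
            have h3 : (N : ℝ) ≤ (N : ℝ) ^ 2 := by nlinarith
            nlinarith
end

section
/- Let t be an even positive integer and k = 2^t. Let B be the k×k Walsh matrix, with rows indexed by subsets σ ⊆ {1,…,t}, columns indexed by ε ∈ {−1,1}^t, and entry W_σ(ε) = Π_{i∈σ} ε_i. Let a = (a_σ) be the vector with a_σ = 1 if σ ⊆ {1,…,t/2} and a_σ = 0 otherwise. Then ‖√k a‖_{L_2^k} = ‖aB‖_{L_2^k} = k^{1/4} while ‖√k a‖_{L_1^k} = ‖aB‖_{L_1^k} = 1. In particular, the span of the rows of [√k I, B] with B the Walsh matrix does not give a Kashin splitting with a constant independent of k. -/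
open Finset

lemma aux_sum (t : ℕ) (S : Finset (Fin t)) (g : Bool → ℝ) :
    ∑ ε : Fin t → Bool, ∏ i ∈ S, g (ε i) = (g true + g false) ^ S.card * 2 ^ (t - S.card) := by
  have h1 : ∀ ε : Fin t → Bool, ∏ i ∈ S, g (ε i) = ∏ i, (if i ∈ S then g (ε i) else 1) := by
    intro ε
    simp [Finset.prod_ite_mem]
  simp_rw [h1]
  have h2 := Finset.prod_univ_sum (fun _ : Fin t => (Finset.univ : Finset Bool))
    (fun i b => if i ∈ S then g b else 1)
  rw [Fintype.piFinset_univ] at h2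
  rw [← h2]
  have h3 : ∀ i : Fin t, ∑ b : Bool, (if i ∈ S then g b else 1)
      = if i ∈ S then g true + g false else 2 := by
    intro i
    by_cases h : i ∈ S <;> simp [h]
  simp_rw [h3]
  rw [Finset.prod_ite]
  simp only [Finset.prod_const]
  congr 2
  · simp
  · rw [Finset.filter_not, Finset.card_sdiff_of_subset (Finset.filter_subset _ _)]
    simp

/-- Let `t` be an even positive integer and `k = 2^t`. Let `B` be the `k×k` Walsh matrix,
with rows indexed by subsets `σ ⊆ {1,…,t}`, columns indexed by `ε ∈ {−1,1}^t` (encoded by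
`Fin t → Bool`), and entries `W_σ(ε) = ∏_{i∈σ} ε_i`. Let `a = (a_σ)` with `a_σ = 1` if
`σ ⊆ {1,…,t/2}` and `a_σ = 0` otherwise. Then
`‖√k a‖_{L_2^k} = ‖aB‖_{L_2^k} = k^{1/4}` while `‖√k a‖_{L_1^k} = ‖aB‖_{L_1^k} = 1`
(so the rows of `[√k I, B]` do not give a Kashin splitting with constant independent
of `k`). -/
theorem stmt14 (t : ℕ) (ht : 0 < t) (hte : Even t)
    (k : ℕ) (hk : k = 2 ^ t)
    (W : Finset (Fin t) → (Fin t → Bool) → ℝ)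
    (hW : ∀ σ ε, W σ ε = ∏ i ∈ σ, (if ε i then (1 : ℝ) else -1))
    (a : Finset (Fin t) → ℝ)
    (ha : ∀ σ, a σ = if σ ⊆ Finset.univ.filter (fun i : Fin t => (i : ℕ) < t / 2)
      then (1 : ℝ) else 0) :
    Real.sqrt ((k : ℝ)⁻¹ * ∑ σ : Finset (Fin t), (Real.sqrt k * a σ) ^ 2)
        = (k : ℝ) ^ ((1 : ℝ) / 4) ∧
    Real.sqrt ((k : ℝ)⁻¹ * ∑ ε : Fin t → Bool, (∑ σ : Finset (Fin t), a σ * W σ ε) ^ 2)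
        = (k : ℝ) ^ ((1 : ℝ) / 4) ∧
    (k : ℝ)⁻¹ * ∑ σ : Finset (Fin t), |Real.sqrt k * a σ| = 1 ∧
    (k : ℝ)⁻¹ * ∑ ε : Fin t → Bool, |∑ σ : Finset (Fin t), a σ * W σ ε| = 1 := by
  obtain ⟨m, rfl⟩ := hte
  have hm : (m + m) / 2 = m := by omega
  rw [hm] at ha
  set S : Finset (Fin (m + m)) := Finset.univ.filter (fun i => (i : ℕ) < m) with hS
  have hc : S.card = m := by
    rw [hS, Fin.card_filter_val_lt]
    omega
  have hkm : (k : ℝ) = 2 ^ m * 2 ^ m := by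
    rw [hk]; push_cast; ring
  have hp : (0 : ℝ) < 2 ^ m := by positivity
  have hsq : Real.sqrt k = 2 ^ m := by
    rw [hkm]; exact Real.sqrt_mul_self hp.le
  have hq : (k : ℝ) ^ ((1 : ℝ) / 4) = Real.sqrt (2 ^ m) := by
    rw [← hsq, Real.sqrt_eq_rpow, Real.sqrt_eq_rpow, ← Real.rpow_mul (Nat.cast_nonneg k)]
    norm_num
  have hsum : ∀ f : Finset (Fin (m + m)) → ℝ, ∑ σ, a σ * f σ = ∑ σ ∈ S.powerset, f σ := by
    intro f
    simp_rw [ha, ite_mul, one_mul, zero_mul]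
    rw [← Finset.sum_filter]
    congr 1
    ext σ
    simp
  have hB : ∀ ε, ∑ σ, a σ * W σ ε = ∏ i ∈ S, (1 + (if ε i then (1 : ℝ) else -1)) := by
    intro ε
    rw [hsum, Finset.prod_one_add]
    exact Finset.sum_congr rfl fun σ _ => hW σ ε
  have ha1 : ∑ σ, a σ = 2 ^ m := by
    have := hsum (fun _ => 1)
    simpa [hc] using this
  have ha2 : ∀ σ, (a σ) ^ 2 = a σ := by
    intro σ; rw [ha]; split_ifs <;> norm_num
  have ha3 : ∀ σ, |a σ| = a σ := by
    intro σ; rw [ha]; split_ifs <;> norm_num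
  have hsub : m + m - m = m := by omega
  rw [hq]
  refine ⟨?_, ?_, ?_, ?_⟩
  · congr 1
    simp_rw [mul_pow, ha2]
    rw [← Finset.mul_sum, ha1, hsq, hkm]
    field_simp
  · congr 1
    simp_rw [hB, ← Finset.prod_pow]
    rw [aux_sum (m + m) S (fun b => (1 + (if b then (1 : ℝ) else -1)) ^ 2), hc, hsub, hkm]
    have h4 : ((1 + (if (true : Bool) then (1 : ℝ) else -1)) ^ 2
      + (1 + (if (false : Bool) then (1 : ℝ) else -1)) ^ 2) = 2 * 2 := by norm_num
    beta_reduce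
    rw [h4, mul_pow]
    field_simp
  · simp_rw [abs_mul, ha3]
    rw [← Finset.mul_sum, ha1, hsq, hkm, abs_of_pos hp]
    field_simp
  · simp_rw [hB, Finset.abs_prod]
    rw [aux_sum (m + m) S (fun b => |1 + (if b then (1 : ℝ) else -1)|), hc, hsub, hkm]
    have h4 : (|1 + (if (true : Bool) then (1 : ℝ) else -1)|
      + |1 + (if (false : Bool) then (1 : ℝ) else -1)|) = 2 := by norm_num
    beta_reduce
    rw [h4]
    field_simp
end

section
/- For every positive integer k, every integer 1 ≤ l ≤ k/2 and every 0 < δ < 1, the covering number of F_l^k by Euclidean balls of radius δ satisfies N(F_l^k, δ B₂^k) ≤ e^{3l(log(k/l) + log(2/δ))}. -/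
open Finset

lemma aux_round (r : ℝ) : ∃ z : ℤ, |(z : ℝ)| ≤ |r| ∧ |r - z| ≤ 1 := by
  rcases le_total 0 r with h | h
  · refine ⟨⌊r⌋, ?_, ?_⟩
    · have : (0 : ℝ) ≤ ⌊r⌋ := by exact_mod_cast Int.floor_nonneg.2 h
      rw [abs_of_nonneg this, abs_of_nonneg h]
      exact Int.floor_le r
    · rw [abs_le]; constructor <;> linarith [Int.floor_le r, Int.lt_floor_add_one r]
  · refine ⟨⌈r⌉, ?_, ?_⟩
    · have : (⌈r⌉ : ℝ) ≤ 0 := by exact_mod_cast Int.ceil_le.2 (by simpa using h)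
      rw [abs_of_nonpos this, abs_of_nonpos h]
      linarith [Int.le_ceil r]
    · rw [abs_le]; constructor <;> linarith [Int.le_ceil r, Int.ceil_lt_add_one r]

lemma aux_sum_s15 (y δ : ℝ) (hδ : 0 < δ) (M : ℕ) :
    ∑ j ∈ Finset.Icc (-(M : ℤ)) M, (if j = 0 then (1 : ℝ) else y * ((1 + δ)⁻¹) ^ j.natAbs)
      = 1 + 2 * y / δ * (1 - ((1 + δ)⁻¹) ^ M) := by
  induction M with
  | zero => simp
  | succ M ih =>
    have h : Finset.Icc (-((M + 1 : ℕ) : ℤ)) ((M + 1 : ℕ) : ℤ)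
        = insert (-((M : ℤ) + 1)) (insert ((M : ℤ) + 1) (Finset.Icc (-(M : ℤ)) M)) := by
      ext j
      simp only [Finset.mem_Icc, Finset.mem_insert]
      push_cast
      omega
    rw [h, Finset.sum_insert, Finset.sum_insert, ih, if_neg (by omega), if_neg (by omega)]
    · have e1 : (-((M : ℤ) + 1)).natAbs = M + 1 := by omega
      have e2 : ((M : ℤ) + 1).natAbs = M + 1 := by omega
      rw [e1, e2, pow_succ]
      generalize ((1 + δ)⁻¹) ^ M = p
      have : (1 + δ) ≠ 0 := by positivity
      field_simp
      ring
    · simp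
    · simp only [Finset.mem_Icc, Finset.mem_insert]
      omega

lemma aux_count (k l M : ℕ) (hl1 : 1 ≤ l) (hk : 2 * l ≤ k) (δ : ℝ) (hδ0 : 0 < δ) (hδ1 : δ < 1)
    (G : Finset (Fin k → ℤ)) (hG : G ⊆ Fintype.piFinset (fun _ => Finset.Icc (-(M : ℤ)) M))
    (h1 : ∀ z ∈ G, (Finset.univ.filter fun i => z i ≠ 0).card ≤ l)
    (h2 : ∀ z ∈ G, δ * ((∑ i, (z i).natAbs : ℕ) : ℝ) ≤ l) :
    (G.card : ℝ) ≤ (2 * k / (l * δ)) ^ (3 * l) := by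
  have hl : (1 : ℝ) ≤ l := by exact_mod_cast hl1
  have hl0 : (0 : ℝ) < l := by linarith
  have hkl : (2 : ℝ) * l ≤ k := by exact_mod_cast hk
  have hk0 : (0 : ℝ) < k := by linarith
  set Q : ℝ := 2 * k / (l * δ) with hQ
  have hQ4 : 4 ≤ Q := by
    rw [hQ, le_div_iff₀ (by positivity)]
    nlinarith
  have hQ0 : 0 < Q := by linarith
  let w : ℤ → ℝ := fun j => if j = 0 then (1 : ℝ) else Q⁻¹ * ((1 + δ)⁻¹) ^ j.natAbs
  have hw0 : ∀ j, 0 ≤ w j := by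
    intro j; simp only [w]; split_ifs <;> positivity
  have hweight : ∀ z ∈ G, Q⁻¹ ^ l * (Real.exp l)⁻¹ ≤ ∏ i, w (z i) := by
    intro z hz
    have e : ∀ i, w (z i) = (if z i ≠ 0 then Q⁻¹ else 1) * ((1 + δ)⁻¹) ^ (z i).natAbs := by
      intro i; by_cases h : z i = 0 <;> simp [w, h]
    simp_rw [e]
    rw [Finset.prod_mul_distrib, Finset.prod_pow_eq_pow_sum, ← Finset.prod_filter,
      Finset.prod_const]
    gcongr ?_ * ?_
    · exact pow_le_pow_of_le_one (by positivity) (inv_le_one_of_one_le₀ (by linarith)) (h1 z hz)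
    · rw [inv_pow]
      apply inv_anti₀ (by positivity)
      calc (1 + δ) ^ (∑ i, (z i).natAbs) ≤ (Real.exp δ) ^ (∑ i, (z i).natAbs) := by
            gcongr; linarith [Real.add_one_le_exp δ]
        _ = Real.exp (((∑ i, (z i).natAbs : ℕ) : ℝ) * δ) := by rw [Real.exp_nat_mul]
        _ ≤ _ := by
            apply Real.exp_le_exp.2; rw [mul_comm]; exact h2 z hz
  have hS : ∑ j ∈ Finset.Icc (-(M : ℤ)) M, w j ≤ Real.exp (l / k) := by
    have := aux_sum_s15 Q⁻¹ δ hδ0 M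
    simp only [w]
    rw [this]
    have hp : 0 ≤ ((1 + δ)⁻¹) ^ M := by positivity
    have e : 2 * Q⁻¹ / δ = l / k := by rw [hQ]; field_simp
    rw [e]
    have : 0 ≤ (l : ℝ) / k := by positivity
    nlinarith [Real.add_one_le_exp ((l : ℝ) / k)]
  have htot : (G.card : ℝ) * (Q⁻¹ ^ l * (Real.exp l)⁻¹) ≤ Real.exp l := by
    calc (G.card : ℝ) * (Q⁻¹ ^ l * (Real.exp l)⁻¹) ≤ ∑ z ∈ G, ∏ i, w (z i) := by
          rw [← nsmul_eq_mul]; exact Finset.card_nsmul_le_sum _ _ _ hweight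
      _ ≤ ∑ z ∈ Fintype.piFinset (fun _ : Fin k => Finset.Icc (-(M : ℤ)) M), ∏ i, w (z i) :=
          Finset.sum_le_sum_of_subset_of_nonneg hG
            (fun z _ _ => Finset.prod_nonneg fun i _ => hw0 _)
      _ = ∏ _i : Fin k, ∑ j ∈ Finset.Icc (-(M : ℤ)) M, w j := by
          rw [Finset.prod_univ_sum]
      _ = (∑ j ∈ Finset.Icc (-(M : ℤ)) M, w j) ^ k := by simp
      _ ≤ Real.exp (l / k) ^ k := by
          gcongr
      _ = Real.exp l := by
          rw [← Real.exp_nat_mul]; congr 1; field_simp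
  have hexp : Real.exp l ≤ Q ^ l := by
    have : Real.exp l = Real.exp 1 ^ l := by rw [← Real.exp_nat_mul]; simp
    rw [this]
    gcongr
    linarith [Real.exp_one_lt_d9]
  have hE := Real.exp_pos (l : ℝ)
  have hQl : 0 < Q ^ l := by positivity
  rw [inv_pow, ← mul_inv, ← div_eq_mul_inv, div_le_iff₀ (by positivity)] at htot
  calc (G.card : ℝ) ≤ Real.exp l * (Q ^ l * Real.exp l) := htot
    _ ≤ Q ^ l * (Q ^ l * Q ^ l) := by gcongr
    _ = Q ^ (3 * l) := by ring



open scoped Classical in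
/-- `F_l^k`: vectors in the Euclidean unit ball of `ℝ^k` with at most `l` nonzero
coordinates. -/
noncomputable def Flk (k l : ℕ) : Set (Fin k → ℝ) :=
  {a | (∑ i, a i ^ 2) ≤ 1 ∧ (Finset.univ.filter fun i => a i ≠ 0).card ≤ l}

/-- For every positive integer `k`, every `1 ≤ l ≤ k/2` and every `0 < δ < 1`,
`N(F_l^k, δ B₂^k) ≤ e^{3l(log(k/l) + log(2/δ))}`: there is a family of at most
`e^{3l(log(k/l) + log(2/δ))}` Euclidean balls of radius `δ` covering `F_l^k`. -/
theorem stmt15 (k : ℕ) (hk : 0 < k) (l : ℕ) (hl1 : 1 ≤ l) (hlk : (l : ℝ) ≤ k / 2)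
    (δ : ℝ) (hδ0 : 0 < δ) (hδ1 : δ < 1) :
    ∃ T : Finset (Fin k → ℝ),
      (T.card : ℝ) ≤ Real.exp (3 * l * (Real.log (k / l) + Real.log (2 / δ))) ∧
      Flk k l ⊆ ⋃ t ∈ T, {x | Real.sqrt (∑ i, (x i - t i) ^ 2) ≤ δ} := by
  classical
  have hl : (1 : ℝ) ≤ l := by exact_mod_cast hl1
  have hl0 : (0 : ℝ) < l := by linarith
  have hk0 : (0 : ℝ) < k := by exact_mod_cast hk
  have hkl : 2 * l ≤ k := by
    have : (2 : ℝ) * l ≤ k := by linarith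
    exact_mod_cast this
  set h : ℝ := δ / Real.sqrt l with hh
  have hs : 0 < Real.sqrt l := Real.sqrt_pos.2 hl0
  have hss : Real.sqrt l ^ 2 = l := Real.sq_sqrt hl0.le
  have hh0 : 0 < h := by positivity
  set M : ℕ := ⌊(l : ℝ) / δ⌋₊ with hM
  let G : Finset (Fin k → ℤ) :=
    (Fintype.piFinset (fun _ : Fin k => Finset.Icc (-(M : ℤ)) M)).filter fun z =>
      (Finset.univ.filter fun i => z i ≠ 0).card ≤ l ∧
        δ * ((∑ i, (z i).natAbs : ℕ) : ℝ) ≤ l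
  refine ⟨G.image (fun z i => h * (z i : ℝ)), ?_, ?_⟩
  · have hc := aux_count k l M hl1 hkl δ hδ0 hδ1 G (Finset.filter_subset _ _)
      (fun z hz => (Finset.mem_filter.1 hz).2.1) (fun z hz => (Finset.mem_filter.1 hz).2.2)
    have hE : Real.exp (3 * l * (Real.log (k / l) + Real.log (2 / δ)))
        = (2 * k / (l * δ)) ^ (3 * l) := by
      rw [← Real.log_mul (by positivity) (by positivity)]
      have : (3 * l : ℝ) = ((3 * l : ℕ) : ℝ) := by push_cast; ring
      rw [this, Real.exp_nat_mul, Real.exp_log (by positivity)]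
      congr 1
      field_simp
    rw [hE]
    refine le_trans ?_ hc
    exact_mod_cast Finset.card_image_le
  · intro a ha
    obtain ⟨ha1, ha2⟩ := ha
    choose z hz1 hz2 using fun i => aux_round (a i / h)
    have hza : ∀ i, a i = 0 → z i = 0 := by
      intro i hi
      have := hz1 i
      rw [hi] at this
      simpa using this
    set S := Finset.univ.filter fun i => a i ≠ 0 with hS
    have hS' : (S.card : ℝ) ≤ l := by
      have : S.card ≤ l := by convert ha2
      exact_mod_cast this
    have hsupp : (Finset.univ.filter fun i => z i ≠ 0).card ≤ l := by
      refine le_trans (Finset.card_le_card (t := S) ?_) (by exact_mod_cast hS')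
      intro i hi
      simp only [hS, Finset.mem_filter, Finset.mem_univ, true_and] at hi ⊢
      exact fun h0 => hi (hza i h0)
    have habs : ∑ i, |a i| ≤ Real.sqrt l := by
      have e : ∑ i, |a i| = ∑ i ∈ S, |a i| := by
        symm
        apply Finset.sum_subset (Finset.subset_univ _)
        intro i _ hi
        simpa [hS] using hi
      apply Real.le_sqrt_of_sq_le
      rw [e]
      calc (∑ i ∈ S, |a i|) ^ 2 ≤ S.card * ∑ i ∈ S, |a i| ^ 2 := sq_sum_le_card_mul_sum_sq
        _ ≤ l * 1 := by
            gcongr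
            simp only [sq_abs]
            exact le_trans (Finset.sum_le_univ_sum_of_nonneg fun i => sq_nonneg _) ha1
        _ = l := mul_one _
    have hsum : δ * ((∑ i, (z i).natAbs : ℕ) : ℝ) ≤ l := by
      push_cast
      simp only [Nat.cast_natAbs, Int.cast_abs]
      calc δ * ∑ i, |(z i : ℝ)| ≤ δ * ∑ i, |a i / h| := by
            exact mul_le_mul_of_nonneg_left (Finset.sum_le_sum fun i _ => hz1 i) hδ0.le
        _ = δ / h * ∑ i, |a i| := by
            rw [Finset.mul_sum, Finset.mul_sum]
            refine Finset.sum_congr rfl fun i _ => ?_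
            rw [abs_div, abs_of_pos hh0]; ring
        _ ≤ δ / h * Real.sqrt l := by gcongr
        _ = l := by rw [hh]; field_simp; exact hss
    have hbd : ∀ i, (z i).natAbs ≤ M := by
      intro i
      refine le_trans (Finset.single_le_sum (f := fun i => (z i).natAbs)
        (fun _ _ => Nat.zero_le _) (Finset.mem_univ i)) ?_
      apply Nat.le_floor
      rw [le_div_iff₀ hδ0, mul_comm]
      exact hsum
    simp only [Set.mem_iUnion, Set.mem_ofPred_eq]
    refine ⟨fun i => h * (z i : ℝ), Finset.mem_image.2 ⟨z, ?_, rfl⟩, ?_⟩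
    · refine Finset.mem_filter.2 ⟨?_, hsupp, hsum⟩
      rw [Fintype.mem_piFinset]
      intro i
      have := hbd i
      rw [Finset.mem_Icc]
      omega
    · apply Real.sqrt_le_iff.2 ⟨hδ0.le, ?_⟩
      have e : ∑ i, (a i - h * (z i : ℝ)) ^ 2 = ∑ i ∈ S, (a i - h * (z i : ℝ)) ^ 2 := by
        symm
        apply Finset.sum_subset (Finset.subset_univ _)
        intro i _ hi
        have h0 : a i = 0 := by simpa [hS] using hi
        simp [h0, hza i h0]
      rw [e]
      calc ∑ i ∈ S, (a i - h * (z i : ℝ)) ^ 2 ≤ ∑ i ∈ S, h ^ 2 := by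
            refine Finset.sum_le_sum fun i _ => ?_
            have : a i - h * (z i : ℝ) = h * (a i / h - z i) := by field_simp
            rw [this, mul_pow]
            have h3 : (a i / h - z i) ^ 2 ≤ 1 := (sq_le_one_iff_abs_le_one _).2 (hz2 i)
            nlinarith [sq_nonneg h]
        _ = S.card * h ^ 2 := by simp
        _ ≤ l * h ^ 2 := by gcongr
        _ = δ ^ 2 := by rw [hh, div_pow, hss]; field_simp
end
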